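/- arXiv:1911.01924 — 3 statements merged into one kernel-verified Lean document; each statement's English description precedes it below -/
import Mathlib

section
/- Let p, q and r be distinct primes, let 𝔚 be the class of finite groups lying in 𝔄_p𝔄_q𝔄_r, and let 𝔛 be the class of finite groups lying in 𝔄_p𝔄_q𝔄_r whose center is trivial. Then for all natural numbers α, β, γ, f_𝔚(p^α q^β r^γ) equals the sum of f_𝔛(p^{α₁} q^{β₁} r^{γ₁}) over all ordered triples (α₁, β₁, γ₁) of natural numbers with α₁ ≤ α, β₁ ≤ β and γ₁ ≤ γ. -/
/-- A group is abelian of exponent dividing `p`. -/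
def ElemAbelian (p : ℕ) (G : Type*) [Group G] : Prop :=
  (∀ a b : G, a * b = b * a) ∧ ∀ a : G, a ^ p = 1

/-- `G` lies in the product variety `𝔄_p𝔄_q`: there is a normal subgroup `N` that is
abelian of exponent dividing `p` such that `G/N` is abelian of exponent dividing `q`
(expressed by: all commutators and all `q`-th powers lie in `N`). -/
def InApAq (p q : ℕ) (G : Type*) [Group G] : Prop :=
  ∃ N : Subgroup G, N.Normal ∧ ElemAbelian p N ∧
    (∀ a b : G, a * b * a⁻¹ * b⁻¹ ∈ N) ∧ ∀ a : G, a ^ q ∈ N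

/-- `G` lies in `𝔄_p𝔄_q𝔄_r`: there is a normal subgroup `N`, abelian of exponent
dividing `p`, with `G/N ∈ 𝔄_q𝔄_r`. -/
def InApAqAr (p q r : ℕ) (G : Type*) [Group G] : Prop :=
  ∃ N : Subgroup G, ∃ _ : N.Normal, ElemAbelian p N ∧ InApAq q r (G ⧸ N)

/-- A Sylow `p`-subgroup: a `p`-subgroup whose index is coprime to `p`. -/
def IsSylow' (p : ℕ) {G : Type*} [Group G] (P : Subgroup G) : Prop :=
  IsPGroup p P ∧ Nat.Coprime P.index p

/-- Two group structures give isomorphic groups. -/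
def GroupIsoOf {α β : Type} (g : Group α) (h : Group β) : Prop :=
  letI := g; letI := h; Nonempty (α ≃* β)

/-- The number of isomorphism classes of groups of order `n` lying in the class `S`
(a class of groups closed under isomorphism, given as a predicate on group structures). -/
noncomputable def numGroups (n : ℕ) (S : (G : Type) → Group G → Prop) : ℕ :=
  Nat.card (Quot fun g h : {g : Group (Fin n) // S (Fin n) g} => GroupIsoOf g.1 h.1)


def Good (p q r : ℕ) (G : Type*) [Group G] : Prop :=
  ∃ N M : Subgroup G, N.Normal ∧ M.Normal ∧ (∀ a ∈ N, ∀ b ∈ N, a * b = b * a) ∧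
    (∀ a ∈ N, a ^ p = 1) ∧ (∀ a ∈ M, ∀ b ∈ M, a * b * a⁻¹ * b⁻¹ ∈ N) ∧
    (∀ a ∈ M, a ^ q ∈ N) ∧ (∀ a b, a * b * a⁻¹ * b⁻¹ ∈ M) ∧ ∀ a, a ^ r ∈ M

theorem good_iff (p q r : ℕ) (G : Type*) [Group G] : InApAqAr p q r G ↔ Good p q r G := by
  constructor
  · rintro ⟨N, hN, ⟨h1, h2⟩, L, hL, ⟨h3, h4⟩, h5, h6⟩
    refine ⟨N, L.comap (QuotientGroup.mk' N), hN, inferInstance, ?_, ?_, ?_, ?_, ?_, ?_⟩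
    · intro a ha b hb
      exact congrArg Subtype.val (h1 ⟨a, ha⟩ ⟨b, hb⟩)
    · intro a ha
      exact congrArg Subtype.val (h2 ⟨a, ha⟩)
    · intro a ha b hb
      have := congrArg Subtype.val (h3 ⟨_, ha⟩ ⟨_, hb⟩)
      rw [← QuotientGroup.ker_mk' N, MonoidHom.mem_ker]
      simp only [Subgroup.coe_mul] at this
      simp only [map_mul, map_inv]
      rw [this]; group
    · intro a ha
      have := congrArg Subtype.val (h4 ⟨_, ha⟩)
      rw [← QuotientGroup.ker_mk' N, MonoidHom.mem_ker]
      simpa using this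
    · intro a b
      simpa using h5 (QuotientGroup.mk' N a) (QuotientGroup.mk' N b)
    · intro a
      simpa using h6 (QuotientGroup.mk' N a)
  · rintro ⟨N, M, hN, hM, h1, h2, h3, h4, h5, h6⟩
    refine ⟨N, hN, ⟨?_, ?_⟩, M.map (QuotientGroup.mk' N), ?_, ⟨?_, ?_⟩, ?_, ?_⟩
    · rintro ⟨a, ha⟩ ⟨b, hb⟩
      exact Subtype.ext (h1 a ha b hb)
    · rintro ⟨a, ha⟩
      exact Subtype.ext (h2 a ha)
    · exact hM.map _ (QuotientGroup.mk'_surjective N)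
    · rintro ⟨_, a, ha, rfl⟩ ⟨_, b, hb, rfl⟩
      apply Subtype.ext
      have := h3 a ha b hb
      rw [← QuotientGroup.ker_mk' N, MonoidHom.mem_ker] at this
      simp only [map_mul, map_inv] at this
      simp only [Subgroup.coe_mul]
      rw [mul_inv_eq_one, mul_inv_eq_iff_eq_mul] at this
      exact this
    · rintro ⟨_, a, ha, rfl⟩
      apply Subtype.ext
      have := h4 a ha
      rw [← QuotientGroup.ker_mk' N, MonoidHom.mem_ker] at this
      simpa using this
    · intro a b
      obtain ⟨a, rfl⟩ := QuotientGroup.mk'_surjective N a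
      obtain ⟨b, rfl⟩ := QuotientGroup.mk'_surjective N b
      exact ⟨_, h5 a b, by simp⟩
    · intro a
      obtain ⟨a, rfl⟩ := QuotientGroup.mk'_surjective N a
      exact ⟨_, h6 a, by simp⟩

theorem Good.of_inj {p q r : ℕ} {G H : Type*} [Group G] [Group H] (f : H →* G)
    (hf : Function.Injective f) (h : Good p q r G) : Good p q r H := by
  obtain ⟨N, M, hN, hM, h1, h2, h3, h4, h5, h6⟩ := h
  refine ⟨N.comap f, M.comap f, inferInstance, inferInstance, ?_, ?_, ?_, ?_, ?_, ?_⟩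
  · intro a ha b hb
    apply hf
    simpa using h1 _ ha _ hb
  · intro a ha
    apply hf
    simpa using h2 _ ha
  · intro a ha b hb
    simpa using h3 _ ha _ hb
  · intro a ha
    simpa using h4 _ ha
  · intro a b
    simpa using h5 (f a) (f b)
  · intro a
    simpa using h6 (f a)

theorem Good.prod {p q r : ℕ} {G H : Type*} [Group G] [Group H] 
    (h : Good p q r G) (h' : Good p q r H) : Good p q r (G × H) := by
  obtain ⟨N, M, hN, hM, h1, h2, h3, h4, h5, h6⟩ := h
  obtain ⟨N', M', hN', hM', h1', h2', h3', h4', h5', h6'⟩ := h'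
  refine ⟨N.prod N', M.prod M', inferInstance, inferInstance, ?_, ?_, ?_, ?_, ?_, ?_⟩
  · intro a ha b hb
    exact Prod.ext (h1 _ ha.1 _ hb.1) (h1' _ ha.2 _ hb.2)
  · intro a ha
    exact Prod.ext (h2 _ ha.1) (h2' _ ha.2)
  · intro a ha b hb
    exact ⟨h3 _ ha.1 _ hb.1, h3' _ ha.2 _ hb.2⟩
  · intro a ha
    exact ⟨h4 _ ha.1, h4' _ ha.2⟩
  · intro a b
    exact ⟨h5 _ _, h5' _ _⟩
  · intro a
    exact ⟨h6 _, h6' _⟩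

theorem good_p (p q r : ℕ) (G : Type*) [CommGroup G] (h : ∀ a : G, a ^ p = 1) : Good p q r G :=
  ⟨⊤, ⊤, inferInstance, inferInstance, by intros; apply mul_comm, fun a _ => h a, by simp, by simp,
    by simp, by simp⟩

theorem good_q (p q r : ℕ) (G : Type*) [CommGroup G] (h : ∀ a : G, a ^ q = 1) : Good p q r G :=
  ⟨⊥, ⊤, inferInstance, inferInstance, by intros; apply mul_comm, by simp,
    by simp [mul_inv_eq_one, mul_inv_eq_iff_eq_mul, mul_comm], by simp [h], by simp, by simp⟩

theorem good_r (p q r : ℕ) (G : Type*) [CommGroup G] (h : ∀ a : G, a ^ r = 1) : Good p q r G :=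
  ⟨⊥, ⊥, inferInstance, inferInstance, by intros; apply mul_comm, by simp,
    by simp, by simp, 
    by intro a b; simp [mul_inv_eq_one, mul_inv_eq_iff_eq_mul, mul_comm], by simp [h]⟩

theorem Good.pow {p q r : ℕ} {G : Type*} [Group G] (h : Good p q r G) (a : G) :
    a ^ (p * q * r) = 1 := by
  obtain ⟨N, M, hN, hM, h1, h2, h3, h4, h5, h6⟩ := h
  have := h2 _ (h4 _ (h6 a))
  rw [← pow_mul, ← pow_mul] at this
  rw [← this]; congr 1; ring

/-- an element of `ℓ`-power order with coprime power trivial is trivial -/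
theorem eq_one_aux {G : Type*} [Group G] {l m : ℕ} (hc : Nat.Coprime l m) {P : Subgroup G}
    (hP : IsPGroup l P) {x : G} (hx : x ∈ P) (hm : x ^ m = 1) : x = 1 := by
  obtain ⟨k, hk⟩ := hP ⟨x, hx⟩
  have hk : x ^ l ^ k = 1 := congrArg Subtype.val hk
  have := Nat.dvd_gcd (orderOf_dvd_of_pow_eq_one hk) (orderOf_dvd_of_pow_eq_one hm)
  rw [(hc.pow_left k).gcd_eq_one] at this
  exact orderOf_eq_one_iff.1 (Nat.dvd_one.1 this)

theorem mem_aux {G : Type*} [Group G] {l m : ℕ} (hc : Nat.Coprime l m) {P : Subgroup G}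
    (hP : IsPGroup l P) (N : Subgroup G) {x : G} (hx : x ∈ P) (hm : x ^ m ∈ N) : x ∈ N := by
  obtain ⟨k, hk⟩ := hP ⟨x, hx⟩
  have hk : x ^ l ^ k = 1 := congrArg Subtype.val hk
  have h := Nat.gcd_eq_gcd_ab (l ^ k) m
  rw [(hc.pow_left k).gcd_eq_one] at h
  have : x = (x ^ m) ^ (Nat.gcdB (l ^ k) m) := by
    calc x = x ^ ((1 : ℕ) : ℤ) := by simp
      _ = _ := by
        rw [h, zpow_add, zpow_mul, zpow_mul]
        norm_cast
        rw [hk]; simp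
  rw [this]
  exact N.zpow_mem hm _

theorem Good.comm_of_pgroup {p q r : ℕ} (hp : p.Prime) (hq : q.Prime)
    (hr : r.Prime) (hpq : p ≠ q) (hpr : p ≠ r) (hqr : q ≠ r) {G : Type*} [Group G]
    (h : Good p q r G) {l : ℕ} (hl : l.Prime) (P : Subgroup G) (hP : IsPGroup l P) :
    ∀ a ∈ P, ∀ b ∈ P, a * b = b * a := by
  have cpq := (Nat.coprime_primes hp hq).2 hpq
  have cpr := (Nat.coprime_primes hp hr).2 hpr
  have cqr := (Nat.coprime_primes hq hr).2 hqr
  have hpow := h.pow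
  obtain ⟨N, M, hN, hM, h1, h2, h3, h4, h5, h6⟩ := h
  intro a ha b hb
  have hab : a * b * a⁻¹ * b⁻¹ ∈ P :=
    P.mul_mem (P.mul_mem (P.mul_mem ha hb) (P.inv_mem ha)) (P.inv_mem hb)
  have fin : a * b * a⁻¹ * b⁻¹ = 1 → a * b = b * a := by
    intro h
    rwa [mul_inv_eq_one, mul_inv_eq_iff_eq_mul] at h
  by_cases e1 : l = p
  · subst e1
    have : ∀ x ∈ P, x ∈ N := fun x hx => by
      apply mem_aux (cpr.mul_right cpq) hP N hx
      rw [pow_mul]; exact h4 _ (h6 _)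
    exact h1 _ (this a ha) _ (this b hb)
  by_cases e2 : l = q
  · subst e2
    have : ∀ x ∈ P, x ∈ M := fun x hx => mem_aux cqr hP M hx (h6 x)
    apply fin
    exact eq_one_aux cpq.symm hP hab (h2 _ (h3 _ (this a ha) _ (this b hb)))
  by_cases e3 : l = r
  · subst e3
    apply fin
    apply eq_one_aux (cqr.symm.mul_right cpr.symm) hP hab
    rw [pow_mul]
    exact h2 _ (h4 _ (h5 a b))
  · apply fin
    exact eq_one_aux ((((Nat.coprime_primes hl hp).2 e1).mul_right
      ((Nat.coprime_primes hl hq).2 e2)).mul_right ((Nat.coprime_primes hl hr).2 e3)) hP hab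
      (hpow _)

theorem center_inf_commutator {G : Type*} [Group G] [Finite G]
    (h : ∀ l : ℕ, l.Prime → ∀ P : Subgroup G, IsPGroup l P → ∀ a ∈ P, ∀ b ∈ P, a * b = b * a)
    (z : G) (hz : z ∈ Subgroup.center G) (hz' : z ∈ commutator G) : z = 1 := by
  by_contra hne
  obtain ⟨l, hl, hd⟩ := Nat.exists_prime_and_dvd (mt orderOf_eq_one_iff.1 hne)
  have := Fact.mk hl
  obtain ⟨P⟩ : Nonempty (Sylow l G) := inferInstance
  let : CommGroup P := { (inferInstance : Group P) with
    mul_comm := fun a b => Subtype.ext (h l hl P P.2 a a.2 b b.2) }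
  have key : ∀ (k : ℕ) (g₀ : G), g₀⁻¹ * z ^ k * g₀ ∈ (P : Subgroup G) →
      g₀⁻¹ * z ^ k * g₀ = z ^ k := by
    intro k g _
    have := Subgroup.mem_center_iff.1 ((Subgroup.center G).pow_mem hz k) g
    rw [mul_assoc, ← this]; group
  have e := MonoidHom.transfer_eq_pow (MonoidHom.id (P : Subgroup G)) z key
  have e2 : MonoidHom.transfer (MonoidHom.id (P : Subgroup G)) z = 1 :=
    Abelianization.commutator_subset_ker _ hz'
  rw [e2] at e
  have e3 : z ^ (P : Subgroup G).index = 1 := (congrArg Subtype.val e).symm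
  exact P.not_dvd_index (hd.trans (orderOf_dvd_of_pow_eq_one e3))

theorem exists_compl_comm {A : Type*} [CommGroup A] {m : ℕ} (hm : Squarefree m)
    (h : ∀ a : A, a ^ m = 1) (B : Subgroup A) : ∃ C : Subgroup A, IsCompl B C := by
  let : Module (ZMod m) (Additive A) := AddCommGroup.zmodModule (n := m) (fun x => h x.toMul)
  have : NeZero m := ⟨hm.ne_zero⟩
  have : IsReduced (ZMod m) := isReduced_zmod.2 (Or.inl hm)
  have : IsSemisimpleRing (ZMod m) := IsArtinianRing.isSemisimpleRing_of_isReduced _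
  let e : Subgroup A ≃o Submodule (ZMod m) (Additive A) :=
    Subgroup.toAddSubgroup.trans (AddSubgroup.toZModSubmodule m)
  obtain ⟨C, hC⟩ := exists_isCompl (e B)
  refine ⟨e.symm C, ?_⟩
  rw [e.isCompl_iff]
  simpa using hC

theorem exists_prod {G : Type*} [Group G] {m : ℕ} (hm : Squarefree m)
    (h : ∀ a : G, a ^ m = 1) (hc : ∀ z ∈ Subgroup.center G, z ∈ commutator G → z = 1) :
    ∃ K : Subgroup G, Nonempty (G ≃* K × Subgroup.center G) ∧ Subgroup.center K = ⊥ := by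
  let f : G →* Abelianization G := Abelianization.of
  have hfs : Function.Surjective f := QuotientGroup.mk'_surjective _
  have hker : ∀ x, f x = 1 ↔ x ∈ commutator G := by
    intro x
    rw [← MonoidHom.mem_ker, Abelianization.ker_of]
  obtain ⟨C, hC⟩ := exists_compl_comm (A := Abelianization G) hm (by
    intro a; obtain ⟨a, rfl⟩ := hfs a; rw [← map_pow, h, map_one]) ((Subgroup.center G).map f)
  have hd : ∀ z ∈ Subgroup.center G, z ∈ C.comap f → z = 1 := by
    intro z hz hz'
    apply hc z hz
    rw [← hker]
    exact Subgroup.disjoint_def.1 hC.disjoint ⟨z, hz, rfl⟩ hz'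
  have hs : ∀ g : G, ∃ k ∈ C.comap f, ∃ z ∈ Subgroup.center G, k * z = g := by
    intro g
    have : f g ∈ (Subgroup.center G).map f ⊔ C := by rw [hC.sup_eq_top]; trivial
    obtain ⟨_, ⟨z, hz, rfl⟩, c, hc', e⟩ := Subgroup.mem_sup.1 this
    refine ⟨g * z⁻¹, ?_, z, hz, by group⟩
    rw [Subgroup.mem_comap, map_mul, ← e, mul_comm (f z), map_inv, mul_inv_cancel_right]
    exact hc'
  refine ⟨C.comap f, ⟨?_⟩, ?_⟩
  · refine (MulEquiv.ofBijective (MonoidHom.mk' (fun x : (C.comap f) × Subgroup.center G =>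
      (x.1 : G) * x.2) ?_) ⟨?_, ?_⟩).symm
    · rintro ⟨⟨a, ha⟩, ⟨z, hz⟩⟩ ⟨⟨b, hb⟩, ⟨w, hw⟩⟩
      have := Subgroup.mem_center_iff.1 hz b
      show a * b * (z * w) = a * z * (b * w)
      rw [mul_assoc, ← mul_assoc b, this]; group
    · rw [injective_iff_map_eq_one]
      rintro ⟨⟨a, ha⟩, ⟨z, hz⟩⟩ e
      have e : a * z = 1 := e
      have hz1 : z = 1 := by
        apply hd z hz
        rw [eq_inv_of_mul_eq_one_right e]
        exact Subgroup.inv_mem _ ha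
      subst hz1
      simp at e
      subst e
      rfl
    · intro g
      obtain ⟨k, hk, z, hz, e⟩ := hs g
      exact ⟨(⟨k, hk⟩, ⟨z, hz⟩), e⟩
  · rw [eq_bot_iff]
    rintro ⟨x, hx⟩ hx'
    rw [Subgroup.mem_bot]
    apply Subtype.ext
    refine hd x ?_ hx
    rw [Subgroup.mem_center_iff]
    intro g
    obtain ⟨k, hk, z, hz, rfl⟩ := hs g
    have h1 : k * x = x * k := congrArg Subtype.val (Subgroup.mem_center_iff.1 hx' ⟨k, hk⟩)
    have h2 := Subgroup.mem_center_iff.1 hz x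
    rw [mul_assoc, ← h2, ← mul_assoc, h1, mul_assoc]

theorem iso_of_card_elem {A B : Type*} [CommGroup A] [CommGroup B] {p : ℕ} (hp : p.Prime)
    [Finite A] [Finite B]
    (hA : ∀ a : A, a ^ p = 1) (hB : ∀ a : B, a ^ p = 1) (hc : Nat.card A = Nat.card B) :
    Nonempty (A ≃* B) := by
  have := Fact.mk hp
  let : Module (ZMod p) (Additive A) := AddCommGroup.zmodModule (n := p) (fun x => hA x.toMul)
  let : Module (ZMod p) (Additive B) := AddCommGroup.zmodModule (n := p) (fun x => hB x.toMul)
  have h1 := Module.natCard_eq_pow_finrank (K := ZMod p) (V := Additive A)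
  have h2 := Module.natCard_eq_pow_finrank (K := ZMod p) (V := Additive B)
  have h3 : Nat.card (Additive A) = Nat.card (Additive B) := hc
  rw [h3, h2] at h1
  simp only [Nat.card_zmod] at h1
  have := Nat.pow_right_injective hp.two_le h1
  exact ⟨MulEquiv.toAdditive.symm (LinearEquiv.ofFinrankEq _ _ this.symm).toAddEquiv⟩

theorem pow_aux {D : Type*} [CommGroup D] {m : ℕ} (hm : Squarefree m) (hD : ∀ a : D, a ^ m = 1)
    {l : ℕ} (hl : l.Prime) (P : Subgroup D) (hP : IsPGroup l P) (a : P) : a ^ l = 1 := by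
  obtain ⟨k, hk⟩ := hP a
  have h1 : a ^ m = 1 := Subtype.ext (hD a)
  obtain ⟨i, hi, e⟩ := (Nat.dvd_prime_pow hl).1 (orderOf_dvd_of_pow_eq_one hk)
  have h2 := orderOf_dvd_of_pow_eq_one h1
  rw [e] at h2
  have : i ≤ 1 := by
    by_contra hlt
    have : l * l ∣ m := by
      rw [← pow_two]; exact (pow_dvd_pow l (by omega)).trans h2
    exact hl.one_lt.ne' (Nat.isUnit_iff.1 (hm l this))
  apply orderOf_dvd_iff_pow_eq_one.1
  rw [e]
  simpa using pow_dvd_pow l this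

theorem iso_of_card {A B : Type*} [CommGroup A] [CommGroup B] {m : ℕ} (hm : Squarefree m)
    [Finite A] [Finite B]
    (hA : ∀ a : A, a ^ m = 1) (hB : ∀ a : B, a ^ m = 1) (hc : Nat.card A = Nat.card B) :
    Nonempty (A ≃* B) := by
  have eA := Sylow.directProductOfNormal (G := A) (fun _ => inferInstance)
  have eB := Sylow.directProductOfNormal (G := B) (fun _ => inferInstance)
  rw [← hc] at eB
  refine ⟨eA.symm.trans (MulEquiv.trans (MulEquiv.piCongrRight fun l => ?_) eB)⟩
  have hl := Nat.prime_of_mem_primeFactors l.2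
  have := Fact.mk hl
  let P : Sylow l A := default
  let Q : Sylow l B := default
  letI := Sylow.unique_of_normal P inferInstance
  letI := Sylow.unique_of_normal Q inferInstance
  refine (MulEquiv.piUnique _).trans (MulEquiv.trans ?_ (MulEquiv.piUnique _).symm)
  apply Classical.choice
  apply iso_of_card_elem hl
  · exact pow_aux hm hA hl _ (default : Sylow l A).2
  · exact pow_aux hm hB hl _ (default : Sylow l B).2
  · exact (Sylow.card_eq_multiplicity (default : Sylow l A)).trans
      ((congrArg (fun n => (l : ℕ) ^ n.factorization l) hc).trans
        (Sylow.card_eq_multiplicity (default : Sylow l B)).symm)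

abbrev EG (p q r a b c : ℕ) : Type :=
  (Fin a → Multiplicative (ZMod p)) × (Fin b → Multiplicative (ZMod q)) ×
    (Fin c → Multiplicative (ZMod r))

theorem zmod_pow (p a : ℕ) (x : Fin a → Multiplicative (ZMod p)) : x ^ p = 1 := by
  ext i
  apply Multiplicative.toAdd.injective
  simp

theorem EG_good (p q r a b c : ℕ) : Good p q r (EG p q r a b c) :=
  (good_p p q r _ (zmod_pow p a)).prod
    ((good_q p q r _ (zmod_pow q b)).prod (good_r p q r _ (zmod_pow r c)))

theorem EG_card (p q r a b c : ℕ) : Nat.card (EG p q r a b c) = p ^ a * q ^ b * r ^ c := by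
  have h : ∀ n, Nat.card (Multiplicative (ZMod n)) = n := fun n => Nat.card_zmod n
  simp [Nat.card_prod, Nat.card_fun, h, mul_assoc]

theorem fst_one {H E H' E' : Type*} [Group H] [CommGroup E] [Group H'] [CommGroup E']
    (φ : H × E ≃* H' × E') (h' : Subgroup.center H' = ⊥) (z : E) : (φ (1, z)).1 = 1 := by
  rw [← Subgroup.mem_bot, ← h', Subgroup.mem_center_iff]
  intro g
  have : φ.symm (g, 1) * (1, z) = (1, z) * φ.symm (g, 1) := by
    apply Prod.ext
    · simp
    · exact mul_comm _ _
  have := congrArg (fun x => (φ x).1) this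
  simpa using this

theorem snd_inv {H E H' E' : Type*} [Group H] [CommGroup E] [Group H'] [CommGroup E']
    (φ : H × E ≃* H' × E') (h : Subgroup.center H = ⊥) (x : H) :
    (φ.symm ((φ (x, 1)).1, 1)).1 = x := by
  have e : ((φ (x, 1)).1, (1 : E')) = φ (x, 1) * (1, (φ (x, 1)).2⁻¹) := by
    apply Prod.ext <;> simp
  rw [e, map_mul, Prod.fst_mul, fst_one φ.symm h]
  simp

theorem iso_of_prod {H E H' E' : Type*} [Group H] [CommGroup E] [Group H'] [CommGroup E']
    (φ : H × E ≃* H' × E') (h : Subgroup.center H = ⊥) (h' : Subgroup.center H' = ⊥) :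
    Nonempty (H ≃* H') :=
  ⟨{ toFun := fun x => (φ (x, 1)).1
     invFun := fun x => (φ.symm (x, 1)).1
     left_inv := snd_inv φ h
     right_inv := snd_inv φ.symm h'
     map_mul' := fun x y => by
      rw [← Prod.fst_mul, ← map_mul]; simp }⟩

theorem center_iso {X Y : Type*} [Group X] [Group Y] (e : X ≃* Y)
    (h : Subgroup.center X = ⊥) : Subgroup.center Y = ⊥ := by
  rw [eq_bot_iff]
  intro y hy
  have : e.symm y ∈ Subgroup.center X := by
    rw [Subgroup.mem_center_iff] at hy ⊢
    intro g
    apply e.injective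
    simpa using hy (e g)
  rw [h, Subgroup.mem_bot] at this
  simpa using this

theorem Good.iso {p q r : ℕ} {X Y : Type*} [Group X] [Group Y] (e : X ≃* Y)
    (h : Good p q r X) : Good p q r Y := h.of_inj e.symm.toMonoidHom e.symm.injective

theorem exists_transport_aux {Y X : Type} [Group X] (e : Y ≃ X) :
    ∃ g : Group Y, GroupIsoOf g (inferInstance : Group X) :=
  ⟨e.group, ⟨e.mulEquiv⟩⟩

theorem exists_transport {n : ℕ} {X : Type} [Group X] (hn : n ≠ 0) (h : Nat.card X = n) :
    ∃ g : Group (Fin n), GroupIsoOf g (inferInstance : Group X) := by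
  have : Finite X := Nat.finite_of_card_ne_zero (h ▸ hn)
  exact exists_transport_aux (Finite.equivFinOfCardEq h).symm

theorem giso_refl {X : Type} (g : Group X) : GroupIsoOf g g := ⟨MulEquiv.refl _⟩

theorem giso_card {X Y : Type} {g : Group X} {h : Group Y} (e : GroupIsoOf g h) :
    Nat.card X = Nat.card Y := Nat.card_congr e.some.toEquiv

theorem giso_symm {X Y : Type} {g : Group X} {h : Group Y} (e : GroupIsoOf g h) :
    GroupIsoOf h g := ⟨e.some.symm⟩

theorem giso_trans {X Y Z : Type} {g : Group X} {h : Group Y} {k : Group Z} (e : GroupIsoOf g h)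
    (f : GroupIsoOf h k) : GroupIsoOf g k := ⟨e.some.trans f.some⟩

theorem giso_prod {X Y Z : Type} {g : Group X} {h : Group Y} [Group Z] (e : GroupIsoOf g h) :
    GroupIsoOf (@Prod.instGroup X Z g _) (@Prod.instGroup Y Z h _) :=
  ⟨MulEquiv.prodCongr e.some (MulEquiv.refl Z)⟩

theorem giso_quot {n : ℕ} {S : (G : Type) → Group G → Prop}
    {g h : {g : Group (Fin n) // S (Fin n) g}}
    (e : Quot.mk (fun g h : {g : Group (Fin n) // S (Fin n) g} => GroupIsoOf g.1 h.1) g =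
      Quot.mk _ h) : GroupIsoOf g.1 h.1 := by
  have := Quot.eqvGen_exact e
  rwa [Equivalence.eqvGen_iff] at this
  exact ⟨fun g => giso_refl _, giso_symm, giso_trans⟩

theorem finite_group {Y : Type} [Finite Y] : Finite (Group Y) := by
  refine Finite.of_injective (fun g : Group Y => g.mul) ?_
  intro g h e
  exact Group.ext (by ext a b; exact congrFun (congrFun e a) b)

theorem decomp {p q r : ℕ} (hp : p.Prime) (hq : q.Prime)
    (hr : r.Prime) (hpq : p ≠ q) (hpr : p ≠ r) (hqr : q ≠ r) (α β γ : ℕ) {G : Type} [Group G]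
    (hG : Good p q r G) (hc : Nat.card G = p ^ α * q ^ β * r ^ γ) :
    ∃ a b c, a ≤ α ∧ b ≤ β ∧ c ≤ γ ∧ ∃ K : Subgroup G, Nat.card K = p ^ a * q ^ b * r ^ c ∧
      Subgroup.center K = ⊥ ∧ Nonempty (G ≃* K × EG p q r (α - a) (β - b) (γ - c)) := by
  have hn : p ^ α * q ^ β * r ^ γ ≠ 0 := by
    have := hp.pos; have := hq.pos; have := hr.pos; positivity
  have : Finite G := Nat.finite_of_card_ne_zero (hc ▸ hn)
  have hm : Squarefree (p * q * r) := by
    have cpq := (Nat.coprime_primes hp hq).2 hpq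
    have cpr := (Nat.coprime_primes hp hr).2 hpr
    have cqr := (Nat.coprime_primes hq hr).2 hqr
    rw [Nat.squarefree_mul (cpr.mul_left cqr), Nat.squarefree_mul cpq]
    exact ⟨⟨hp.prime.squarefree, hq.prime.squarefree⟩, hr.prime.squarefree⟩
  obtain ⟨K, ⟨e⟩, hK⟩ := exists_prod hm hG.pow (center_inf_commutator fun l hl P hP =>
    hG.comm_of_pgroup hp hq hr hpq hpr hqr hl P hP)
  have hd := K.card_subgroup_dvd_card
  rw [hc] at hd
  obtain ⟨u, w, hu, hw, huw⟩ := (Nat.dvd_mul).1 hd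
  obtain ⟨x, y, hx, hy, hxy⟩ := (Nat.dvd_mul).1 hu
  obtain ⟨a, ha, rfl⟩ := (Nat.dvd_prime_pow hp).1 hx
  obtain ⟨b, hb, rfl⟩ := (Nat.dvd_prime_pow hq).1 hy
  obtain ⟨c, hc', rfl⟩ := (Nat.dvd_prime_pow hr).1 hw
  subst hxy
  refine ⟨a, b, c, ha, hb, hc', K, huw.symm, hK, ?_⟩
  have hcard := Nat.card_congr e.toEquiv
  rw [Nat.card_prod, hc, ← huw] at hcard
  obtain ⟨f⟩ : Nonempty (Subgroup.center G ≃* EG p q r (α - a) (β - b) (γ - c)) := by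
    letI : CommGroup (Subgroup.center G) :=
      { (inferInstance : Group (Subgroup.center G)) with
        mul_comm := fun a b => Subtype.ext (Subgroup.mem_center_iff.1 b.2 a) }
    have : Finite (EG p q r (α - a) (β - b) (γ - c)) := by
      apply Nat.finite_of_card_ne_zero
      rw [EG_card]
      have := hp.pos; have := hq.pos; have := hr.pos; positivity
    apply iso_of_card (A := Subgroup.center G) (B := EG p q r (α - a) (β - b) (γ - c)) hm
    · intro z; exact Subtype.ext (hG.pow z)
    · exact (EG_good p q r _ _ _).pow
    · rw [EG_card]
      have hpos : 0 < p ^ a * q ^ b * r ^ c := by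
        have := hp.pos; have := hq.pos; have := hr.pos; positivity
      apply Nat.eq_of_mul_eq_mul_left hpos
      rw [← hcard]
      obtain ⟨a', rfl⟩ := Nat.exists_eq_add_of_le ha
      obtain ⟨b', rfl⟩ := Nat.exists_eq_add_of_le hb
      obtain ⟨c', rfl⟩ := Nat.exists_eq_add_of_le hc'
      simp only [Nat.add_sub_cancel_left]
      ring
  exact ⟨e.trans (MulEquiv.prodCongr (MulEquiv.refl _) f)⟩

theorem exp_inj {p q r : ℕ} (hp : p.Prime) (hq : q.Prime)
    (hr : r.Prime) (hpq : p ≠ q) (hpr : p ≠ r) (hqr : q ≠ r) {a b c a' b' c' : ℕ}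
    (h : p ^ a * q ^ b * r ^ c = p ^ a' * q ^ b' * r ^ c') : a = a' ∧ b = b' ∧ c = c' := by
  have p0 := hp.ne_zero
  have q0 := hq.ne_zero
  have r0 := hr.ne_zero
  have key : ∀ l a b c, (p ^ a * q ^ b * r ^ c).factorization l =
      a * p.factorization l + b * q.factorization l + c * r.factorization l := by
    intro l a b c
    rw [Nat.factorization_mul (by positivity) (by positivity),
      Nat.factorization_mul (by positivity) (by positivity)]
    simp
  have h' := fun l => congrArg (fun n => n.factorization l) h
  simp only [key, hp.factorization, hq.factorization, hr.factorization] at h'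
  have h1 := h' p
  have h2 := h' q
  have h3 := h' r
  simp [Finsupp.single_apply, hpq, hpr, hqr, hpq.symm, hpr.symm, hqr.symm] at h1 h2 h3
  exact ⟨h1, h2, h3⟩

theorem count_abs {ι : Type} [Fintype ι] (n : ℕ) (k : ι → ℕ) (S T : (G : Type) → Group G → Prop)
    (R : ∀ i, Group (Fin (k i)) → Group (Fin n) → Prop)
    (h1 : ∀ i g, T _ g → ∃ G, S _ G ∧ R i g G)
    (h2 : ∀ G, S _ G → ∃ i g, T _ g ∧ R i g G)
    (h3 : ∀ i j g g' G G', R i g G → R j g' G' → T _ g → T _ g' → GroupIsoOf G G' →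
      i = j ∧ GroupIsoOf g g')
    (h4 : ∀ i g g' G G', R i g G → R i g' G' → GroupIsoOf g g' → GroupIsoOf G G') :
    numGroups n S = ∑ i, numGroups (k i) T := by
  unfold numGroups
  have fin : ∀ i,
      Finite (Quot fun g h : {g : Group (Fin (k i)) // T _ g} => GroupIsoOf g.1 h.1) := by
    intro i
    have := finite_group (Y := Fin (k i))
    infer_instance
  rw [← Nat.card_sigma]
  symm
  choose f hf hf' using h1
  refine Nat.card_congr (Equiv.ofBijective
    (fun x => Quot.mk _ ⟨f x.1 x.2.out.1 x.2.out.2, hf x.1 x.2.out.1 x.2.out.2⟩) ⟨?_, ?_⟩)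
  · rintro ⟨i, x⟩ ⟨j, y⟩ e
    have e := giso_quot e
    obtain ⟨rfl, e'⟩ := h3 _ _ _ _ _ _ (hf' i _ x.out.2) (hf' j _ y.out.2) x.out.2 y.out.2 e
    congr 1
    rw [← Quot.out_eq x, ← Quot.out_eq y]
    exact Quot.sound e'
  · intro y
    obtain ⟨⟨G, hG⟩, rfl⟩ := Quot.exists_rep y
    obtain ⟨i, g, hg, hR⟩ := h2 G hG
    refine ⟨⟨i, Quot.mk _ ⟨g, hg⟩⟩, ?_⟩
    apply Quot.sound
    refine h4 i _ _ _ _ (hf' i _ _) hR ?_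
    exact giso_quot (Quot.out_eq _)

/-- Version of `GroupIsoOf` with products -/
def RR {X Y : Type} (E : Type) [Group E] (g : Group X) (G : Group Y) : Prop :=
  GroupIsoOf G (@Prod.instGroup X E g _)

theorem RR_exists {p q r : ℕ} {X : Type} (g : Group X) {n a b c : ℕ} (hn : n ≠ 0)
    (hg : InApAqAr p q r X) (h : Nat.card X * (p ^ a * q ^ b * r ^ c) = n) :
    ∃ G : Group (Fin n), @InApAqAr p q r _ G ∧ RR (EG p q r a b c) g G := by
  obtain ⟨G, hG⟩ := exists_transport (X := X × EG p q r a b c) hn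
    (by rw [Nat.card_prod, EG_card, h])
  refine ⟨G, ?_, hG⟩
  rw [good_iff] at hg
  rw [@good_iff]
  exact @Good.iso _ _ _ _ _ _ G (giso_symm hG).some (hg.prod (EG_good p q r a b c))

theorem RR_surj {p q r : ℕ} (hp : p.Prime) (hq : q.Prime)
    (hr : r.Prime) (hpq : p ≠ q) (hpr : p ≠ r) (hqr : q ≠ r) (α β γ : ℕ) {Y : Type} [G : Group Y]
    (hG : InApAqAr p q r Y) (hc : Nat.card Y = p ^ α * q ^ β * r ^ γ) :
    ∃ a b c, a ≤ α ∧ b ≤ β ∧ c ≤ γ ∧ ∃ g : Group (Fin (p ^ a * q ^ b * r ^ c)),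
      (@InApAqAr p q r _ g ∧ @Subgroup.center _ g = @Bot.bot _ (@Subgroup.instBot _ g)) ∧
      RR (EG p q r (α - a) (β - b) (γ - c)) g G := by
  rw [good_iff] at hG
  obtain ⟨a, b, c, ha, hb, hc', K, hK, hZ, ⟨e⟩⟩ := decomp hp hq hr hpq hpr hqr α β γ hG hc
  have pos : p ^ a * q ^ b * r ^ c ≠ 0 := by
    have := hp.pos; have := hq.pos; have := hr.pos
    positivity
  obtain ⟨g, hg⟩ := exists_transport (X := K) pos hK
  refine ⟨a, b, c, ha, hb, hc', g, ⟨?_, ?_⟩, ?_⟩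
  · rw [@good_iff]
    exact @Good.iso _ _ _ _ _ _ g (giso_symm hg).some (hG.of_inj K.subtype K.subtype_injective)
  · exact @center_iso _ _ _ g (giso_symm hg).some hZ
  · exact giso_trans (⟨e⟩ : GroupIsoOf G (inferInstance : Group (K × _))) (giso_prod (giso_symm hg))

theorem RR_inj {X X' Y Y' E E' : Type} [CommGroup E] [CommGroup E'] {g : Group X} {g' : Group X'}
    {G : Group Y} {G' : Group Y'} (h : RR E g G) (h' : RR E' g' G')
    (hz : Subgroup.center X = ⊥) (hz' : Subgroup.center X' = ⊥) (e : GroupIsoOf G G') :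
    GroupIsoOf g g' :=
  iso_of_prod (giso_trans (giso_symm h) (giso_trans e h')).some hz hz'

theorem RR_congr {X X' Y Y' E : Type} [Group E] {g : Group X} {g' : Group X'}
    {G : Group Y} {G' : Group Y'} (h : RR E g G) (h' : RR E g' G') (e : GroupIsoOf g g') :
    GroupIsoOf G G' :=
  giso_trans h (giso_trans (giso_prod e) (giso_symm h'))

theorem count_ApAqAr_eq_sum_trivial_centre (p q r : ℕ) (hp : p.Prime) (hq : q.Prime)
    (hr : r.Prime) (hpq : p ≠ q) (hpr : p ≠ r) (hqr : q ≠ r) (α β γ : ℕ) :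
    numGroups (p ^ α * q ^ β * r ^ γ) (fun G g => letI := g; InApAqAr p q r G) =
      ∑ α₁ ∈ Finset.range (α + 1), ∑ β₁ ∈ Finset.range (β + 1),
        ∑ γ₁ ∈ Finset.range (γ + 1),
          numGroups (p ^ α₁ * q ^ β₁ * r ^ γ₁)
            (fun G g => letI := g; InApAqAr p q r G ∧ Subgroup.center G = ⊥) := by
  have pos : ∀ a b c, p ^ a * q ^ b * r ^ c ≠ 0 := by
    have := hp.pos; have := hq.pos; have := hr.pos
    intros; positivity
  simp only [Finset.sum_range]
  simp only [← Fintype.sum_prod_type']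
  refine count_abs _
    (fun i : Fin (α + 1) × Fin (β + 1) × Fin (γ + 1) =>
      p ^ (i.1 : ℕ) * q ^ (i.2.1 : ℕ) * r ^ (i.2.2 : ℕ)) _ _
    (fun i g G => RR (EG p q r (α - i.1) (β - i.2.1) (γ - i.2.2)) g G) ?_ ?_ ?_ ?_
  · rintro ⟨⟨a, ha⟩, ⟨b, hb⟩, ⟨c, hc⟩⟩ g hg
    refine RR_exists g (pos _ _ _) hg.1 ?_
    rw [Nat.card_eq_fintype_card, Fintype.card_fin]
    obtain ⟨a', rfl⟩ := Nat.exists_eq_add_of_le (Nat.le_of_lt_succ ha)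
    obtain ⟨b', rfl⟩ := Nat.exists_eq_add_of_le (Nat.le_of_lt_succ hb)
    obtain ⟨c', rfl⟩ := Nat.exists_eq_add_of_le (Nat.le_of_lt_succ hc)
    simp only [Nat.add_sub_cancel_left]
    ring
  · intro G hG
    obtain ⟨a, b, c, ha, hb, hc, g, hg, hR⟩ := RR_surj hp hq hr hpq hpr hqr α β γ hG
      (by rw [Nat.card_eq_fintype_card, Fintype.card_fin])
    exact ⟨⟨⟨a, Nat.lt_succ_of_le ha⟩, ⟨b, Nat.lt_succ_of_le hb⟩, ⟨c, Nat.lt_succ_of_le hc⟩⟩,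
      g, hg, hR⟩
  · rintro ⟨a, b, c⟩ ⟨a', b', c'⟩ g g' G G' h h' hg hg' e
    have e2 := RR_inj h h' hg.2 hg'.2 e
    refine ⟨?_, e2⟩
    have e3 := giso_card e2
    simp only [Nat.card_eq_fintype_card, Fintype.card_fin] at e3
    obtain ⟨h1, h2, h3⟩ := exp_inj hp hq hr hpq hpr hqr e3
    exact Prod.ext (Fin.ext h1) (Prod.ext (Fin.ext h2) (Fin.ext h3))
  · intro i g g' G G' h h' e
    exact RR_congr h h' e
end

section
/- Let n be a squarefree natural number. Then f(n) = Σ_{m | n} Π_{p} (p^{c(p)} − 1)/(p − 1), where the product ranges over the prime divisors p of n/m, and c(p) denotes the number of prime divisors q of m such that q ≡ 1 (mod p). -/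
open Subgroup

/-- The centralizer of the commutator subgroup. -/
def holF (G : Type*) [Group G] : Subgroup G := centralizer (commutator G : Set G)

lemma mem_holF {G : Type*} [Group G] {x : G} :
    x ∈ holF G ↔ ∀ y ∈ commutator G, y * x = x * y := by
  simp [holF, mem_centralizer_iff]

instance holF_normal (G : Type*) [Group G] : (holF G).Normal := by
  unfold holF; infer_instance

lemma holF_comm {G : Type*} [Group G] [Finite G] [IsZGroup G] (x y : holF G) : x * y = y * x := by
  refine commutative_of_cyclic_center_quotient
    ((Abelianization.of (G := G)).comp (holF G).subtype) ?_ x y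
  intro z hz
  rw [Subgroup.mem_center_iff]
  intro w
  have hz' : (z : G) ∈ commutator G := by
    rw [MonoidHom.mem_ker] at hz
    simpa [← Abelianization.ker_of, MonoidHom.mem_ker] using hz
  apply Subtype.ext
  exact (mem_holF.1 w.2 z hz').symm

lemma holF_cyclic {G : Type*} [Group G] [Finite G] [IsZGroup G] : IsCyclic (holF G) := by
  letI : CommGroup (holF G) := { (inferInstance : Group (holF G)) with mul_comm := holF_comm }
  infer_instance

lemma holF_self {G : Type*} [Group G] [Finite G] [IsZGroup G] {x : G}
    (hx : ∀ y ∈ holF G, y * x = x * y) : x ∈ holF G := by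
  rw [mem_holF]
  intro y hy
  apply hx
  have := IsZGroup.isCyclic_commutator (G := G)
  rw [mem_holF]
  intro z hz
  letI : CommGroup (commutator G) := IsCyclic.commGroup
  exact congrArg Subtype.val (mul_comm (⟨z, hz⟩ : commutator G) ⟨y, hy⟩)

lemma holF_eq {G : Type*} [Group G] [Finite G] [IsZGroup G] (K : Subgroup G)
    (h1 : ∀ x ∈ K, ∀ y ∈ K, x * y = y * x) (h2 : commutator G ≤ K)
    (h3 : ∀ x, (∀ y ∈ K, y * x = x * y) → x ∈ K) : holF G = K := by
  have hK : K ≤ holF G := fun x hx => mem_holF.2 fun y hy => h1 _ (h2 hy) _ hx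
  refine le_antisymm ?_ hK
  intro x hx
  apply h3
  intro y hy
  exact congrArg Subtype.val (holF_comm ⟨y, hK hy⟩ ⟨x, hx⟩)

lemma holF_map {G H : Type*} [Group G] [Group H] (e : G ≃* H) (x : G) :
    e x ∈ holF H ↔ x ∈ holF G := by
  have hc : (commutator G).map (e : G →* H) = commutator H := by
    rw [commutator_def, commutator_def, Subgroup.map_commutator,
      Subgroup.map_top_of_surjective _ e.surjective]
  rw [mem_holF, mem_holF, ← hc]
  constructor
  · intro h y hy
    have := h (e y) ⟨y, hy, rfl⟩
    rw [← map_mul, ← map_mul] at this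
    exact e.injective this
  · rintro h _ ⟨y, hy, rfl⟩
    have := h y hy
    simp [← map_mul, this]

section model
variable {N : Type*} [CommGroup N] [Finite N] [IsCyclic N]

lemma mulAut_pow (s : MulAut N) : ∃ k : ℤ, ∀ x, s x = x ^ k := by
  obtain ⟨k, hk⟩ := MonoidHom.map_cyclic (s : N →* N)
  exact ⟨k, fun x => hk x⟩

lemma mulAut_comm (s t : MulAut N) : s * t = t * s := by
  obtain ⟨k, hk⟩ := mulAut_pow s
  obtain ⟨l, hl⟩ := mulAut_pow t
  ext x
  simp [MulAut.mul_apply, hk, hl, ← zpow_mul, mul_comm k l]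

open SemidirectProduct

lemma holF_model (S : Subgroup (MulAut N)) (h : Squarefree (Nat.card (N ⋊[S.subtype] S))) :
    holF (N ⋊[S.subtype] S) = (inl : N →* N ⋊[S.subtype] S).range := by
  have : Finite (N ⋊[S.subtype] S) := Nat.finite_of_card_ne_zero h.ne_zero
  have : IsZGroup (N ⋊[S.subtype] S) := IsZGroup.of_squarefree h
  apply holF_eq
  · rintro _ ⟨a, rfl⟩ _ ⟨b, rfl⟩
    rw [← map_mul, ← map_mul, mul_comm]
  · rw [range_inl_eq_ker_rightHom]
    letI : CommGroup S := { (inferInstance : Group S) with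
      mul_comm := fun a b => Subtype.ext (mulAut_comm _ _) }
    exact Abelianization.commutator_subset_ker _
  · intro x hx
    rw [range_inl_eq_ker_rightHom, MonoidHom.mem_ker, rightHom_eq_right]
    apply Subtype.ext
    ext y
    have := congrArg SemidirectProduct.left (hx _ ⟨y, rfl⟩)
    simp at this
    rw [mul_comm] at this
    simpa using (mul_left_cancel this).symm

lemma model_le (S T : Subgroup (MulAut N)) (h : Squarefree (Nat.card (N ⋊[S.subtype] S)))
    (θ : N ⋊[S.subtype] S ≃* N ⋊[T.subtype] T) : S ≤ T := by
  have h' : Squarefree (Nat.card (N ⋊[T.subtype] T)) := by rwa [← Nat.card_congr θ.toEquiv]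
  have hα : ∀ x : N, ∃ y : N, inl y = θ (inl x) := by
    intro x
    have : θ (inl x) ∈ holF _ := (holF_map θ _).2 (by rw [holF_model S h]; exact ⟨x, rfl⟩)
    rw [holF_model T h'] at this
    exact this
  choose α hα using hα
  have hinj : Function.Injective α := by
    intro x y hxy
    have := congrArg (inl : N →* N ⋊[T.subtype] T) hxy
    rw [hα, hα] at this
    exact inl_injective (θ.injective this)
  have hsurj : Function.Surjective α := Finite.surjective_of_injective hinj
  intro s hs
  obtain ⟨k, hk⟩ := mulAut_pow s
  have key : s = ((θ (inr ⟨s, hs⟩)).right : MulAut N) := by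
    ext y
    obtain ⟨x, rfl⟩ := hsurj y
    have e1 : θ (inr ⟨s, hs⟩) * θ (inl x) = θ (inl x) ^ k * θ (inr ⟨s, hs⟩) := by
      rw [← map_zpow, ← map_mul, ← map_mul, ← map_zpow, ← hk]
      congr 1
      ext <;> simp
    rw [← hα, ← map_zpow] at e1
    have := congrArg SemidirectProduct.left e1
    simp [-map_zpow] at this
    rw [mul_comm] at this
    rw [hk]
    exact (mul_right_cancel this).symm
  rw [key]
  exact (θ (inr ⟨s, hs⟩)).right.2

lemma model_eq (S T : Subgroup (MulAut N)) (h : Squarefree (Nat.card (N ⋊[S.subtype] S)))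
    (θ : N ⋊[S.subtype] S ≃* N ⋊[T.subtype] T) : S = T :=
  le_antisymm (model_le S T h θ)
    (model_le T S (by rwa [← Nat.card_congr θ.toEquiv]) θ.symm)

lemma model_card {N' : Type*} [CommGroup N'] [Finite N'] [IsCyclic N']
    (S : Subgroup (MulAut N)) (T : Subgroup (MulAut N'))
    (h : Squarefree (Nat.card (N ⋊[S.subtype] S)))
    (θ : N ⋊[S.subtype] S ≃* N' ⋊[T.subtype] T) : Nat.card N = Nat.card N' := by
  have h' : Squarefree (Nat.card (N' ⋊[T.subtype] T)) := by rwa [← Nat.card_congr θ.toEquiv]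
  have e1 : Nat.card N = Nat.card (holF (N ⋊[S.subtype] S)) := by
    rw [holF_model S h]
    exact Nat.card_congr (MonoidHom.ofInjective inl_injective).toEquiv
  have e2 : Nat.card N' = Nat.card (holF (N' ⋊[T.subtype] T)) := by
    rw [holF_model T h']
    exact Nat.card_congr (MonoidHom.ofInjective inl_injective).toEquiv
  rw [e1, e2]
  exact Nat.card_congr (θ.toEquiv.subtypeEquiv fun x => (holF_map θ x).symm)
end model

open SemidirectProduct in
lemma exists_model {G : Type*} [Group G] (h : Squarefree (Nat.card G)) :
    ∃ m, m ∣ Nat.card G ∧ ∃ S : Subgroup (MulAut (Multiplicative (ZMod m))),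
      Nat.card S = Nat.card G / m ∧
      Nonempty (Multiplicative (ZMod m) ⋊[S.subtype] S ≃* G) := by
  have : Finite G := Nat.finite_of_card_ne_zero h.ne_zero
  have : IsZGroup G := IsZGroup.of_squarefree h
  have := holF_cyclic (G := G)
  have hci := (holF G).card_mul_index
  have hcop : Nat.Coprime (Nat.card (holF G)) (holF G).index := by
    rw [← hci] at h; exact Nat.coprime_of_squarefree_mul h
  obtain ⟨K, hK⟩ := exists_right_complement'_of_coprime hcop
  let e : holF G ≃* Multiplicative (ZMod (Nat.card (holF G))) := (zmodCyclicMulEquiv ‹_›).symm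
  have e1 := mulEquivSubgroup hK
  have e2 := (congr' (φ₁ := ((holF G).normalizerMonoidHom).comp
    (inclusion ((holF G).normalizer_eq_top ▸ le_top))) e (MulEquiv.refl K))
  let φ := MonoidHom.comp (MulAut.congr e).toMonoidHom (((holF G).normalizerMonoidHom.comp
    (inclusion (K := normalizer (holF G : Set G)) (H := K) ((holF G).normalizer_eq_top ▸ le_top))).comp
      ((MulEquiv.refl K).symm.toMonoidHom : K →* K))
  have hinj : Function.Injective φ := by
    rw [injective_iff_map_eq_one]
    intro k hk
    have hk2 : (holF G).normalizerMonoidHom (inclusion (K := normalizer (holF G : Set G)) (H := K)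
      ((holF G).normalizer_eq_top ▸ le_top) k) = 1 := (MulAut.congr e).injective (by
        rw [map_one]; exact hk)
    have hkF : (k : G) ∈ holF G := by
      apply holF_self
      intro y hy
      have := congrArg Subtype.val (DFunLike.congr_fun hk2 ⟨y, hy⟩)
      simp at this
      exact (mul_inv_eq_iff_eq_mul.1 this).symm
    have := (Subgroup.disjoint_def.1 hK.disjoint) hkF k.2
    exact Subtype.ext this
  refine ⟨Nat.card (holF G), (holF G).card_subgroup_dvd_card, φ.range, ?_, ⟨?_⟩⟩
  · rw [← Nat.card_congr (MonoidHom.ofInjective hinj).toEquiv, ← hK.card_mul,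
      Nat.mul_div_cancel_left _ Nat.card_pos]
  · refine MulEquiv.trans (MulEquiv.symm ?_) (e2.symm.trans e1)
    refine congr (MulEquiv.refl _) (MonoidHom.ofInjective hinj) ?_
    intro g
    ext x
    rfl

lemma card_orderOf_mul {A : Type*} [CommGroup A] [Finite A] {a b : ℕ} (hab : a.Coprime b)
    (ha : a ≠ 0) (hb : b ≠ 0) :
    Nat.card {x : A // orderOf x = a * b} =
      Nat.card {x : A // orderOf x = a} * Nat.card {x : A // orderOf x = b} := by
  rw [← Nat.card_prod]
  symm
  refine Nat.card_congr (Equiv.ofBijective (fun z => ⟨z.1.1 * z.2.1, ?_⟩) ⟨?_, ?_⟩)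
  · rw [(Commute.all _ _).orderOf_mul_eq_mul_orderOf_of_coprime] <;> rw [z.1.2, z.2.2]
    exact hab
  · rintro ⟨⟨x, hx⟩, ⟨y, hy⟩⟩ ⟨⟨x', hx'⟩, ⟨y', hy'⟩⟩ h
    have h : x * y = x' * y' := congrArg Subtype.val h
    have h1 : x * x'⁻¹ = y' * y⁻¹ := by
      rw [mul_inv_eq_iff_eq_mul, eq_comm, mul_comm, ← mul_assoc, ← h, mul_inv_cancel_right]
    have h2 : (x * x'⁻¹) ^ a = 1 := by
      rw [mul_pow, inv_pow, ← hx, pow_orderOf_eq_one, hx, ← hx', pow_orderOf_eq_one]; simp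
    have h3 : (x * x'⁻¹) ^ b = 1 := by
      rw [h1, mul_pow, inv_pow, ← hy, pow_orderOf_eq_one, hy, ← hy', pow_orderOf_eq_one]; simp
    have h4 : x * x'⁻¹ = 1 := by
      rw [← orderOf_eq_one_iff]
      exact Nat.eq_one_of_dvd_coprimes hab (orderOf_dvd_of_pow_eq_one h2)
        (orderOf_dvd_of_pow_eq_one h3)
    have h5 : x = x' := mul_inv_eq_one.1 h4
    subst h5
    have h6 : y = y' := mul_left_cancel h
    subst h6
    rfl
  · rintro ⟨z, hz⟩
    have hu := Int.isCoprime_iff_gcd_eq_one.2 (by simpa using hab : Int.gcd a b = 1)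
    obtain ⟨u, v, huv⟩ := hu
    have hza : orderOf (z ^ a) = b := by
      rw [orderOf_pow, hz, Nat.gcd_mul_right_left, Nat.mul_div_cancel_left _ (Nat.pos_of_ne_zero ha)]
    have hzb : orderOf (z ^ b) = a := by
      rw [orderOf_pow, hz, Nat.gcd_mul_left_left, Nat.mul_div_cancel _ (Nat.pos_of_ne_zero hb)]
    have hz0 : (z ^ (b : ℤ)) ^ v * (z ^ (a : ℤ)) ^ u = z := by
      rw [← zpow_mul, ← zpow_mul, ← zpow_add, mul_comm _ v, mul_comm _ u, add_comm, huv, zpow_one]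
    have d1 : orderOf ((z ^ (b : ℤ)) ^ v) ∣ a := by
      rw [zpow_natCast, ← hzb]; exact orderOf_dvd_of_mem_zpowers ⟨v, rfl⟩
    have d2 : orderOf ((z ^ (a : ℤ)) ^ u) ∣ b := by
      rw [zpow_natCast, ← hza]; exact orderOf_dvd_of_mem_zpowers ⟨u, rfl⟩
    have hprod : orderOf ((z ^ (b : ℤ)) ^ v) * orderOf ((z ^ (a : ℤ)) ^ u) = a * b := by
      rw [← (Commute.all _ _).orderOf_mul_eq_mul_orderOf_of_coprime
        (Nat.Coprime.of_dvd d1 d2 hab), hz0, hz]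
    have e1 : orderOf ((z ^ (b : ℤ)) ^ v) = a := by
      refine Nat.dvd_antisymm d1 ?_
      exact (Nat.Coprime.of_dvd_right d2 hab).dvd_of_dvd_mul_right (hprod ▸ Nat.dvd_mul_right a b)
    have e2 : orderOf ((z ^ (a : ℤ)) ^ u) = b := by
      rw [e1] at hprod
      exact Nat.eq_of_mul_eq_mul_left (Nat.pos_of_ne_zero ha) hprod
    exact ⟨⟨⟨_, e1⟩, ⟨_, e2⟩⟩, Subtype.ext hz0⟩

lemma card_orderOf_prod {A : Type*} [CommGroup A] [Finite A] (d : ℕ) (hd : Squarefree d) :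
    Nat.card {x : A // orderOf x = d} =
      ∏ p ∈ d.primeFactors, Nat.card {x : A // orderOf x = p} := by
  induction d using induction_on_primes with
  | zero => simp at hd
  | one => simp
  | prime_mul p d hp ih =>
    have hc := Nat.coprime_of_squarefree_mul hd
    have hd' := hd.of_mul_right
    rw [card_orderOf_mul hc hp.ne_zero hd'.ne_zero, ih hd', hc.primeFactors_mul,
      Finset.prod_union hc.disjoint_primeFactors, hp.primeFactors, Finset.prod_singleton]

lemma card_subgroup_mul {A : Type*} [CommGroup A] [Finite A] (d : ℕ) (hd : Squarefree d) :
    Nat.card {S : Subgroup A // Nat.card S = d} * d.totient = Nat.card {x : A // orderOf x = d} := by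
  classical
  have := Fintype.ofFinite A
  let f : {x : A // orderOf x = d} → {S : Subgroup A // Nat.card S = d} :=
    fun x => ⟨zpowers x.1, by rw [Nat.card_zpowers, x.2]⟩
  have hf : ∀ S, Nat.card {x // f x = S} = d.totient := by
    rintro ⟨S, hS⟩
    have : IsZGroup S := IsZGroup.of_squarefree (hS ▸ hd)
    have hSc : IsCyclic S := inferInstance
    have h1 := IsCyclic.card_orderOf_eq_totient (α := S) (d := d) (by rw [← Nat.card_eq_fintype_card, hS])
    rw [← h1, ← Fintype.card_subtype, ← Nat.card_eq_fintype_card]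
    refine Nat.card_congr
      { toFun := fun x => ⟨⟨x.1.1, ?_⟩, ?_⟩
        invFun := fun y => ⟨⟨y.1.1, ?_⟩, ?_⟩
        left_inv := fun x => rfl
        right_inv := fun y => rfl }
    · have := congrArg Subtype.val x.2
      change zpowers x.1.1 = S at this
      exact this.le (mem_zpowers _)
    · rw [← Subgroup.orderOf_coe]; exact x.1.2
    · rw [Subgroup.orderOf_coe]; exact y.2
    · apply Subtype.ext
      change zpowers y.1.1 = S
      apply Subgroup.eq_of_le_of_card_ge
      · rw [zpowers_le]; exact y.1.2
      · rw [hS, Nat.card_zpowers, Subgroup.orderOf_coe, y.2]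
  rw [← Nat.card_congr (Equiv.sigmaFiberEquiv f), Nat.card_sigma]
  rw [Finset.sum_congr rfl (fun S _ => hf S)]
  simp [-Nat.card_eq_fintype_card, ← Nat.card_eq_fintype_card]

lemma card_ker_units (m p : ℕ) (hm : Squarefree m) (hp : p.Prime) :
    Nat.card {x : (ZMod m)ˣ // x ^ p = 1} =
      p ^ ((m.primeFactors.filter fun q => q % p = 1).card) := by
  induction m using induction_on_primes with
  | zero => simp at hm
  | one =>
    have : Subsingleton (ZMod 1)ˣ := inferInstance
    simp [Fintype.card_subtype, Subsingleton.elim _ (1 : (ZMod 1)ˣ)]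
  | prime_mul q m hq ih =>
    have hc := Nat.coprime_of_squarefree_mul hm
    have hm' := hm.of_mul_right
    have := Fact.mk hq
    have : NeZero m := ⟨hm'.ne_zero⟩
    let e : (ZMod (q * m))ˣ ≃* (ZMod q)ˣ × (ZMod m)ˣ :=
      (Units.mapEquiv (ZMod.chineseRemainder hc).toMulEquiv).trans MulEquiv.prodUnits
    have e2 : {x : (ZMod (q * m))ˣ // x ^ p = 1} ≃
        {x : (ZMod q)ˣ // x ^ p = 1} × {x : (ZMod m)ˣ // x ^ p = 1} :=
      (e.toEquiv.subtypeEquiv (q := fun y => y.1 ^ p = 1 ∧ y.2 ^ p = 1) (by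
        intro x
        rw [← e.injective.eq_iff, map_pow, map_one, Prod.ext_iff]; rfl)).trans
        (Equiv.subtypeProdEquivProd (p := fun x : (ZMod q)ˣ => x ^ p = 1)
          (q := fun x : (ZMod m)ˣ => x ^ p = 1))
    have h1 : Nat.card {x : (ZMod q)ˣ // x ^ p = 1} = if q % p = 1 then p else 1 := by
      have := IsCyclic.card_powMonoidHom_ker (ZMod q)ˣ p
      rw [Nat.card_eq_fintype_card (α := (ZMod q)ˣ), ZMod.card_units] at this
      have h2 : Nat.card {x : (ZMod q)ˣ // x ^ p = 1} = (q - 1).gcd p := this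
      rw [h2]
      have h3 : q % p = 1 ↔ p ∣ q - 1 := by
        rw [← Nat.modEq_iff_dvd' hq.one_lt.le, Nat.ModEq, Nat.mod_eq_of_lt hp.one_lt, eq_comm]
      split_ifs with h
      · exact Nat.gcd_eq_right (h3.1 h)
      · exact ((Nat.Prime.coprime_iff_not_dvd hp).2 (fun h' => h (h3.2 h'))).symm
    rw [Nat.card_congr e2, Nat.card_prod, ih hm', h1, hc.primeFactors_mul, hq.primeFactors,
      Finset.filter_union, Finset.card_union_of_disjoint, pow_add, Finset.filter_singleton]
    · split_ifs <;> simp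
    · apply Finset.disjoint_filter_filter
      rw [← hq.primeFactors]
      exact hc.disjoint_primeFactors

lemma card_orderOf_prime {A : Type*} [CommGroup A] [Finite A] {p : ℕ} (hp : p.Prime) :
    Nat.card {x : A // orderOf x = p} = Nat.card {x : A // x ^ p = 1} - 1 := by
  classical
  have := Fintype.ofFinite A
  have := Fact.mk hp
  simp only [Nat.card_eq_fintype_card, Fintype.card_subtype]
  rw [← Finset.card_erase_of_mem (a := (1 : A)) (by simp)]
  congr 1
  ext x
  simp only [Finset.mem_filter, Finset.mem_univ, true_and, Finset.mem_erase]
  rw [orderOf_eq_prime_iff, and_comm]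

lemma card_subgroups (m d : ℕ) (hm : Squarefree m) (hd : Squarefree d) :
    Nat.card {S : Subgroup (MulAut (Multiplicative (ZMod m))) // Nat.card S = d} =
     ∏ p ∈ d.primeFactors, (p ^ ((m.primeFactors.filter fun q => q % p = 1).card) - 1) / (p - 1) := by
  have : NeZero m := ⟨hm.ne_zero⟩
  have e : MulAut (Multiplicative (ZMod m)) ≃* (ZMod m)ˣ :=
    (IsCyclic.mulAutMulEquiv (Multiplicative (ZMod m))).trans
      (Units.mapEquiv (ZMod.ringEquivCongr (by simp)).toMulEquiv)
  rw [Nat.card_congr (e.mapSubgroup.toEquiv.subtypeEquiv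
    (q := fun S : Subgroup (ZMod m)ˣ => Nat.card S = d) (fun S => by
      show _ ↔ Nat.card (e.mapSubgroup S) = d
      rw [Subgroup.card_mapSubgroup]))]
  have h := card_subgroup_mul (A := (ZMod m)ˣ) d hd
  rw [card_orderOf_prod d hd] at h
  have ht : d.totient = ∏ p ∈ d.primeFactors, (p - 1) := by
    have := Nat.totient_mul_prod_primeFactors d
    rw [Nat.prod_primeFactors_of_squarefree hd, mul_comm] at this
    exact Nat.eq_of_mul_eq_mul_left (Nat.pos_of_ne_zero hd.ne_zero) this
  have hpos : 0 < d.totient := Nat.totient_pos.2 (Nat.pos_of_ne_zero hd.ne_zero)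
  apply Nat.eq_of_mul_eq_mul_right hpos
  rw [h, ht, ← Finset.prod_mul_distrib]
  refine Finset.prod_congr rfl fun p hp => ?_
  have hp := Nat.prime_of_mem_primeFactors hp
  rw [card_orderOf_prime hp, card_ker_units m p hm hp, Nat.div_mul_cancel]
  simpa using Nat.sub_dvd_pow_sub_pow p 1 _

/-- The index type for groups of order `n`. -/
abbrev HolIdx (n : ℕ) : Type :=
  (m : n.divisors) × {S : Subgroup (MulAut (Multiplicative (ZMod m))) // Nat.card S = n / m}

/-- The model group. -/
abbrev HolModel {n : ℕ} (i : HolIdx n) : Type :=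
  Multiplicative (ZMod i.1) ⋊[i.2.1.subtype] i.2.1

lemma holModel_card {n : ℕ} (i : HolIdx n) : Nat.card (HolModel i) = n := by
  rw [SemidirectProduct.card, i.2.2]
  have : Nat.card (Multiplicative (ZMod i.1)) = i.1.1 :=
    (Nat.card_congr Multiplicative.toAdd).trans (Nat.card_zmod _)
  rw [this]
  exact Nat.mul_div_cancel' (Nat.dvd_of_mem_divisors i.1.2)

/-- A bijection from the model to `Fin n`. -/
noncomputable def holEquiv {n : ℕ} (hn : n ≠ 0) (i : HolIdx n) : HolModel i ≃ Fin n :=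
  haveI : Finite (HolModel i) := Nat.finite_of_card_ne_zero (by rw [holModel_card]; exact hn)
  Finite.equivFinOfCardEq (holModel_card i)

/-- The transported group structure. -/
noncomputable abbrev holGroup {n : ℕ} (hn : n ≠ 0) (i : HolIdx n) : Group (Fin n) :=
  (holEquiv hn i).symm.group

lemma holGroup_iso {n : ℕ} (hn : n ≠ 0) (i : HolIdx n) :
    GroupIsoOf (holGroup hn i) (inferInstance : Group (HolModel i)) :=
  ⟨letI := holGroup hn i; (holEquiv hn i).symm.mulEquiv⟩

lemma groupIsoOf_symm {α β : Type} {g : Group α} {h : Group β} (e : GroupIsoOf g h) :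
    GroupIsoOf h g := by
  obtain ⟨e⟩ := e
  exact ⟨letI := g; letI := h; e.symm⟩

lemma groupIsoOf_trans {α β γ : Type} {g : Group α} {h : Group β} {k : Group γ}
    (e : GroupIsoOf g h) (e' : GroupIsoOf h k) : GroupIsoOf g k := by
  obtain ⟨e⟩ := e
  obtain ⟨e'⟩ := e'
  exact ⟨letI := g; letI := h; letI := k; e.trans e'⟩

lemma groupIsoOf_refl {α : Type} (g : Group α) : GroupIsoOf g g :=
  ⟨letI := g; MulEquiv.refl α⟩

lemma holModel_inj {n : ℕ} (hn : Squarefree n) (i j : HolIdx n)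
    (h : GroupIsoOf (inferInstance : Group (HolModel i)) (inferInstance : Group (HolModel j))) :
    i = j := by
  obtain ⟨θ⟩ := h
  have hi : Squarefree (Nat.card (HolModel i)) := by rwa [holModel_card]
  obtain ⟨⟨m, hm⟩, S, hS⟩ := i
  obtain ⟨⟨m', hm'⟩, T, hT⟩ := j
  have : NeZero m := ⟨(Nat.pos_of_mem_divisors hm).ne'⟩
  have : NeZero m' := ⟨(Nat.pos_of_mem_divisors hm').ne'⟩
  have e := model_card (N := Multiplicative (ZMod m)) (N' := Multiplicative (ZMod m')) S T hi θ
  have e : m = m' := by simpa using e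
  subst e
  have := model_eq S T hi θ
  subst this
  rfl

theorem holder_formula (n : ℕ) (hn : Squarefree n) :
    numGroups n (fun _ _ => True) =
      ∑ m ∈ n.divisors, ∏ p ∈ (n / m).primeFactors,
        (p ^ ((m.primeFactors.filter fun q => q % p = 1).card) - 1) / (p - 1) := by
  have h1 : numGroups n (fun _ _ => True) = Nat.card (HolIdx n) := by
    unfold numGroups
    symm
    refine Nat.card_congr (Equiv.ofBijective
      (fun i => Quot.mk _ ⟨holGroup hn.ne_zero i, trivial⟩) ⟨?_, ?_⟩)
    · intro i j hij
      have hE : Equivalence (fun g h : {g : Group (Fin n) // True} => GroupIsoOf g.1 h.1) :=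
        ⟨fun g => groupIsoOf_refl _, groupIsoOf_symm, groupIsoOf_trans⟩
      have := (Quot.eqvGen_exact hij)
      rw [hE.eqvGen_iff] at this
      exact holModel_inj hn i j (groupIsoOf_trans (groupIsoOf_symm (holGroup_iso hn.ne_zero i))
        (groupIsoOf_trans this (holGroup_iso hn.ne_zero j)))
    · rintro ⟨⟨g, -⟩⟩
      have hc : Nat.card (Fin n) = n := by simp
      obtain ⟨m, hm, S, hS, e⟩ := @exists_model (Fin n) g (by rwa [hc])
      rw [hc] at hm hS
      refine ⟨⟨⟨m, Nat.mem_divisors.2 ⟨hm, hn.ne_zero⟩⟩, S, hS⟩, Quot.sound ?_⟩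
      exact groupIsoOf_trans (holGroup_iso hn.ne_zero _) e
  have hfin : ∀ m : n.divisors, Finite (MulAut (Multiplicative (ZMod m))) := fun m => by
    have : NeZero m.1 := ⟨(Nat.pos_of_mem_divisors m.2).ne'⟩
    have : Finite (Multiplicative (ZMod m)) := inferInstance
    exact Finite.of_injective (fun f : MulAut (Multiplicative (ZMod m)) => (f : _ → _))
      DFunLike.coe_injective
  rw [h1, HolIdx, Nat.card_sigma, ← Finset.sum_coe_sort n.divisors]
  refine Finset.sum_congr rfl fun m _ => ?_
  have hm := Nat.dvd_of_mem_divisors m.2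
  exact card_subgroups m (n / m) (hn.squarefree_of_dvd hm)
    (hn.squarefree_of_dvd (Nat.div_dvd_of_dvd hm))
end

section
/- There exists a constant C > 0 such that for every prime p and every natural number m, f(p^m) ≤ p^{(2/27)m³ + C·m^{8/3}}. -/
universe u

/-- Every additive family of alternating forms vanishes on a subspace whose codimension is at most
twice the rank of a suitable member of the family. -/
theorem sims_rank_lemma {K : Type*} [Field K] (n : ℕ) :
    ∀ (V : Type u) [AddCommGroup V] [Module K V] [FiniteDimensional K V]
      (L : Set (LinearMap.BilinForm K V)), Module.finrank K V = n →
      (0 : LinearMap.BilinForm K V) ∈ L → (∀ c ∈ L, ∀ c' ∈ L, c + c' ∈ L) →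
      (∀ c ∈ L, LinearMap.IsAlt c) →
      ∃ R : Submodule K V, ∃ c ∈ L, (∀ c' ∈ L, ∀ x ∈ R, ∀ y ∈ R, c' x y = 0) ∧
        2 * Module.finrank K (LinearMap.BilinForm.orthogonal c ⊤) ≤ n + Module.finrank K R := by
  induction n using Nat.strong_induction_on with
  | _ n ih =>
  intro V _ _ _ L hn h0 hadd halt
  by_cases hall : ∀ c ∈ L, c = 0
  · refine ⟨⊤, 0, h0, ?_, ?_⟩
    · intro c' hc' x _ y _
      rw [hall c' hc']; simp
    · have := Submodule.finrank_le (LinearMap.BilinForm.orthogonal (0 : LinearMap.BilinForm K V) ⊤)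
      rw [finrank_top]
      omega
  push Not at hall
  obtain ⟨c₁, hc₁, hne⟩ := hall
  set T : Submodule K V := LinearMap.BilinForm.orthogonal c₁ ⊤ with hT
  have memT : ∀ x, x ∈ T ↔ ∀ y, c₁ x y = 0 := by
    intro x
    rw [hT, LinearMap.BilinForm.mem_orthogonal_iff]
    constructor
    · intro h y
      have := h y trivial
      exact (halt c₁ hc₁).isRefl _ _ this
    · intro h y _
      exact (halt c₁ hc₁).isRefl _ _ (h y)
  have hTlt : Module.finrank K T < n := by
    rw [← hn]
    apply Submodule.finrank_lt
    intro htop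
    apply hne
    ext x y
    have : x ∈ T := by rw [htop]; trivial
    simpa using (memT x).1 this y
  obtain ⟨R', c', hc', hvan, hle⟩ := ih _ hTlt T ((fun c => c.restrict T) '' L) rfl
    ⟨0, h0, rfl⟩
    (by
      rintro _ ⟨a, ha, rfl⟩ _ ⟨b, hb, rfl⟩
      exact ⟨a + b, hadd a ha b hb, rfl⟩)
    (by
      rintro _ ⟨a, ha, rfl⟩ x
      exact halt a ha x)
  obtain ⟨c, hc, rfl⟩ := hc'
  have hRfin : Module.finrank K (R'.map T.subtype) = Module.finrank K R' :=
    Submodule.finrank_map_subtype_eq T R'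
  have hRvan : ∀ c' ∈ L, ∀ x ∈ R'.map T.subtype, ∀ y ∈ R'.map T.subtype, c' x y = 0 := by
    rintro c' hc' _ ⟨x, hx, rfl⟩ _ ⟨y, hy, rfl⟩
    exact hvan _ ⟨c', hc', rfl⟩ x hx y hy
  have hcc := hadd c hc c₁ hc₁
  have e1 := LinearMap.BilinForm.finrank_add_finrank_orthogonal (halt c hc).isRefl T
  have e2 := Submodule.finrank_sup_add_finrank_inf_eq (LinearMap.BilinForm.orthogonal c ⊤)
    (LinearMap.BilinForm.orthogonal (c + c₁) ⊤)
  have s1 : LinearMap.BilinForm.orthogonal c ⊤ ⊔ LinearMap.BilinForm.orthogonal (c + c₁) ⊤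
      ≤ LinearMap.BilinForm.orthogonal c T := by
    apply sup_le
    · intro x hx
      rw [LinearMap.BilinForm.mem_orthogonal_iff] at hx ⊢
      intro y _
      exact hx y trivial
    · intro x hx
      rw [LinearMap.BilinForm.mem_orthogonal_iff] at hx ⊢
      intro y hy
      have h1 := hx y trivial
      have h2 := (memT y).1 hy x
      simp only [LinearMap.add_apply] at h1 ⊢
      rwa [h2, add_zero] at h1
  have s2 : LinearMap.BilinForm.orthogonal c ⊤ ⊓ LinearMap.BilinForm.orthogonal (c + c₁) ⊤
      ≤ T ⊓ LinearMap.BilinForm.orthogonal c ⊤ := by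
    rintro x ⟨hx1, hx2⟩
    refine ⟨?_, hx1⟩
    rw [SetLike.mem_coe, LinearMap.BilinForm.mem_orthogonal_iff] at hx1 hx2 
    rw [SetLike.mem_coe, hT, LinearMap.BilinForm.mem_orthogonal_iff]
    intro y hy
    have h1 := hx1 y hy
    have h2 := hx2 y hy
    simp only [LinearMap.add_apply] at h1 h2 ⊢
    rwa [h1, zero_add] at h2
  have s3 : T ⊓ LinearMap.BilinForm.orthogonal c ⊤
      ≤ (LinearMap.BilinForm.orthogonal (c.restrict T) ⊤).map T.subtype := by
    rintro x ⟨hx1, hx2⟩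
    refine ⟨⟨x, hx1⟩, ?_, rfl⟩
    rw [SetLike.mem_coe, LinearMap.BilinForm.mem_orthogonal_iff] at hx2 ⊢
    intro y _
    exact hx2 y trivial
  have f1 := Submodule.finrank_mono s1
  have f2 := Submodule.finrank_mono s2
  have f3 := Submodule.finrank_mono s3
  rw [Submodule.finrank_map_subtype_eq] at f3
  by_cases hh : 2 * Module.finrank K (LinearMap.BilinForm.orthogonal c ⊤) ≤
      n + Module.finrank K R'
  · exact ⟨R'.map T.subtype, c, hc, hRvan, by rw [hRfin]; exact hh⟩
  · refine ⟨R'.map T.subtype, c + c₁, hcc, hRvan, ?_⟩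
    rw [hRfin]
    beta_reduce at hle
    omega

section potential

open Classical in
/-- The weight of a form in the potential function. -/
noncomputable def simsWeight (p h : ℕ) {V : Type*} [AddCommGroup V] [Module (ZMod p) V]
    (c : LinearMap.BilinForm (ZMod p) V) (U : Set V) : ℕ :=
  if ∀ u ∈ U, ∀ v ∈ U, c u v = 0 then
    p ^ (h * (h - Module.finrank (ZMod p) ((Submodule.span (ZMod p) U).map c))) else 0

theorem sims_card_submodule {p : ℕ} [Fact p.Prime] {V : Type*} [AddCommGroup V]
    [Module (ZMod p) V] [Finite V] (S : Submodule (ZMod p) V) :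
    Nat.card S = p ^ Module.finrank (ZMod p) S := by
  have : Module.Finite (ZMod p) S := Module.Finite.of_finite
  rw [Module.natCard_eq_pow_finrank (K := ZMod p), Nat.card_zmod]

open Classical in
theorem sims_weight_step {p : ℕ} [Fact p.Prime] (h : ℕ) {V : Type*} [AddCommGroup V]
    [Module (ZMod p) V] [Fintype V] (c : LinearMap.BilinForm (ZMod p) V)
    (hrank : 2 * h ≤ Module.finrank (ZMod p) (LinearMap.range c)) (U : Set V) :
    p ^ h * ∑ x : V, simsWeight p h c (insert x U) ≤
      2 * (Fintype.card V * simsWeight p h c U) := by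
  have hp : 1 < p := (Fact.out : p.Prime).one_lt
  have hp0 : 0 < p := by omega
  have : Module.Finite (ZMod p) V := Module.Finite.of_finite
  by_cases hU : ∀ u ∈ U, ∀ v ∈ U, c u v = 0
  swap
  · have : ∀ x : V, simsWeight p h c (insert x U) = 0 := by
      intro x
      rw [simsWeight, if_neg]
      intro hh
      exact hU fun u hu v hv => hh u (Set.mem_insert_of_mem _ hu) v (Set.mem_insert_of_mem _ hv)
    simp [this]
  have hV : Fintype.card V = p ^ Module.finrank (ZMod p) V := by
    rw [Module.card_eq_pow_finrank (K := ZMod p), ZMod.card]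
  set D : Submodule (ZMod p) (V →ₗ[ZMod p] ZMod p) := (Submodule.span (ZMod p) U).map c with hD
  have hw : simsWeight p h c U = p ^ (h * (h - Module.finrank (ZMod p) D)) := by
    rw [simsWeight, if_pos hU]
  have hmono : ∀ x, D ≤ (Submodule.span (ZMod p) (insert x U)).map c := fun x =>
    Submodule.map_mono (Submodule.span_mono (Set.subset_insert _ _))
  have hle : ∀ x, simsWeight p h c (insert x U) ≤ simsWeight p h c U := by
    intro x
    rw [hw, simsWeight]
    split_ifs
    · apply Nat.pow_le_pow_right hp0
      apply Nat.mul_le_mul_left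
      have := Submodule.finrank_mono (hmono x)
      omega
    · exact Nat.zero_le _
  by_cases hd : h ≤ Module.finrank (ZMod p) D
  · -- few vectors are orthogonal to `U`
    have hsum : ∑ x : V, simsWeight p h c (insert x U) ≤
        Nat.card D.dualCoannihilator * simsWeight p h c U := by
      have : ∑ x : V, simsWeight p h c (insert x U) ≤
          ∑ x : V, if x ∈ D.dualCoannihilator then simsWeight p h c U else 0 := by
        apply Finset.sum_le_sum
        intro x _
        split_ifs with hx
        · exact hle x
        · rw [simsWeight, if_neg]
          intro hh
          apply hx
          rw [Submodule.mem_dualCoannihilator]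
          rintro _ ⟨v, hv, rfl⟩
          refine Submodule.span_induction (p := fun v _ => c v x = 0) ?_ ?_ ?_ ?_ hv
          · intro v hv
            exact hh v (Set.mem_insert_of_mem _ hv) x (Set.mem_insert _ _)
          · simp
          · intro a b _ _ ha hb
            simp [ha, hb]
          · intro a b _ hb
            simp [hb]
      refine this.trans ?_
      rw [← Finset.sum_filter, Finset.sum_const, smul_eq_mul]
      apply Nat.mul_le_mul_right
      rw [Nat.card_eq_fintype_card, Fintype.card_subtype]
    have e : Module.finrank (ZMod p) D + Module.finrank (ZMod p) D.dualCoannihilator =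
        Module.finrank (ZMod p) V := Subspace.finrank_add_finrank_dualCoannihilator_eq D
    rw [sims_card_submodule] at hsum
    calc p ^ h * ∑ x : V, simsWeight p h c (insert x U)
        ≤ p ^ h * (p ^ Module.finrank (ZMod p) D.dualCoannihilator * simsWeight p h c U) :=
          Nat.mul_le_mul_left _ hsum
      _ = p ^ (h + Module.finrank (ZMod p) D.dualCoannihilator) * simsWeight p h c U := by
          rw [pow_add, mul_assoc]
      _ ≤ Fintype.card V * simsWeight p h c U := by
          apply Nat.mul_le_mul_right
          rw [hV]
          apply Nat.pow_le_pow_right hp0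
          omega
      _ ≤ _ := by omega
  · -- few vectors fail to increase the dimension
    push Not at hd
    set S : Submodule (ZMod p) V := D.comap c with hS
    have hSrank : Module.finrank (ZMod p) S + h ≤ Module.finrank (ZMod p) V := by
      have e1 := LinearMap.finrank_range_add_finrank_ker c
      have e2 := LinearMap.finrank_range_add_finrank_ker (c.domRestrict S)
      have e3 : LinearMap.range (c.domRestrict S) ≤ D := by
        rintro _ ⟨⟨x, hx⟩, rfl⟩
        exact hx
      have e4 := Submodule.finrank_mono e3
      have e5 : (LinearMap.ker (c.domRestrict S)).map S.subtype ≤ LinearMap.ker c := by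
        rintro _ ⟨x, hx, rfl⟩
        exact hx
      have e6 := Submodule.finrank_mono e5
      rw [Submodule.finrank_map_subtype_eq] at e6
      omega
    have hsum : p ^ h * ∑ x : V, simsWeight p h c (insert x U) ≤
        ∑ x : V, ((if x ∈ S then p ^ h * simsWeight p h c U else 0) + simsWeight p h c U) := by
      rw [Finset.mul_sum]
      apply Finset.sum_le_sum
      intro x _
      split_ifs with hx
      · have := Nat.mul_le_mul_left (p ^ h) (hle x)
        omega
      · rw [zero_add, hw, simsWeight]
        split_ifs
        · rw [← pow_add]
          apply Nat.pow_le_pow_right hp0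
          have hlt : D < (Submodule.span (ZMod p) (insert x U)).map c := by
            refine lt_of_le_of_ne (hmono x) ?_
            intro heq
            apply hx
            change c x ∈ D
            rw [heq]
            exact ⟨x, Submodule.subset_span (Set.mem_insert _ _), rfl⟩
          have h1 := Submodule.finrank_lt_finrank_of_lt hlt
          obtain ⟨k, hk⟩ : ∃ k, h - Module.finrank (ZMod p) D = k + 1 :=
            ⟨h - Module.finrank (ZMod p) D - 1, by omega⟩
          rw [hk]
          have h2 : h - Module.finrank (ZMod p) ((Submodule.span (ZMod p) (insert x U)).map c) ≤ k := by
            omega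
          have := Nat.mul_le_mul_left h h2
          rw [mul_add]
          omega
        · simp
    refine hsum.trans ?_
    rw [Finset.sum_add_distrib, ← Finset.sum_filter, Finset.sum_const, Finset.sum_const,
      smul_eq_mul, smul_eq_mul]
    have hc : (Finset.univ.filter (fun x => x ∈ S)).card = p ^ Module.finrank (ZMod p) S := by
      rw [← sims_card_submodule, Nat.card_eq_fintype_card, Fintype.card_subtype]
    rw [hc, ← mul_assoc, ← pow_add]
    have : p ^ (Module.finrank (ZMod p) S + h) ≤ Fintype.card V := by
      rw [hV]; exact Nat.pow_le_pow_right hp0 hSrank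
    have := Nat.mul_le_mul_right (simsWeight p h c U) this
    rw [Finset.card_univ]
    omega

open Classical in
theorem sims_potential {p : ℕ} [Fact p.Prime] (h m : ℕ) {V : Type*} [AddCommGroup V]
    [Module (ZMod p) V] [Fintype V] (𝒞 : Finset (LinearMap.BilinForm (ZMod p) V))
    (hrank : ∀ c ∈ 𝒞, 2 * h ≤ Module.finrank (ZMod p) (LinearMap.range c))
    (hcard : 𝒞.card ≤ p ^ m) (a : ℕ) :
    ∃ U : Finset V, U.card ≤ a ∧
      p ^ (h * a) * ∑ c ∈ 𝒞, simsWeight p h c (U : Set V) ≤ 2 ^ a * p ^ (m + h * h) := by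
  have hp : 1 < p := (Fact.out : p.Prime).one_lt
  have hp0 : 0 < p := by omega
  induction a with
  | zero =>
    refine ⟨∅, by simp, ?_⟩
    have : ∑ c ∈ 𝒞, simsWeight p h c ((∅ : Finset V) : Set V) ≤ ∑ c ∈ 𝒞, p ^ (h * h) := by
      apply Finset.sum_le_sum
      intro c _
      rw [simsWeight]
      split_ifs
      · apply Nat.pow_le_pow_right hp0
        apply Nat.mul_le_mul_left
        omega
      · exact Nat.zero_le _
    rw [Finset.sum_const, smul_eq_mul] at this
    have h2 := Nat.mul_le_mul_right (p ^ (h * h)) hcard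
    rw [pow_add]
    simpa using this.trans h2
  | succ a ih =>
    obtain ⟨U, hUc, hU⟩ := ih
    have key : ∃ x : V, p ^ h * ∑ c ∈ 𝒞, simsWeight p h c (insert x (U : Set V)) ≤
        2 * ∑ c ∈ 𝒞, simsWeight p h c (U : Set V) := by
      by_contra hcon
      push Not at hcon
      have h1 : ∑ x : V, 2 * ∑ c ∈ 𝒞, simsWeight p h c (U : Set V) <
          ∑ x : V, p ^ h * ∑ c ∈ 𝒞, simsWeight p h c (insert x (U : Set V)) :=
        Finset.sum_lt_sum_of_nonempty ⟨0, Finset.mem_univ _⟩ fun x _ => hcon x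
      rw [Finset.sum_const, smul_eq_mul, Finset.card_univ, ← Finset.mul_sum, Finset.sum_comm,
        Finset.mul_sum] at h1
      have h2 : ∑ c ∈ 𝒞, p ^ h * ∑ x : V, simsWeight p h c (insert x (U : Set V)) ≤
          ∑ c ∈ 𝒞, 2 * (Fintype.card V * simsWeight p h c (U : Set V)) :=
        Finset.sum_le_sum fun c hc => sims_weight_step h c (hrank c hc) _
      rw [← Finset.mul_sum, ← Finset.mul_sum] at h2
      have h3 := lt_of_lt_of_le h1 h2
      simp only [← Finset.mul_sum] at h3
      rw [mul_left_comm] at h3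
      exact lt_irrefl _ h3
    obtain ⟨x, hx⟩ := key
    refine ⟨insert x U, (Finset.card_insert_le _ _).trans (by omega), ?_⟩
    rw [Finset.coe_insert]
    calc p ^ (h * (a + 1)) * ∑ c ∈ 𝒞, simsWeight p h c (insert x (U : Set V))
        = p ^ (h * a) * (p ^ h * ∑ c ∈ 𝒞, simsWeight p h c (insert x (U : Set V))) := by
          rw [mul_add, pow_add, mul_one, mul_assoc]
      _ ≤ p ^ (h * a) * (2 * ∑ c ∈ 𝒞, simsWeight p h c (U : Set V)) := Nat.mul_le_mul_left _ hx
      _ = 2 * (p ^ (h * a) * ∑ c ∈ 𝒞, simsWeight p h c (U : Set V)) := by ring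
      _ ≤ 2 * (2 ^ a * p ^ (m + h * h)) := Nat.mul_le_mul_left _ hU
      _ = _ := by rw [pow_succ]; ring

theorem sims_exists_U {p : ℕ} [Fact p.Prime] (h m a : ℕ) {V : Type*} [AddCommGroup V]
    [Module (ZMod p) V] [Finite V] (𝒞 : Finset (LinearMap.BilinForm (ZMod p) V))
    (hrank : ∀ c ∈ 𝒞, 2 * h ≤ Module.finrank (ZMod p) (LinearMap.range c))
    (hcard : 𝒞.card ≤ p ^ m) (ha : m + h * h + a < h * a) :
    ∃ U : Finset V, U.card ≤ a ∧ ∀ c ∈ 𝒞, ∃ u ∈ U, ∃ v ∈ U, c u v ≠ 0 := by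
  classical
  have hp : 1 < p := (Fact.out : p.Prime).one_lt
  haveI := Fintype.ofFinite V
  obtain ⟨U, hU, hle⟩ := sims_potential h m 𝒞 hrank hcard a
  refine ⟨U, hU, fun c hc => ?_⟩
  by_contra hcon
  push Not at hcon
  have h1 : 1 ≤ simsWeight p h c (U : Set V) := by
    rw [simsWeight, if_pos (by exact_mod_cast hcon)]
    exact Nat.one_le_pow _ _ (by omega)
  have h2 : 1 ≤ ∑ c ∈ 𝒞, simsWeight p h c (U : Set V) :=
    h1.trans (Finset.single_le_sum (f := fun c => simsWeight p h c (U : Set V))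
      (fun _ _ => Nat.zero_le _) hc)
  have h3 := Nat.mul_le_mul_left (p ^ (h * a)) h2
  have h4 : 2 ^ a * p ^ (m + h * h) ≤ p ^ (m + h * h + a) := by
    rw [pow_add _ _ a, mul_comm]
    exact Nat.mul_le_mul_left _ (Nat.pow_le_pow_left hp a)
  have h5 : p ^ (m + h * h + a) < p ^ (h * a) := Nat.pow_lt_pow_right hp ha
  omega

end potential

section linear

theorem sims_extend_span {K : Type*} [Field K] {V E : Type*} [AddCommGroup V] [Module K V]
    [AddCommGroup E] [Module K E] [FiniteDimensional K E] (B : V →ₗ[K] V →ₗ[K] E) (t : ℕ) :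
    ∀ U : Finset V, Module.finrank K (Submodule.span K (Set.image2 (fun u v => B u v) Set.univ Set.univ)) ≤
      Module.finrank K (Submodule.span K (Set.image2 (fun u v => B u v) (U : Set V) U)) + t →
      ∃ U' : Finset V, U'.card ≤ U.card + 2 * t ∧
        ∀ x y, B x y ∈ Submodule.span K (Set.image2 (fun u v => B u v) (U' : Set V) U') := by
  classical
  induction t with
  | zero =>
    intro U hU
    refine ⟨U, by omega, fun x y => ?_⟩
    have hle : Submodule.span K (Set.image2 (fun u v => B u v) (U : Set V) U) ≤
        Submodule.span K (Set.image2 (fun u v => B u v) Set.univ Set.univ) :=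
      Submodule.span_mono (Set.image2_subset (Set.subset_univ _) (Set.subset_univ _))
    rw [Submodule.eq_of_le_of_finrank_le hle (by omega)]
    exact Submodule.subset_span ⟨x, trivial, y, trivial, rfl⟩
  | succ t ih =>
    intro U hU
    by_cases hall : ∀ x y, B x y ∈ Submodule.span K (Set.image2 (fun u v => B u v) (U : Set V) U)
    · exact ⟨U, by omega, hall⟩
    push Not at hall
    obtain ⟨x, y, hxy⟩ := hall
    have hlt : Submodule.span K (Set.image2 (fun u v => B u v) (U : Set V) U) <
        Submodule.span K (Set.image2 (fun u v => B u v)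
          ((insert x (insert y U) : Finset V) : Set V) ((insert x (insert y U) : Finset V) : Set V)) := by
      apply lt_of_le_of_ne
      · apply Submodule.span_mono
        apply Set.image2_subset <;>
        · intro z hz
          simp only [Finset.coe_insert]
          exact Or.inr (Or.inr hz)
      · intro heq
        apply hxy
        rw [heq]
        exact Submodule.subset_span ⟨x, by simp, y, by simp, rfl⟩
    have hlt' := Submodule.finrank_lt_finrank_of_lt hlt
    obtain ⟨U', hU', hU'2⟩ := ih (insert x (insert y U)) (by omega)
    refine ⟨U', ?_, hU'2⟩
    have h1 := Finset.card_insert_le x (insert y U)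
    have h2 := Finset.card_insert_le y U
    omega

theorem sims_linear {p : ℕ} [Fact p.Prime] (h m a : ℕ) (ha : m + h * h + a < h * a)
    {V E : Type*} [AddCommGroup V] [Module (ZMod p) V] [Finite V]
    [AddCommGroup E] [Module (ZMod p) E] [Finite E]
    (B : V →ₗ[ZMod p] V →ₗ[ZMod p] E) (halt : ∀ x, B x x = 0) (hE : Nat.card E ≤ p ^ m) :
    (∃ U : Finset V, U.card ≤ a + 2 * (h * h) ∧
      ∀ x y, B x y ∈ Submodule.span (ZMod p) (Set.image2 (fun u v => B u v) (U : Set V) U)) ∨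
    (∃ R : Submodule (ZMod p) V,
      Module.finrank (ZMod p) V ≤ Module.finrank (ZMod p) R + 4 * h ∧
      ∃ S : Submodule (ZMod p) E, (∀ x ∈ R, ∀ y ∈ R, B x y ∈ S) ∧
        Module.finrank (ZMod p) S + h * h ≤ Module.finrank (ZMod p)
          (Submodule.span (ZMod p) (Set.image2 (fun u v => B u v) Set.univ Set.univ))) := by
  classical
  have : Finite (E →ₗ[ZMod p] ZMod p) := Finite.of_injective (fun f => (f : E → ZMod p)) DFunLike.coe_injective
  have := Fintype.ofFinite (E →ₗ[ZMod p] ZMod p)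
  have hcd : Fintype.card (E →ₗ[ZMod p] ZMod p) ≤ p ^ m := by
    rw [← Nat.card_eq_fintype_card, Module.natCard_eq_pow_finrank (K := ZMod p)]
    rw [Module.natCard_eq_pow_finrank (K := ZMod p)] at hE
    have e : Module.finrank (ZMod p) (E →ₗ[ZMod p] ZMod p) = Module.finrank (ZMod p) E :=
      Subspace.dual_finrank_eq
    rwa [e]
  set 𝒞 : Finset (LinearMap.BilinForm (ZMod p) V) :=
    (Finset.univ.image fun c : E →ₗ[ZMod p] ZMod p => (B.compr₂ c : LinearMap.BilinForm (ZMod p) V)).filter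
      (fun c => 2 * h ≤ Module.finrank (ZMod p) (LinearMap.range c)) with h𝒞
  obtain ⟨U, hUc, hU⟩ := sims_exists_U h m a 𝒞 (fun c hc => (Finset.mem_filter.1 hc).2)
    ((Finset.card_filter_le _ _).trans (Finset.card_image_le.trans hcd)) ha
  set L : Set (LinearMap.BilinForm (ZMod p) V) :=
    {b | ∃ c : E →ₗ[ZMod p] ZMod p, b = B.compr₂ c ∧ ∀ u ∈ U, ∀ v ∈ U, c (B u v) = 0} with hL
  obtain ⟨R, c0, hc0, hR, hrk⟩ := sims_rank_lemma (K := ZMod p) (Module.finrank (ZMod p) V) V L rfl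
    ⟨0, by ext; simp, by simp⟩
    (by
      rintro b ⟨c, rfl, hc⟩ b' ⟨c', rfl, hc'⟩
      exact ⟨c + c', by ext; simp, fun u hu v hv => by simp [hc u hu v hv, hc' u hu v hv]⟩)
    (by
      rintro b ⟨c, rfl, hc⟩ x
      simp [halt])
  obtain ⟨c, hcB, hcU⟩ := hc0
  have hker : LinearMap.BilinForm.orthogonal c0 ⊤ = LinearMap.ker c0 := by
    have hsk : ∀ x y, c0 x y = - c0 y x := by
      have : LinearMap.IsAlt c0 := by intro x; simp [hcB, halt]
      intro x y
      rw [this.neg]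
    ext x
    rw [LinearMap.BilinForm.mem_orthogonal_iff, LinearMap.mem_ker]
    constructor
    · intro hx
      ext y
      have := hx y trivial
      rw [hsk, this]; simp
    · intro hx y _
      rw [hsk, hx]; simp
  have hlow : Module.finrank (ZMod p) (LinearMap.range c0) < 2 * h := by
    by_contra hcon
    push Not at hcon
    obtain ⟨u, hu, v, hv, huv⟩ := hU c0 (by
      rw [h𝒞, Finset.mem_filter]
      exact ⟨Finset.mem_image.2 ⟨c, Finset.mem_univ _, hcB.symm⟩, hcon⟩)
    apply huv
    rw [hcB]
    simpa using hcU u hu v hv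
  have hrn := LinearMap.finrank_range_add_finrank_ker c0
  rw [hker] at hrk
  have hBR : ∀ x ∈ R, ∀ y ∈ R, B x y ∈
      Submodule.span (ZMod p) (Set.image2 (fun u v => B u v) (U : Set V) U) := by
    intro x hx y hy
    by_contra hcon
    obtain ⟨f, hf1, hf2⟩ := Submodule.exists_le_ker_of_notMem hcon
    apply hf1
    have := hR (B.compr₂ f) ⟨f, rfl, fun u hu v hv => by
      have := hf2 (Submodule.subset_span (s := Set.image2 (fun u v => B u v) (U : Set V) U) ⟨u, hu, v, hv, rfl⟩)
      simpa using this⟩ x hx y hy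
    simpa using this
  by_cases hcase : Module.finrank (ZMod p) (Submodule.span (ZMod p) (Set.image2 (fun u v => B u v) Set.univ Set.univ)) ≤
      Module.finrank (ZMod p) (Submodule.span (ZMod p) (Set.image2 (fun u v => B u v) (U : Set V) U)) + h * h
  · left
    obtain ⟨U', h1, h2⟩ := sims_extend_span B (h * h) U hcase
    exact ⟨U', by omega, h2⟩
  · right
    exact ⟨R, by omega, _, hBR, by omega⟩

end linear

section classTwo

open scoped commutatorElement

/-- The largest elementary abelian quotient of a group. -/
abbrev SimsAb (p : ℕ) (Q : Type*) [Group Q] :=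
  Abelianization Q ⧸ (powMonoidHom p : Abelianization Q →* Abelianization Q).range

/-- The central elements of exponent `p`. -/
def SimsZ (p : ℕ) (Q : Type*) [Group Q] : Subgroup Q where
  carrier := {x | x ∈ Subgroup.center Q ∧ x ^ p = 1}
  one_mem' := ⟨one_mem _, one_pow _⟩
  mul_mem' := by
    rintro x y ⟨hx, hx'⟩ ⟨hy, hy'⟩
    refine ⟨mul_mem hx hy, ?_⟩
    have : Commute x y := Subgroup.mem_center_iff.1 hy x
    rw [this.mul_pow, hx', hy', one_mul]
  inv_mem' := by
    rintro x ⟨hx, hx'⟩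
    exact ⟨inv_mem hx, by rw [inv_pow, hx', inv_one]⟩

instance (p : ℕ) (Q : Type*) [Group Q] : CommGroup (SimsZ p Q) :=
  { (inferInstance : Group (SimsZ p Q)) with
    mul_comm := fun x y => Subtype.ext (Subgroup.mem_center_iff.1 y.2.1 x) }

def simsProj (p : ℕ) (Q : Type*) [Group Q] : Q →* SimsAb p Q :=
  (QuotientGroup.mk' _).comp Abelianization.of

theorem simsProj_surjective (p : ℕ) (Q : Type*) [Group Q] :
    Function.Surjective (simsProj p Q) := by
  intro x
  obtain ⟨y, rfl⟩ := QuotientGroup.mk'_surjective _ x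
  obtain ⟨z, rfl⟩ := QuotientGroup.mk'_surjective _ y
  exact ⟨z, rfl⟩

theorem simsAb_pow (p : ℕ) (Q : Type*) [Group Q] (x : SimsAb p Q) : x ^ p = 1 := by
  obtain ⟨y, rfl⟩ := QuotientGroup.mk'_surjective _ x
  rw [← map_pow, QuotientGroup.mk'_apply, QuotientGroup.eq_one_iff]
  exact ⟨y, rfl⟩

theorem simsZ_pow (p : ℕ) (Q : Type*) [Group Q] (x : SimsZ p Q) : x ^ p = 1 := by
  exact Subtype.ext x.2.2

/-- Universal property of `simsProj`. -/
def simsLift (p : ℕ) {Q Z : Type*} [Group Q] [CommGroup Z] (hZ : ∀ z : Z, z ^ p = 1)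
    (f : Q →* Z) : SimsAb p Q →* Z :=
  QuotientGroup.lift _ (Abelianization.lift f) (by
    rintro _ ⟨x, rfl⟩
    rw [MonoidHom.mem_ker, powMonoidHom_apply, map_pow, hZ])

theorem simsLift_apply (p : ℕ) {Q Z : Type*} [Group Q] [CommGroup Z] (hZ : ∀ z : Z, z ^ p = 1)
    (f : Q →* Z) (x : Q) : simsLift p hZ f (simsProj p Q x) = f x := rfl

def simsLiftHom (p : ℕ) {Q Z : Type*} [Group Q] [CommGroup Z] (hZ : ∀ z : Z, z ^ p = 1) :
    (Q →* Z) →* (SimsAb p Q →* Z) :=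
  MonoidHom.mk' (simsLift p hZ) (by
    intro f g
    apply MonoidHom.ext
    intro x
    obtain ⟨y, rfl⟩ := simsProj_surjective p Q x
    simp [simsLift_apply])

def simsComm (p : ℕ) {Q : Type*} [Group Q] (hc : commutator Q ≤ Subgroup.center Q)
    (hp : ∀ x ∈ commutator Q, x ^ p = 1) : Q →* (Q →* SimsZ p Q) :=
  have hm : ∀ x y : Q, ⁅x, y⁆ ∈ commutator Q := fun x y =>
    Subgroup.commutator_mem_commutator (Subgroup.mem_top x) (Subgroup.mem_top y)
  have hcen : ∀ x y z : Q, z * ⁅x, y⁆ = ⁅x, y⁆ * z := fun x y z =>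
    Subgroup.mem_center_iff.1 (hc (hm x y)) z
  MonoidHom.mk' (fun x => MonoidHom.mk' (fun y => ⟨⁅x, y⁆, hc (hm x y), hp _ (hm x y)⟩) (by
        intro y z
        ext
        change ⁅x, y * z⁆ = ⁅x, y⁆ * ⁅x, z⁆
        have e : ⁅x, y * z⁆ = ⁅x, y⁆ * (y * ⁅x, z⁆ * y⁻¹) := by
          simp only [commutatorElement_def]; group
        rw [e, hcen]; group)) (by
    intro x y
    ext z
    change ⁅x * y, z⁆ = ⁅x, z⁆ * ⁅y, z⁆
    have e : ⁅x * y, z⁆ = (x * ⁅y, z⁆ * x⁻¹) * ⁅x, z⁆ := by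
      simp only [commutatorElement_def]; group
    rw [e, hcen y z x, mul_inv_cancel_right, hcen])

theorem simsComm_coe (p : ℕ) {Q : Type*} [Group Q] (hc : commutator Q ≤ Subgroup.center Q)
    (hp : ∀ x ∈ commutator Q, x ^ p = 1) (x y : Q) :
    (simsComm p hc hp x y : Q) = ⁅x, y⁆ := rfl

theorem simsHom_pow (p : ℕ) (Q A : Type*) [Group Q] [Group A] (f : A →* SimsZ p Q) : f ^ p = 1 := by
  ext1 x
  exact simsZ_pow p Q (f x)

instance simsModuleAb (p : ℕ) (Q : Type*) [Group Q] : Module (ZMod p) (Additive (SimsAb p Q)) :=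
  AddCommGroup.zmodModule (fun x => congrArg Additive.ofMul (simsAb_pow p Q x.toMul))

instance simsModuleZ (p : ℕ) (Q : Type*) [Group Q] : Module (ZMod p) (Additive (SimsZ p Q)) :=
  AddCommGroup.zmodModule (fun x => congrArg Additive.ofMul (simsZ_pow p Q x.toMul))

theorem sims_class2 {p : ℕ} [Fact p.Prime] (h m a : ℕ) (ha : m + h * h + a < h * a)
    {Q : Type*} [Group Q] [Finite Q] (hc : commutator Q ≤ Subgroup.center Q)
    (hp : ∀ x ∈ commutator Q, x ^ p = 1) (hQ : Nat.card Q ≤ p ^ m) :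
    (∃ U : Finset Q, U.card ≤ a + 2 * (h * h) ∧
      commutator Q ≤ ⁅Subgroup.closure (U : Set Q), Subgroup.closure (U : Set Q)⁆) ∨
    (∃ R : Subgroup Q, R.index ≤ p ^ (4 * h) ∧
      Nat.card (⁅R, R⁆ : Subgroup Q) * p ^ (h * h) ≤ Nat.card (commutator Q)) := by
  classical
  have hp1 : 1 < p := (Fact.out : p.Prime).one_lt
  let B0 : SimsAb p Q →* (SimsAb p Q →* SimsZ p Q) :=
    simsLift p (simsHom_pow p Q (SimsAb p Q)) ((simsLiftHom p (simsZ_pow p Q)).comp (simsComm p hc hp))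
  have hB0 : ∀ x y : Q, ((B0 (simsProj p Q x) (simsProj p Q y) : SimsZ p Q) : Q) = ⁅x, y⁆ :=
    fun x y => rfl
  let B : Additive (SimsAb p Q) →ₗ[ZMod p] Additive (SimsAb p Q) →ₗ[ZMod p] Additive (SimsZ p Q) :=
    LinearMap.mk₂ (ZMod p) (fun x y => Additive.ofMul (B0 x.toMul y.toMul))
      (fun x y z => by simp)
      (fun c x y => ZMod.map_smul (AddMonoidHom.mk' (fun x : Additive (SimsAb p Q) =>
        Additive.ofMul (B0 x.toMul y.toMul)) (fun x x' => by simp)) c x)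
      (fun x y z => by simp)
      (fun c x y => ZMod.map_smul (AddMonoidHom.mk' (fun y : Additive (SimsAb p Q) =>
        Additive.ofMul (B0 x.toMul y.toMul)) (fun x x' => by simp)) c y)
  let j : SimsZ p Q →* Q := (SimsZ p Q).subtype
  have hj : Function.Injective j := Subtype.val_injective
  let π : Q → Additive (SimsAb p Q) := fun x => Additive.ofMul (simsProj p Q x)
  have hπ : Function.Surjective π := fun x => by
    obtain ⟨y, hy⟩ := simsProj_surjective p Q x.toMul
    exact ⟨y, congrArg Additive.ofMul hy⟩
  have hB : ∀ x y : Q, j (B (π x) (π y)).toMul = ⁅x, y⁆ := fun x y => rfl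
  have hcE : Nat.card (Additive (SimsZ p Q)) ≤ p ^ m :=
    (Nat.card_le_card_of_injective (fun x : Additive (SimsZ p Q) => j x.toMul)
      (fun x y hxy => hj hxy)).trans hQ
  -- pull back a subgroup of Q to a submodule
  have hpull : ∀ H : Subgroup Q, ∀ s : Set (Additive (SimsZ p Q)), (∀ z ∈ s, j z.toMul ∈ H) →
      ∀ z ∈ Submodule.span (ZMod p) s, j z.toMul ∈ H := by
    intro H s hs
    have : Submodule.span (ZMod p) s ≤
        AddSubgroup.toZModSubmodule p (Subgroup.toAddSubgroup (H.comap j)) :=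
      Submodule.span_le.2 fun z hz => hs z hz
    exact fun z hz => this hz
  rcases sims_linear h m a ha B (fun x => by
      obtain ⟨y, rfl⟩ := hπ x
      have := hB y y
      rw [commutatorElement_self] at this
      exact hj (this.trans (map_one j).symm)) hcE with ⟨U, hU1, hU2⟩ | ⟨R, hR, S, hS1, hS2⟩
  · left
    choose σ hσ using hπ
    refine ⟨U.image σ, Finset.card_image_le.trans hU1, ?_⟩
    rw [commutator_def, Subgroup.commutator_le]
    intro x _ y _
    rw [← hB]
    apply hpull _ _ _ _ (hU2 _ _)
    rintro _ ⟨u, hu, v, hv, rfl⟩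
    have := hB (σ u) (σ v)
    rw [hσ, hσ] at this
    rw [this]
    apply Subgroup.commutator_mem_commutator
    · exact Subgroup.subset_closure (Finset.mem_coe.2 (Finset.mem_image_of_mem _ hu))
    · exact Subgroup.subset_closure (Finset.mem_coe.2 (Finset.mem_image_of_mem _ hv))
  · right
    have hRc : (Subgroup.toAddSubgroup.symm R.toAddSubgroup).index ≤ p ^ (4 * h) := by
      have h1 := Subgroup.card_mul_index (Subgroup.toAddSubgroup.symm R.toAddSubgroup)
      have h2 : Nat.card (Subgroup.toAddSubgroup.symm R.toAddSubgroup) =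
        p ^ Module.finrank (ZMod p) R := by
        have := Module.natCard_eq_pow_finrank (K := ZMod p) (V := R)
        rw [Nat.card_zmod] at this
        exact this
      have h3 : Nat.card (SimsAb p Q) = p ^ Module.finrank (ZMod p) (Additive (SimsAb p Q)) := by
        have := Module.natCard_eq_pow_finrank (K := ZMod p) (V := Additive (SimsAb p Q))
        rw [Nat.card_zmod] at this
        exact this
      rw [h2, h3] at h1
      have h4 : p ^ Module.finrank (ZMod p) (Additive (SimsAb p Q)) ≤
          p ^ Module.finrank (ZMod p) R * p ^ (4 * h) := by
        rw [← pow_add]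
        exact Nat.pow_le_pow_right hp1.le hR
      rw [← h1] at h4
      exact Nat.le_of_mul_le_mul_left h4 (Nat.pow_pos (by omega))
    refine ⟨(Subgroup.toAddSubgroup.symm R.toAddSubgroup).comap (simsProj p Q), ?_, ?_⟩
    · rw [Subgroup.index_comap_of_surjective _ (simsProj_surjective p Q)]
      exact hRc
    · have h1 : ⁅(Subgroup.toAddSubgroup.symm R.toAddSubgroup).comap (simsProj p Q),
          (Subgroup.toAddSubgroup.symm R.toAddSubgroup).comap (simsProj p Q)⁆ ≤
          (Subgroup.toAddSubgroup.symm S.toAddSubgroup).map j := by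
        rw [Subgroup.commutator_le]
        intro x hx y hy
        exact ⟨(B (π x) (π y)).toMul, hS1 _ hx _ hy, hB x y⟩
      have h2 := Subgroup.card_le_of_le h1
      rw [Subgroup.card_map_of_injective hj] at h2
      have h3 : Nat.card (Subgroup.toAddSubgroup.symm S.toAddSubgroup) =
          p ^ Module.finrank (ZMod p) S := by
        have := Module.natCard_eq_pow_finrank (K := ZMod p) (V := S)
        rw [Nat.card_zmod] at this
        exact this
      set T := Submodule.span (ZMod p) (Set.image2 (fun u v => B u v) Set.univ Set.univ) with hT
      have h4 : (Subgroup.toAddSubgroup.symm T.toAddSubgroup).map j ≤ commutator Q := by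
        rintro _ ⟨z, hz, rfl⟩
        apply hpull _ _ _ _ hz
        rintro _ ⟨u, _, v, _, rfl⟩
        obtain ⟨x, rfl⟩ := hπ u
        obtain ⟨y, rfl⟩ := hπ v
        rw [hB]
        exact Subgroup.commutator_mem_commutator (Subgroup.mem_top x) (Subgroup.mem_top y)
      have h5 := Subgroup.card_le_of_le h4
      rw [Subgroup.card_map_of_injective hj] at h5
      have h6 : Nat.card (Subgroup.toAddSubgroup.symm T.toAddSubgroup) =
          p ^ Module.finrank (ZMod p) T := by
        have := Module.natCard_eq_pow_finrank (K := ZMod p) (V := T)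
        rw [Nat.card_zmod] at this
        exact this
      rw [h6] at h5
      rw [h3] at h2
      calc _ ≤ p ^ Module.finrank (ZMod p) S * p ^ (h * h) := Nat.mul_le_mul_right _ h2
        _ = p ^ (Module.finrank (ZMod p) S + h * h) := by rw [pow_add]
        _ ≤ p ^ Module.finrank (ZMod p) T := Nat.pow_le_pow_right hp1.le hS2
        _ ≤ _ := h5

end classTwo

section star

open scoped commutatorElement

/-- `[K, G] K^p`. -/
def simsStar (p : ℕ) {G : Type*} [Group G] (K : Subgroup G) : Subgroup G :=
  ⁅K, (⊤ : Subgroup G)⁆ ⊔ Subgroup.normalClosure ((fun x => x ^ p) '' (K : Set G))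

instance simsStar_normal (p : ℕ) {G : Type*} [Group G] (K : Subgroup G) [K.Normal] :
    (simsStar p K).Normal := by
  unfold simsStar; infer_instance

theorem simsStar_le_iff (p : ℕ) {G : Type*} [Group G] {K D : Subgroup G} [D.Normal] :
    simsStar p K ≤ D ↔ (∀ x ∈ K, ∀ g : G, ⁅x, g⁆ ∈ D) ∧ ∀ x ∈ K, x ^ p ∈ D := by
  unfold simsStar
  rw [sup_le_iff, Subgroup.commutator_le, Subgroup.normalClosure_subset_iff.symm,
    Set.image_subset_iff]
  simp [Set.subset_def]

theorem simsStar_le_self (p : ℕ) {G : Type*} [Group G] (K : Subgroup G) [K.Normal] :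
    simsStar p K ≤ K := by
  rw [simsStar_le_iff]
  refine ⟨fun x hx g => ?_, fun x hx => pow_mem hx p⟩
  rw [commutatorElement_def]
  have : x * g * x⁻¹ * g⁻¹ = x * (g * x⁻¹ * g⁻¹) := by group
  rw [this]
  exact mul_mem hx (Subgroup.Normal.conj_mem ‹_› _ (inv_mem hx) g)

theorem simsStar_comm_mem (p : ℕ) {G : Type*} [Group G] {K : Subgroup G} {x : G} (hx : x ∈ K)
    (g : G) : ⁅x, g⁆ ∈ simsStar p K :=
  (le_sup_left : _ ≤ simsStar p K) (Subgroup.commutator_mem_commutator hx (Subgroup.mem_top g))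

theorem simsStar_pow_mem (p : ℕ) {G : Type*} [Group G] {K : Subgroup G} {x : G} (hx : x ∈ K) :
    x ^ p ∈ simsStar p K :=
  (le_sup_right : _ ≤ simsStar p K) (Subgroup.subset_normalClosure ⟨x, hx, rfl⟩)

theorem sims_meets_center {p : ℕ} [Fact p.Prime] {G : Type*} [Group G] [Finite G]
    (hG : IsPGroup p G) (K : Subgroup G) [K.Normal] (hK : K ≠ ⊥) :
    ∃ z ∈ K, z ∈ Subgroup.center G ∧ orderOf z = p := by
  have hne : Nontrivial K := (Subgroup.nontrivial_iff_ne_bot K).2 hK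
  obtain ⟨n, hn, hcard⟩ := (hG.to_subgroup K).nontrivial_iff_card.1 hne
  have hdvd : p ∣ Nat.card K := hcard ▸ dvd_pow_self p (by omega)
  have hC : IsPGroup p (ConjAct G) := hG
  have h1 : (1 : K) ∈ MulAction.fixedPoints (ConjAct G) K := by
    intro g
    simp
  obtain ⟨b, hb, hb1⟩ := hC.exists_fixed_point_of_prime_dvd_card_of_fixed_point K hdvd h1
  have hbc : (b : G) ∈ Subgroup.center G := by
    rw [Subgroup.mem_center_iff]
    intro g
    have := congrArg (Subtype.val) (hb (ConjAct.toConjAct g))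
    rw [ConjAct.Subgroup.val_conj_smul, ConjAct.toConjAct_smul] at this
    exact mul_inv_eq_iff_eq_mul.1 this
  have hb2 : (b : G) ≠ 1 := fun h => hb1 (Subtype.ext h.symm)
  obtain ⟨k, hk⟩ := (IsPGroup.iff_orderOf.1 hG) (b : G)
  have hk0 : k ≠ 0 := by
    rintro rfl
    rw [pow_zero, orderOf_eq_one_iff] at hk
    exact hb2 hk
  refine ⟨(b : G) ^ p ^ (k - 1), pow_mem b.2 _, pow_mem hbc _, ?_⟩
  have hp : 0 < p := (Fact.out : p.Prime).pos
  rw [orderOf_pow' _ (Nat.pow_pos hp).ne', hk,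
    Nat.gcd_eq_right (pow_dvd_pow p (by omega)), Nat.pow_div (by omega) hp]
  rw [show k - (k - 1) = 1 by omega, pow_one]

theorem sims_step {p : ℕ} [Fact p.Prime] {G : Type*} [Group G] (M K : Subgroup G) [M.Normal]
    [K.Normal] [Finite (G ⧸ M)] (hG : IsPGroup p (G ⧸ M)) (hMK : M < K) :
    ∃ K2 : Subgroup G, K2.Normal ∧ M < K2 ∧ K2 ≤ K ∧ simsStar p K2 ≤ M ∧ M.relIndex K2 = p := by
  have hmk := QuotientGroup.mk'_surjective M
  have : (K.map (QuotientGroup.mk' M)).Normal := Subgroup.Normal.map ‹_› _ hmk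
  obtain ⟨z, hzK, hzc, hzo⟩ := sims_meets_center hG (K.map (QuotientGroup.mk' M)) (by
    intro h
    rw [Subgroup.map_eq_bot_iff, QuotientGroup.ker_mk'] at h
    exact not_le_of_gt hMK h)
  have hzn : (Subgroup.zpowers z).Normal := by
    constructor
    intro n hn g
    have : n ∈ Subgroup.center (G ⧸ M) := (Subgroup.zpowers_le.2 hzc) hn
    rw [Subgroup.mem_center_iff] at this
    rw [this g, mul_inv_cancel_right]
    exact hn
  have hrel : M.relIndex ((Subgroup.zpowers z).comap (QuotientGroup.mk' M)) = p := by
    have h1 := Subgroup.relIndex_comap (⊥ : Subgroup (G ⧸ M)) (QuotientGroup.mk' M)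
      ((Subgroup.zpowers z).comap (QuotientGroup.mk' M))
    rw [Subgroup.map_comap_eq_self_of_surjective hmk, MonoidHom.comap_bot,
      QuotientGroup.ker_mk', Subgroup.relIndex_bot_left, Nat.card_zpowers, hzo] at h1
    exact h1
  have hle : M ≤ (Subgroup.zpowers z).comap (QuotientGroup.mk' M) := by
    intro x hx
    rw [Subgroup.mem_comap, QuotientGroup.mk'_apply, (QuotientGroup.eq_one_iff x).2 hx]
    exact one_mem _
  refine ⟨(Subgroup.zpowers z).comap (QuotientGroup.mk' M), inferInstance, ?_, ?_, ?_, hrel⟩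
  · refine lt_of_le_of_ne hle fun h => ?_
    rw [← h, Subgroup.relIndex_self] at hrel
    exact (Fact.out : p.Prime).one_lt.ne hrel
  · intro x hx
    obtain ⟨y, hy, hyx⟩ := (Subgroup.zpowers_le.2 hzK) (Subgroup.mem_comap.1 hx)
    have := QuotientGroup.eq.1 hyx
    have h2 := mul_mem hy (hMK.le this)
    rwa [mul_inv_cancel_left] at h2
  · rw [simsStar_le_iff]
    refine ⟨fun x hx g => ?_, fun x hx => ?_⟩
    · rw [← QuotientGroup.eq_one_iff, ← QuotientGroup.mk'_apply, map_commutatorElement,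
        commutatorElement_eq_one_iff_mul_comm]
      have : QuotientGroup.mk' M x ∈ Subgroup.center (G ⧸ M) :=
        (Subgroup.zpowers_le.2 hzc) (Subgroup.mem_comap.1 hx)
      exact (Subgroup.mem_center_iff.1 this _).symm
    · rw [← QuotientGroup.eq_one_iff, ← QuotientGroup.mk'_apply, map_pow]
      obtain ⟨i, hi⟩ := Subgroup.mem_zpowers_iff.1 (Subgroup.mem_comap.1 hx)
      rw [← hi, ← zpow_natCast, ← zpow_mul, mul_comm, zpow_mul, zpow_natCast, ← hzo,
        pow_orderOf_eq_one, one_zpow]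

theorem simsStar_lt {p : ℕ} [Fact p.Prime] {G : Type*} [Group G] [Finite G]
    (hG : IsPGroup p G) (K : Subgroup G) [K.Normal] (hK : K ≠ ⊥) : simsStar p K < K := by
  obtain ⟨M, hM⟩ := (Set.toFinite {M : Subgroup G | M.Normal ∧ M < K}).exists_maximal
    ⟨⊥, inferInstance, bot_lt_iff_ne_bot.2 hK⟩
  have : M.Normal := hM.1.1
  obtain ⟨K2, hn, h1, h2, h3, -⟩ := sims_step M K (hG.to_quotient M) hM.1.2
  have : K2 = K := by
    by_contra hne
    exact not_le_of_gt h1 (hM.2 ⟨hn, lt_of_le_of_ne h2 hne⟩ h1.le)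
  subst this
  exact lt_of_le_of_lt h3 h1

theorem sims_comm_central {G : Type*} [Group G] {x1 x2 y1 y2 : G} (hx : ∀ g, Commute x2 g)
    (hy : ∀ g, Commute y2 g) : ⁅x1 * x2, y1 * y2⁆ = ⁅x1, y1⁆ := by
  simp only [commutatorElement_def]
  have a1 := (hx (y1 * y2)).eq
  have a2 := (hy x1⁻¹).eq
  calc x1 * x2 * (y1 * y2) * (x1 * x2)⁻¹ * (y1 * y2)⁻¹
      = x1 * (x2 * (y1 * y2)) * x2⁻¹ * x1⁻¹ * y2⁻¹ * y1⁻¹ := by group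
    _ = x1 * y1 * (y2 * x1⁻¹) * y2⁻¹ * y1⁻¹ := by rw [a1]; group
    _ = _ := by rw [a2]; group

theorem sims_hall {p : ℕ} [Fact p.Prime] {G : Type*} [Group G] [Finite G]
    (hG : IsPGroup p G) (H : Subgroup G)
    (h : commutator G ≤ ⁅H, H⁆ ⊔ simsStar p (commutator G)) : commutator G ≤ ⁅H, H⁆ := by
  obtain ⟨l, hl⟩ := (Set.toFinite {l : Subgroup G | l.Normal ∧ commutator G ≤ ⁅H, H⁆ ⊔ l}).exists_minimal
    ⟨commutator G, inferInstance, le_sup_right⟩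
  have hn : l.Normal := hl.1.1
  have hl2 := hl.1.2
  by_cases hbot : l = ⊥
  · rwa [hbot, sup_bot_eq] at hl2
  exfalso
  have hlt := simsStar_lt hG l hbot
  refine not_le_of_gt hlt (hl.2 ⟨inferInstance, ?_⟩ hlt.le)
  set s := simsStar p l with hs
  have hcen : ∀ x ∈ l, ∀ g : G, ⁅x, g⁆ ∈ s := fun x hx g => simsStar_comm_mem p hx g
  have hHl : (H ⊔ l).Normal := by
    apply Subgroup.Normal.of_commutator_le
    refine hl2.trans (sup_le_sup_right ?_ l)
    rw [Subgroup.commutator_le]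
    intro x hx y hy
    rw [commutatorElement_def]
    exact mul_mem (mul_mem (mul_mem hx hy) (inv_mem hx)) (inv_mem hy)
  have hD : ⁅H, H⁆ ⊔ s = ⁅H ⊔ l, H ⊔ l⁆ ⊔ s := by
    apply le_antisymm
    · exact sup_le_sup_right (Subgroup.commutator_mono le_sup_left le_sup_left) s
    · refine sup_le ?_ le_sup_right
      rw [Subgroup.commutator_le]
      intro x hx y hy
      obtain ⟨x1, hx1, x2, hx2, rfl⟩ := Subgroup.mem_sup_of_normal_right.1 hx
      obtain ⟨y1, hy1, y2, hy2, rfl⟩ := Subgroup.mem_sup_of_normal_right.1 hy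
      have hc : ∀ z ∈ l, ∀ g : G ⧸ s, Commute (z : G ⧸ s) g := by
        intro z hz g
        obtain ⟨g, rfl⟩ := QuotientGroup.mk'_surjective s g
        have := hcen z hz g
        rw [← QuotientGroup.eq_one_iff, ← QuotientGroup.mk'_apply, map_commutatorElement,
          commutatorElement_eq_one_iff_mul_comm] at this
        exact this
      have e : ((⁅x1 * x2, y1 * y2⁆ : G) : G ⧸ s) = ((⁅x1, y1⁆ : G) : G ⧸ s) := by
        simp only [← QuotientGroup.mk'_apply, map_commutatorElement, map_mul]
        exact sims_comm_central (hc x2 hx2) (hc y2 hy2)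
      have e2 := QuotientGroup.eq.1 e.symm
      have := mul_mem ((le_sup_left : _ ≤ ⁅H, H⁆ ⊔ s) (Subgroup.commutator_mem_commutator hx1 hy1))
        ((le_sup_right : _ ≤ ⁅H, H⁆ ⊔ s) e2)
      rwa [mul_inv_cancel_left] at this
  have hDn : (⁅H, H⁆ ⊔ s).Normal := by
    rw [hD]; infer_instance
  have hsD : s ≤ ⁅H, H⁆ ⊔ s := le_sup_right
  refine h.trans (sup_le le_sup_left ?_)
  rw [simsStar_le_iff]
  have key : ∀ x ∈ commutator G, ∃ y ∈ l, (x : G ⧸ (⁅H, H⁆ ⊔ s)) = y := by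
    intro x hx
    obtain ⟨d, hd, y, hy, rfl⟩ := Subgroup.mem_sup_of_normal_right.1 (hl2 hx)
    refine ⟨y, hy, ?_⟩
    rw [QuotientGroup.mk_mul, (QuotientGroup.eq_one_iff d).2 ((le_sup_left : _ ≤ ⁅H, H⁆ ⊔ s) hd), one_mul]
  refine ⟨fun x hx g => ?_, fun x hx => ?_⟩
  · obtain ⟨y, hy, hxy⟩ := key x hx
    have := hsD (hcen y hy g)
    rw [← QuotientGroup.eq_one_iff, ← QuotientGroup.mk'_apply, map_commutatorElement] at this ⊢
    rw [QuotientGroup.mk'_apply, hxy]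
    exact this
  · obtain ⟨y, hy, hxy⟩ := key x hx
    have := hsD (simsStar_pow_mem p hy)
    rw [← QuotientGroup.eq_one_iff, ← QuotientGroup.mk'_apply, map_pow] at this ⊢
    rw [QuotientGroup.mk'_apply, hxy]
    exact this

end star

section reduction

open scoped commutatorElement

theorem sims_card_comap {G Q : Type*} [Group G] [Group Q] [Finite G] (f : G →* Q)
    (hf : Function.Surjective f) (T : Subgroup Q) :
    Nat.card (T.comap f) = Nat.card T * Nat.card f.ker := by
  have : Finite Q := Finite.of_surjective f hf
  have h1 := Subgroup.card_mul_index (T.comap f)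
  have h2 := Subgroup.card_mul_index T
  have h3 := Subgroup.card_mul_index f.ker
  rw [Subgroup.index_comap_of_surjective _ hf] at h1
  rw [Subgroup.index_ker, MonoidHom.range_eq_top.2 hf, Subgroup.card_top] at h3
  have h4 : T.index ≠ 0 := Subgroup.index_ne_zero_of_finite
  apply Nat.eq_of_mul_eq_mul_right (Nat.pos_of_ne_zero h4)
  rw [h1, ← h3, ← h2]
  ring

theorem sims_dichotomy {p : ℕ} [Fact p.Prime] (h m a : ℕ) (ha : m + h * h + a < h * a)
    {G : Type*} [Group G] [Finite G] (hG : IsPGroup p G) (hm : Nat.card G ≤ p ^ m) :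
    (∃ U : Finset G, U.card ≤ a + 2 * (h * h) ∧
      commutator G ≤ ⁅Subgroup.closure (U : Set G), Subgroup.closure (U : Set G)⁆) ∨
    (∃ R : Subgroup G, R.index ≤ p ^ (4 * h) ∧
      Nat.card (⁅R, R⁆ : Subgroup G) * p ^ (h * h) ≤ Nat.card (commutator G)) := by
  classical
  set s := simsStar p (commutator G) with hs
  have hmk := QuotientGroup.mk'_surjective s
  have hcomm : commutator (G ⧸ s) = (commutator G).map (QuotientGroup.mk' s) := by
    have : (commutator G).map (QuotientGroup.mk' s) =
        Subgroup.map (QuotientGroup.mk' s) ⁅(⊤ : Subgroup G), (⊤ : Subgroup G)⁆ := rfl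
    rw [this, Subgroup.map_commutator, Subgroup.map_top_of_surjective _ hmk]
    rfl
  have hsle : s ≤ commutator G := simsStar_le_self p _
  have hQ : Nat.card (G ⧸ s) ≤ p ^ m := (Nat.card_le_card_of_surjective _ hmk).trans hm
  rcases sims_class2 (p := p) h m a ha (Q := G ⧸ s) (by
      rw [hcomm]
      rintro _ ⟨x, hx, rfl⟩
      rw [Subgroup.mem_center_iff]
      intro g
      obtain ⟨g, rfl⟩ := hmk g
      have := simsStar_comm_mem p hx g
      rw [← hs, ← QuotientGroup.eq_one_iff, ← QuotientGroup.mk'_apply, map_commutatorElement,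
          commutatorElement_eq_one_iff_mul_comm] at this
      exact this.symm) (by
      rw [hcomm]
      rintro _ ⟨x, hx, rfl⟩
      have := simsStar_pow_mem p hx
      rwa [← hs, ← QuotientGroup.eq_one_iff, ← QuotientGroup.mk'_apply, map_pow] at this) hQ
    with ⟨U, hU1, hU2⟩ | ⟨R, hR1, hR2⟩
  · left
    choose σ hσ using hmk
    refine ⟨U.image σ, Finset.card_image_le.trans hU1, ?_⟩
    apply sims_hall hG
    have e : (Subgroup.closure ((U.image σ : Finset G) : Set G)).map (QuotientGroup.mk' s) =
        Subgroup.closure (U : Set (G ⧸ s)) := by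
      rw [MonoidHom.map_closure, Finset.coe_image, ← Set.image_comp]
      congr 1
      have : (QuotientGroup.mk' s : G → G ⧸ s) ∘ σ = id := funext hσ
      rw [this, Set.image_id]
    rw [hcomm, ← e, ← Subgroup.map_commutator, Subgroup.map_le_iff_le_comap,
      Subgroup.comap_map_eq, QuotientGroup.ker_mk'] at hU2
    exact hU2
  · right
    refine ⟨R.comap (QuotientGroup.mk' s), ?_, ?_⟩
    · rwa [Subgroup.index_comap_of_surjective _ hmk]
    · have h1 : Nat.card (⁅R.comap (QuotientGroup.mk' s), R.comap (QuotientGroup.mk' s)⁆ : Subgroup G) ≤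
          Nat.card (⁅R, R⁆ : Subgroup (G ⧸ s)) * Nat.card s := by
        have h2 := sims_card_comap (QuotientGroup.mk' s) hmk ⁅R, R⁆
        rw [QuotientGroup.ker_mk'] at h2
        rw [← h2]
        apply Subgroup.card_le_of_le
        rw [← Subgroup.map_le_iff_le_comap, Subgroup.map_commutator,
          Subgroup.map_comap_eq_self_of_surjective hmk]
      have h3 := sims_card_comap (QuotientGroup.mk' s) hmk (commutator (G ⧸ s))
      rw [hcomm, Subgroup.comap_map_eq, QuotientGroup.ker_mk', sup_eq_left.2 hsle, ← hcomm] at h3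
      rw [h3]
      calc _ ≤ Nat.card (⁅R, R⁆ : Subgroup (G ⧸ s)) * Nat.card s * p ^ (h * h) :=
            Nat.mul_le_mul_right _ h1
        _ = (Nat.card (⁅R, R⁆ : Subgroup (G ⧸ s)) * p ^ (h * h)) * Nat.card s := by ring
        _ ≤ _ := Nat.mul_le_mul_right _ hR2

theorem sims_reduction {p : ℕ} [Fact p.Prime] (h m a : ℕ) (ha : m + h * h + a < h * a) (t : ℕ) :
    ∀ (G : Type*) [Group G] [Finite G], IsPGroup p G → Nat.card G ≤ p ^ m →
      Nat.card (commutator G) < p ^ (h * h * (t + 1)) →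
      ∃ G0 : Subgroup G, G0.index ≤ p ^ (4 * h * t) ∧ ∃ U : Finset G,
        U.card ≤ a + 2 * (h * h) ∧ (U : Set G) ⊆ G0 ∧
        ⁅G0, G0⁆ ≤ ⁅Subgroup.closure (U : Set G), Subgroup.closure (U : Set G)⁆ := by
  classical
  induction t with
  | zero =>
    intro G _ _ hG hm hlt
    rcases sims_dichotomy h m a ha hG hm with ⟨U, hU1, hU2⟩ | ⟨R, hR1, hR2⟩
    · exact ⟨⊤, by simp, U, hU1, by simp, hU2⟩
    · exfalso
      have : 1 ≤ Nat.card (⁅R, R⁆ : Subgroup G) := Nat.card_pos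
      have h2 := Nat.mul_le_mul_right (p ^ (h * h)) this
      simp only [zero_add, mul_one, one_mul] at hlt h2
      omega
  | succ t ih =>
    intro G _ _ hG hm hlt
    have hp : 0 < p := (Fact.out : p.Prime).pos
    rcases sims_dichotomy h m a ha hG hm with ⟨U, hU1, hU2⟩ | ⟨R, hR1, hR2⟩
    · exact ⟨⊤, by simpa using Nat.one_le_pow _ _ hp, U, hU1, by simp, hU2⟩
    · have hcR : (commutator R).map R.subtype = ⁅R, R⁆ := by
        rw [commutator_def, Subgroup.map_commutator, ← MonoidHom.range_eq_map, Subgroup.range_subtype]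
      obtain ⟨G0, hG0, U, hU1, hU2, hU3⟩ := ih R (hG.to_subgroup R)
        ((Subgroup.card_le_card_group R).trans hm) (by
          rw [← hcR, Subgroup.card_map_of_injective R.subtype_injective] at hR2
          have h1 := hR2.trans_lt hlt
          rw [show h * h * (t + 1 + 1) = h * h * (t + 1) + h * h by ring, pow_add] at h1
          exact Nat.lt_of_mul_lt_mul_right h1)
      refine ⟨G0.map R.subtype, ?_, U.image R.subtype, Finset.card_image_le.trans hU1, ?_, ?_⟩
      · rw [Subgroup.index_map_subtype, mul_add, mul_one, pow_add]
        exact Nat.mul_le_mul hG0 hR1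
      · rw [Finset.coe_image, Subgroup.coe_map]
        exact Set.image_mono hU2
      · rw [Finset.coe_image, ← MonoidHom.map_closure, ← Subgroup.map_commutator,
          ← Subgroup.map_commutator]
        exact Subgroup.map_mono hU3

end reduction

section freeCount

open scoped commutatorElement

theorem sims_gen_step {p : ℕ} [Fact p.Prime] {u : ℕ} (K K' : Subgroup (FreeGroup (Fin u)))
    [K.Normal] [K'.Normal] (hlt : K < K') (hrel : K.relIndex K' = p) (hstar : simsStar p K' ≤ K)
    (T' : Finset (FreeGroup (Fin u))) (hT' : (T' : Set (FreeGroup (Fin u))) ⊆ K')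
    (hgen : K' ≤ simsStar p K' ⊔ Subgroup.closure (T' : Set (FreeGroup (Fin u)))) :
    ∃ T : Finset (FreeGroup (Fin u)), T.card ≤ T'.card + u + 1 ∧
      (T : Set (FreeGroup (Fin u))) ⊆ K ∧
      K ≤ simsStar p K ⊔ Subgroup.closure (T : Set (FreeGroup (Fin u))) := by
  classical
  have hpp : p.Prime := Fact.out
  obtain ⟨x, hxT, hxK⟩ : ∃ x ∈ T', x ∉ K := by
    by_contra hcon
    push Not at hcon
    apply not_le_of_gt hlt
    refine hgen.trans (sup_le hstar ?_)
    rw [Subgroup.closure_le]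
    exact fun t ht => hcon t ht
  have hxK' : x ∈ K' := hT' hxT
  have hsup : K' ≤ K ⊔ Subgroup.zpowers x := by
    have hle : K ⊔ Subgroup.zpowers x ≤ K' := sup_le hlt.le (Subgroup.zpowers_le.2 hxK')
    have h1 := Subgroup.relIndex_mul_relIndex K (K ⊔ Subgroup.zpowers x) K' le_sup_left hle
    rw [hrel] at h1
    have h2 : K.relIndex (K ⊔ Subgroup.zpowers x) ≠ 1 := by
      intro h
      rw [Subgroup.relIndex_eq_one] at h
      exact hxK (h ((le_sup_right : _ ≤ K ⊔ Subgroup.zpowers x) (Subgroup.mem_zpowers x)))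
    have h3 : (K ⊔ Subgroup.zpowers x).relIndex K' = 1 := by
      rcases Nat.prime_mul_iff.1 (h1 ▸ hpp) with h | h
      · exact h.2
      · exact absurd h.2 h2
    rwa [Subgroup.relIndex_eq_one] at h3
  have hdec : ∀ y ∈ K', ∃ i : ℤ, y * x ^ i ∈ K := by
    intro y hy
    obtain ⟨k, hk, z, hz, rfl⟩ := Subgroup.mem_sup_of_normal_left.1 (hsup hy)
    obtain ⟨i, rfl⟩ := Subgroup.mem_zpowers_iff.1 hz
    exact ⟨-i, by simpa using hk⟩
  choose! i hi using hdec
  set T : Finset (FreeGroup (Fin u)) := T'.image (fun t => t * x ^ i t) ∪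
    ((Finset.univ : Finset (Fin u)).image (fun j => ⁅x, FreeGroup.of j⁆) ∪ {x ^ p}) with hT
  have hTK : (T : Set (FreeGroup (Fin u))) ⊆ K := by
    intro t ht
    rw [Finset.mem_coe, hT, Finset.mem_union, Finset.mem_union] at ht
    rcases ht with ht | ht | ht
    · obtain ⟨s, hs, rfl⟩ := Finset.mem_image.1 ht
      exact hi s (hT' hs)
    · obtain ⟨s, hs, rfl⟩ := Finset.mem_image.1 ht
      exact hstar (simsStar_comm_mem p hxK' _)
    · rw [Finset.mem_singleton.1 ht]
      exact hstar (simsStar_pow_mem p hxK')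
  refine ⟨T, ?_, hTK, ?_⟩
  · have h1 := Finset.card_union_le (T'.image (fun t => t * x ^ i t))
      ((Finset.univ : Finset (Fin u)).image (fun j => ⁅x, FreeGroup.of j⁆) ∪ {x ^ p})
    have h2 := Finset.card_union_le ((Finset.univ : Finset (Fin u)).image
      (fun j => ⁅x, FreeGroup.of j⁆)) {x ^ p}
    have h3 : (T'.image (fun t => t * x ^ i t)).card ≤ T'.card := Finset.card_image_le
    have h4 : ((Finset.univ : Finset (Fin u)).image (fun j => ⁅x, FreeGroup.of j⁆)).card ≤ u :=
      Finset.card_image_le.trans (by simp)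
    rw [Finset.card_singleton] at h2
    rw [hT]
    omega
  set S := simsStar p K ⊔ Subgroup.closure (T : Set (FreeGroup (Fin u))) with hS
  have hstS : simsStar p K ≤ S := le_sup_left
  have hTS : ∀ t ∈ T, t ∈ S := fun t ht =>
    (le_sup_right : _ ≤ S) (Subgroup.subset_closure ht)
  have hSK : S ≤ K := sup_le (simsStar_le_self p K) ((Subgroup.closure_le _).2 hTK)
  have hSn : S.Normal := by
    constructor
    intro s hs f
    have e : f * s * f⁻¹ = s * ⁅s⁻¹, f⁆ := by rw [commutatorElement_def]; group
    rw [e]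
    exact mul_mem hs (hstS (simsStar_comm_mem p (inv_mem (hSK hs)) f))
  have hcent : ∀ k ∈ K, ∀ g : FreeGroup (Fin u) ⧸ S, Commute (k : FreeGroup (Fin u) ⧸ S) g := by
    intro k hk g
    obtain ⟨g, rfl⟩ := QuotientGroup.mk'_surjective S g
    have := hstS (simsStar_comm_mem p hk g)
    rw [← QuotientGroup.eq_one_iff, ← QuotientGroup.mk'_apply, map_commutatorElement,
      commutatorElement_eq_one_iff_mul_comm] at this
    exact this
  have hxcent : ∀ g : FreeGroup (Fin u) ⧸ S, Commute (x : FreeGroup (Fin u) ⧸ S) g := by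
    intro g
    obtain ⟨g, rfl⟩ := QuotientGroup.mk'_surjective S g
    have : g ∈ (Subgroup.centralizer {(x : FreeGroup (Fin u) ⧸ S)}).comap (QuotientGroup.mk' S) := by
      have htop : g ∈ (⊤ : Subgroup (FreeGroup (Fin u))) := trivial
      rw [← FreeGroup.closure_range_of] at htop
      refine (Subgroup.closure_le _).2 ?_ htop
      rintro _ ⟨j, rfl⟩
      rw [SetLike.mem_coe, Subgroup.mem_comap, Subgroup.mem_centralizer_singleton_iff]
      have := hTS ⁅x, FreeGroup.of j⁆ (by
        rw [hT, Finset.mem_union, Finset.mem_union]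
        exact Or.inr (Or.inl (Finset.mem_image_of_mem _ (Finset.mem_univ j))))
      rw [← QuotientGroup.eq_one_iff, ← QuotientGroup.mk'_apply, map_commutatorElement,
        commutatorElement_eq_one_iff_mul_comm] at this
      exact this.symm
    rw [Subgroup.mem_comap, Subgroup.mem_centralizer_singleton_iff] at this
    exact this.symm
  have hxpS : x ^ p ∈ S := hTS _ (by
    rw [hT, Finset.mem_union, Finset.mem_union]
    exact Or.inr (Or.inr (Finset.mem_singleton_self _)))
  have hK'S : simsStar p K' ≤ S := by
    rw [simsStar_le_iff]
    have key : ∀ y ∈ K', ∃ k ∈ K, ∃ i : ℤ, y = k * x ^ i := by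
      intro y hy
      obtain ⟨k, hk, z, hz, rfl⟩ := Subgroup.mem_sup_of_normal_left.1 (hsup hy)
      obtain ⟨i, rfl⟩ := Subgroup.mem_zpowers_iff.1 hz
      exact ⟨k, hk, i, rfl⟩
    refine ⟨fun y hy g => ?_, fun y hy => ?_⟩
    · obtain ⟨k, hk, i, rfl⟩ := key y hy
      rw [← QuotientGroup.eq_one_iff, ← QuotientGroup.mk'_apply, map_commutatorElement,
        commutatorElement_eq_one_iff_mul_comm, map_mul, map_zpow]
      exact ((hcent k hk _).mul_left ((hxcent _).zpow_left i)).eq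
    · obtain ⟨k, hk, i, rfl⟩ := key y hy
      rw [← QuotientGroup.eq_one_iff, ← QuotientGroup.mk'_apply, map_pow, map_mul, map_zpow]
      have hc : Commute (QuotientGroup.mk' S k) (QuotientGroup.mk' S x ^ i) := hcent k hk _
      rw [hc.mul_pow, ← map_pow, QuotientGroup.mk'_apply,
        (QuotientGroup.eq_one_iff _).2 (hstS (simsStar_pow_mem p hk)), one_mul,
        ← zpow_natCast, ← zpow_mul, mul_comm, zpow_mul, zpow_natCast, ← map_pow,
        QuotientGroup.mk'_apply, (QuotientGroup.eq_one_iff _).2 hxpS, one_zpow]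
  have hK'2 : K' ≤ S ⊔ Subgroup.zpowers x := by
    refine hgen.trans (sup_le (hK'S.trans le_sup_left) ?_)
    rw [Subgroup.closure_le]
    intro t ht
    have h1 : t * x ^ i t ∈ S := hTS _ (by
      rw [hT, Finset.mem_union]
      exact Or.inl (Finset.mem_image_of_mem _ ht))
    have h2 : t = (t * x ^ i t) * x ^ (- i t) := by group
    rw [h2]
    exact mul_mem ((le_sup_left : _ ≤ S ⊔ Subgroup.zpowers x) h1)
      ((le_sup_right : _ ≤ S ⊔ Subgroup.zpowers x) ⟨_, rfl⟩)
  intro k hk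
  obtain ⟨s, hs, z, hz, rfl⟩ := Subgroup.mem_sup_of_normal_left.1 (hK'2 (hlt.le hk))
  obtain ⟨b, rfl⟩ := Subgroup.mem_zpowers_iff.1 hz
  refine mul_mem hs ?_
  have hb : x ^ b ∈ K := by
    have := mul_mem (inv_mem (hSK hs)) hk
    rwa [inv_mul_cancel_left] at this
  have hdvd : (p : ℤ) ∣ b := by
    by_contra hnd
    have hcop : IsCoprime (p : ℤ) b := (Nat.prime_iff_prime_int.1 hpp).coprime_iff_not_dvd.2 hnd
    obtain ⟨r, s', hrs⟩ := hcop
    apply hxK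
    have e : x = (x ^ p) ^ r * (x ^ b) ^ s' := by
      rw [← zpow_natCast, ← zpow_mul, ← zpow_mul, ← zpow_add, mul_comm, mul_comm b, hrs, zpow_one]
    rw [e]
    exact mul_mem (zpow_mem (hSK hxpS) r) (zpow_mem hb s')
  obtain ⟨c, rfl⟩ := hdvd
  rw [zpow_mul, zpow_natCast]
  exact zpow_mem hxpS c

theorem sims_sub_count {p : ℕ} [Fact p.Prime] {F : Type*} [Group F] (K' : Subgroup F) [K'.Normal]
    (T' : Finset F) (hgen : K' ≤ simsStar p K' ⊔ Subgroup.closure (T' : Set F))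
    (hT' : (T' : Set F) ⊆ K') :
    ∃ 𝒮 : Finset (Subgroup F), 𝒮.card ≤ p ^ T'.card ∧
      ∀ K : Subgroup F, K.Normal → K < K' → K.relIndex K' = p → simsStar p K' ≤ K → K ∈ 𝒮 := by
  classical
  have hχ : ∀ K : Subgroup F, K.Normal → K.relIndex K' = p →
      ∃ χ : K' →* Multiplicative (ZMod p), χ.ker = K.subgroupOf K' := by
    intro K hK hrel
    have hc : Nat.card (K' ⧸ K.subgroupOf K') = p := hrel
    have hc2 : Nat.card (Multiplicative (ZMod p)) = p := Nat.card_zmod p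
    let e : (K' ⧸ K.subgroupOf K') ≃* Multiplicative (ZMod p) := mulEquivOfPrimeCardEq hc hc2
    refine ⟨e.toMonoidHom.comp (QuotientGroup.mk' _), ?_⟩
    ext x
    rw [MonoidHom.mem_ker, MonoidHom.comp_apply]
    change e _ = 1 ↔ _
    rw [map_eq_one_iff e e.injective, QuotientGroup.mk'_apply, QuotientGroup.eq_one_iff]
  let PP : Set (Subgroup F) := {K | K.Normal ∧ K < K' ∧ K.relIndex K' = p ∧ simsStar p K' ≤ K}
  have hχ' : ∀ K : PP, ∃ χ : K' →* Multiplicative (ZMod p), χ.ker = K.1.subgroupOf K' :=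
    fun K => hχ K.1 K.2.1 K.2.2.2.1
  choose χ hχ1 using hχ'
  let φ : PP → (T' → Multiplicative (ZMod p)) := fun K t => χ K ⟨t.1, hT' t.2⟩
  have hφ : Function.Injective φ := by
    intro K L hKL
    have hle : K' ≤ ((χ K).eqLocus (χ L)).map K'.subtype := by
      refine hgen.trans (sup_le ?_ ?_)
      · intro s hs
        have hs' : s ∈ K' := simsStar_le_self p K' hs
        refine ⟨⟨s, hs'⟩, ?_, rfl⟩
        have h1 : (⟨s, hs'⟩ : K') ∈ (χ K).ker := by
          rw [hχ1]; exact K.2.2.2.2 hs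
        have h2 : (⟨s, hs'⟩ : K') ∈ (χ L).ker := by
          rw [hχ1]; exact L.2.2.2.2 hs
        exact h1.trans h2.symm
      · rw [Subgroup.closure_le]
        intro t ht
        exact ⟨⟨t, hT' ht⟩, congrFun hKL ⟨t, ht⟩, rfl⟩
    have heq : χ K = χ L := by
      ext1 y
      obtain ⟨z, hz, hzy⟩ := hle y.2
      have : z = y := Subtype.ext hzy
      subst this
      exact hz
    have h3 : K.1.subgroupOf K' = L.1.subgroupOf K' := by rw [← hχ1, ← hχ1, heq]
    apply Subtype.ext
    have h4 := congrArg (Subgroup.map K'.subtype) h3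
    rwa [Subgroup.map_subgroupOf_eq_of_le K.2.2.1.le,
      Subgroup.map_subgroupOf_eq_of_le L.2.2.1.le] at h4
  have hfin : Finite PP := Finite.of_injective φ hφ
  refine ⟨(Set.toFinite PP).toFinset, ?_, fun K h1 h2 h3 h4 => by
    rw [Set.Finite.mem_toFinset]; exact ⟨h1, h2, h3, h4⟩⟩
  have h5 := Nat.card_le_card_of_injective φ hφ
  rw [Nat.card_fun, Nat.card_eq_fintype_card (α := T'), Fintype.card_coe] at h5
  rw [← Set.ncard_eq_toFinset_card PP (Set.toFinite PP), ← Nat.card_coe_set_eq]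
  refine h5.trans (le_of_eq ?_)
  congr 1
  exact Nat.card_zmod p

theorem sims_parent {p : ℕ} [Fact p.Prime] {F : Type*} [Group F] (N : ℕ) (K : Subgroup F)
    [K.Normal] (hK : K.index = p ^ (N + 1)) :
    ∃ K' : Subgroup F, K'.Normal ∧ K < K' ∧ K'.index = p ^ N ∧ simsStar p K' ≤ K ∧
      K.relIndex K' = p := by
  have hpp : p.Prime := Fact.out
  have hc : Nat.card (F ⧸ K) = p ^ (N + 1) := hK
  have hfin : Finite (F ⧸ K) := Nat.finite_of_card_ne_zero (by
    rw [hc]; exact (Nat.pow_pos hpp.pos).ne')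
  obtain ⟨K', h1, h2, -, h4, h5⟩ := sims_step K ⊤ (IsPGroup.of_card hc) (by
    rw [lt_top_iff_ne_top]
    rintro rfl
    rw [Subgroup.index_top] at hK
    exact (Nat.one_lt_pow (by omega) hpp.one_lt).ne hK)
  refine ⟨K', h1, h2, ?_, h4, h5⟩
  have h6 := Subgroup.relIndex_mul_index h2.le
  rw [h5, hK, pow_succ, mul_comm] at h6
  exact Nat.eq_of_mul_eq_mul_right hpp.pos h6

theorem sims_gen_bound {p : ℕ} [Fact p.Prime] {u : ℕ} (N : ℕ) :
    ∀ K : Subgroup (FreeGroup (Fin u)), K.Normal → K.index = p ^ N →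
    ∃ T : Finset (FreeGroup (Fin u)), T.card ≤ (u + 1) * (N + 1) ∧
      (T : Set (FreeGroup (Fin u))) ⊆ K ∧
      K ≤ simsStar p K ⊔ Subgroup.closure (T : Set (FreeGroup (Fin u))) := by
  classical
  induction N with
  | zero =>
    intro K _ hK
    rw [pow_zero, Subgroup.index_eq_one] at hK
    subst hK
    refine ⟨Finset.univ.image FreeGroup.of, Finset.card_image_le.trans (by simp), by simp, ?_⟩
    rw [Finset.coe_image, Finset.coe_univ, Set.image_univ, FreeGroup.closure_range_of]
    exact le_sup_right
  | succ N ih =>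
    intro K hKn hK
    obtain ⟨K', h1, h2, h3, h4, h5⟩ := sims_parent N K hK
    obtain ⟨T', hc, hT', hg⟩ := ih K' h1 h3
    obtain ⟨T, hT1, hT2, hT3⟩ := sims_gen_step K K' h2 h5 h4 T' hT' hg
    refine ⟨T, ?_, hT2, hT3⟩
    have : (u + 1) * (N + 1 + 1) = (u + 1) * (N + 1) + u + 1 := by ring
    omega

theorem sims_free_count (p : ℕ) [Fact p.Prime] (u N : ℕ) :
    ∃ 𝒮 : Finset (Subgroup (FreeGroup (Fin u))), 𝒮.card ≤ p ^ ((u + 1) * (N * (N + 1))) ∧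
      ∀ K : Subgroup (FreeGroup (Fin u)), K.Normal → K.index = p ^ N → K ∈ 𝒮 := by
  classical
  have hpp : p.Prime := Fact.out
  induction N with
  | zero =>
    refine ⟨{⊤}, by simp, fun K _ hK => ?_⟩
    rw [pow_zero, Subgroup.index_eq_one] at hK
    simp [hK]
  | succ N ih =>
    obtain ⟨𝒮, hc, h𝒮⟩ := ih
    have hex : ∀ K' : Subgroup (FreeGroup (Fin u)), ∃ 𝒯 : Finset (Subgroup (FreeGroup (Fin u))),
        𝒯.card ≤ p ^ ((u + 1) * (N + 1)) ∧ (K'.Normal → K'.index = p ^ N →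
          ∀ K : Subgroup (FreeGroup (Fin u)), K.Normal → K < K' → K.relIndex K' = p →
            simsStar p K' ≤ K → K ∈ 𝒯) := by
      intro K'
      by_cases h : K'.Normal ∧ K'.index = p ^ N
      · obtain ⟨h1, h2⟩ := h
        obtain ⟨T, hT1, hT2, hT3⟩ := sims_gen_bound N K' h1 h2
        obtain ⟨𝒯, h3, h4⟩ := sims_sub_count K' T hT3 hT2
        exact ⟨𝒯, h3.trans (Nat.pow_le_pow_right hpp.pos hT1), fun _ _ => h4⟩
      · exact ⟨∅, by simp, fun h1 h2 => absurd ⟨h1, h2⟩ h⟩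
    choose f hf1 hf2 using hex
    refine ⟨𝒮.biUnion f, ?_, fun K hKn hK => ?_⟩
    · refine (Finset.card_biUnion_le_card_mul _ _ _ fun K' _ => hf1 K').trans ?_
      calc _ ≤ p ^ ((u + 1) * (N * (N + 1))) * p ^ ((u + 1) * (N + 1)) := Nat.mul_le_mul_right _ hc
        _ = p ^ ((u + 1) * (N * (N + 1)) + (u + 1) * (N + 1)) := by rw [pow_add]
        _ ≤ _ := Nat.pow_le_pow_right hpp.pos (by nlinarith)
    · obtain ⟨K', h1, h2, h3, h4, h5⟩ := sims_parent N K hK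
      exact Finset.mem_biUnion.2 ⟨K', h𝒮 K' h1 h3, hf2 K' h1 h3 K hKn h2 h5 h4⟩

end freeCount

section covers

open scoped commutatorElement

theorem sims_dvd_of_zpow_mem {p : ℕ} (hpp : p.Prime) {G : Type*} [Group G] (A : Subgroup G) {y : G}
    (hy : y ∉ A) (hyp : y ^ p ∈ A) {n : ℤ} (hn : y ^ n ∈ A) : (p : ℤ) ∣ n := by
  by_contra hnd
  have hcop : IsCoprime (p : ℤ) n := (Nat.prime_iff_prime_int.1 hpp).coprime_iff_not_dvd.2 hnd
  obtain ⟨r, s, hrs⟩ := hcop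
  apply hy
  have e : y = (y ^ p) ^ r * (y ^ n) ^ s := by
    rw [← zpow_natCast, ← zpow_mul, ← zpow_mul, ← zpow_add, mul_comm, mul_comm n, hrs, zpow_one]
  rw [e]
  exact mul_mem (zpow_mem hyp r) (zpow_mem hn s)

/-- A predicate on groups with `d` marked elements. -/
abbrev SimsClass (d : ℕ) := ∀ (G : Type) [Group G], (Fin d → G) → Prop

/-- Marked isomorphism. -/
def SimsMI {d : ℕ} (G : Type) [Group G] (g : Fin d → G) (H : Type) [Group H] (h : Fin d → H) :
    Prop := ∃ e : G ≃* H, ∀ j, e (g j) = h j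

/-- The class `C` is covered by at most `B` marked isomorphism types. -/
def SimsCover {d : ℕ} (C : SimsClass d) (B : ℕ) : Prop :=
  ∃ (ι : Type) (A : ι → Type) (_ : ∀ i, Group (A i)) (a : ∀ i, Fin d → A i),
    Finite ι ∧ Nat.card ι ≤ B ∧ (∀ i, C (A i) (a i)) ∧
      ∀ (G : Type) [Group G] (g : Fin d → G), C G g → ∃ i, SimsMI (A i) (a i) G g

theorem sims_cover_of_data {d : ℕ} {C : SimsClass d} {κ : Type} [Finite κ] {B : ℕ}
    (hB : Nat.card κ ≤ B) (R : κ → SimsClass d)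
    (h1 : ∀ (G : Type) [Group G] (g : Fin d → G), C G g → ∃ i, R i G g)
    (h2 : ∀ (i : κ) (G : Type) [Group G] (g : Fin d → G) (G' : Type) [Group G'] (g' : Fin d → G'),
      C G g → C G' g' → R i G g → R i G' g' → SimsMI G g G' g') : SimsCover C B := by
  let ι := {i : κ // ∃ (G : Type) (_ : Group G) (g : Fin d → G), C G g ∧ R i G g}
  have hι : ∀ i : ι, ∃ (G : Type) (_ : Group G) (g : Fin d → G), C G g ∧ R i.1 G g := fun i => i.2
  choose A gr a hC hR using hι
  refine ⟨ι, A, gr, a, inferInstance, (Nat.card_le_card_of_injective _ Subtype.val_injective).trans hB,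
    hC, ?_⟩
  intro G _ g hg
  obtain ⟨i, hi⟩ := h1 G g hg
  let i' : ι := ⟨i, G, inferInstance, g, hg, hi⟩
  exact ⟨i', h2 i _ _ _ _ (hC i') hg (hR i') hi⟩

theorem sims_cover_base (p : ℕ) [Fact p.Prime] (u N : ℕ) :
    SimsCover (d := u) (fun G _ g => Nat.card G = p ^ N ∧ Subgroup.closure (Set.range g) = ⊤)
      (p ^ ((u + 1) * (N * (N + 1)))) := by
  obtain ⟨S, hS, hS2⟩ := sims_free_count p u N
  refine sims_cover_of_data (κ := S) (by simpa using hS)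
    (fun K G _ g => (FreeGroup.lift g).ker = K.1) ?_ ?_
  · rintro G _ g ⟨hc, hg⟩
    have hsurj : Function.Surjective (FreeGroup.lift g) := by
      rw [← MonoidHom.range_eq_top, FreeGroup.range_lift_eq_closure, hg]
    refine ⟨⟨(FreeGroup.lift g).ker, hS2 _ inferInstance ?_⟩, rfl⟩
    rw [Subgroup.index_ker, MonoidHom.range_eq_top.2 hsurj, ← hc]
    exact Subgroup.card_top
  · rintro K G _ g G' _ g' ⟨hc, hg⟩ ⟨hc', hg'⟩ hK hK'
    have hsurj : Function.Surjective (FreeGroup.lift g) := by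
      rw [← MonoidHom.range_eq_top, FreeGroup.range_lift_eq_closure, hg]
    have hsurj' : Function.Surjective (FreeGroup.lift g') := by
      rw [← MonoidHom.range_eq_top, FreeGroup.range_lift_eq_closure, hg']
    let e1 := QuotientGroup.quotientKerEquivOfSurjective _ hsurj
    let e2 := QuotientGroup.quotientKerEquivOfSurjective _ hsurj'
    let e3 := QuotientGroup.quotientMulEquivOfEq (hK.trans hK'.symm)
    refine ⟨(e1.symm.trans e3).trans e2, fun j => ?_⟩
    have h1 : e1.symm (g j) = (QuotientGroup.mk (FreeGroup.of j)) := by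
      rw [MulEquiv.symm_apply_eq]
      change _ = FreeGroup.lift g (FreeGroup.of j)
      simp
    rw [MulEquiv.trans_apply, MulEquiv.trans_apply, h1]
    change FreeGroup.lift g' (FreeGroup.of j) = g' j
    simp

theorem sims_ext_unique {p d : ℕ} (hpp : p.Prime) {G G' : Type} [Group G] [Group G']
    (g : Fin d → G) (g' : Fin d → G') (y : G) (y' : G') (A : Subgroup G) (A' : Subgroup G')
    (hA : Subgroup.closure (Set.range g) = A) (hA' : Subgroup.closure (Set.range g') = A')
    [Finite A] (hy : y ∉ A) (hy' : y' ∉ A') (hyp : y ^ p ∈ A) (hyp' : y' ^ p ∈ A')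
    (e : A ≃* A') (he : ∀ j (h : g j ∈ A), (e ⟨g j, h⟩ : G') = g' j)
    (hep : (e ⟨y ^ p, hyp⟩ : G') = y' ^ p)
    (hec : ∀ j, ∃ h : ⁅y, g j⁆ ∈ A, (e ⟨⁅y, g j⁆, h⟩ : G') = ⁅y', g' j⁆)
    (htop : A ⊔ Subgroup.zpowers y = ⊤) (htop' : A' ⊔ Subgroup.zpowers y' = ⊤) :
    ∃ E : G ≃* G', (∀ j, E (g j) = g' j) ∧ E y = y' := by
  have hgA : ∀ j, g j ∈ A := fun j => hA ▸ Subgroup.subset_closure ⟨j, rfl⟩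
  let γ : A →* G × G' := A.subtype.prod (A'.subtype.comp e.toMonoidHom)
  have hγ : ∀ a, γ a = ((a : G), (e a : G')) := fun a => rfl
  set Γ : Subgroup (G × G') := γ.range with hΓ
  have hfin : Finite Γ := Finite.of_surjective γ.rangeRestrict γ.rangeRestrict_surjective
  have hΓgen : Γ = Subgroup.closure (Set.range fun j => (g j, g' j)) := by
    apply le_antisymm
    · rintro _ ⟨a, rfl⟩
      have ha : (a : G) ∈ Subgroup.closure (Set.range g) := hA ▸ a.2
      have : ∀ x (hx : x ∈ Subgroup.closure (Set.range g)), ∀ h : x ∈ A,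
          γ ⟨x, h⟩ ∈ Subgroup.closure (Set.range fun j => (g j, g' j)) := by
        intro x hx
        induction hx using Subgroup.closure_induction with
        | mem x hx =>
          obtain ⟨j, rfl⟩ := hx
          intro h
          apply Subgroup.subset_closure
          exact ⟨j, by rw [hγ]; simp [he]⟩
        | one => intro h; exact (map_one γ) ▸ one_mem _
        | mul x z hx hz ihx ihz =>
          intro h
          have hx' : x ∈ A := hA ▸ hx
          have hz' : z ∈ A := hA ▸ hz
          have := mul_mem (ihx hx') (ihz hz')
          rwa [← map_mul] at this
        | inv x hx ihx =>
          intro h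
          have hx' : x ∈ A := hA ▸ hx
          have := inv_mem (ihx hx')
          rwa [← map_inv] at this
      exact this a ha a.2
    · rw [Subgroup.closure_le]
      rintro _ ⟨j, rfl⟩
      exact ⟨⟨g j, hgA j⟩, by rw [hγ]; simp [he]⟩
  set Y : G × G' := (y, y') with hY
  have hYp : Y ^ p ∈ Γ := ⟨⟨y ^ p, hyp⟩, by rw [hγ, hep]; rfl⟩
  have hnorm : Y ∈ Subgroup.normalizer (Γ : Set (G × G')) := by
    have : Finite (Γ : Set (G × G')) := hfin
    apply Subgroup.mem_normalizer_fintype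
    have hle : Γ ≤ Γ.comap (MulAut.conj Y).toMonoidHom := by
      conv_lhs => rw [hΓgen]
      rw [Subgroup.closure_le]
      rintro _ ⟨j, rfl⟩
      obtain ⟨hc, hc2⟩ := hec j
      have h1 : (⁅y, g j⁆, ⁅y', g' j⁆) ∈ Γ := ⟨⟨_, hc⟩, by rw [hγ, hc2]⟩
      have h2 : (g j, g' j) ∈ Γ := by
        rw [hΓgen]; exact Subgroup.subset_closure ⟨j, rfl⟩
      have h3 := mul_mem h1 h2
      change Y * (g j, g' j) * Y⁻¹ ∈ Γ
      have e1 : Y * (g j, g' j) * Y⁻¹ = (⁅y, g j⁆, ⁅y', g' j⁆) * (g j, g' j) := by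
        ext
        · simp [hY, commutatorElement_def]
        · simp [hY, commutatorElement_def]
      rwa [e1]
    intro n hn
    exact hle hn
  set P : Subgroup (G × G') := Subgroup.zpowers Y ⊔ Γ with hP
  have hdec : ∀ w ∈ P, ∃ n : ℤ, ∃ a : A, w = Y ^ n * γ a := by
    intro w hw
    have h1 := Subgroup.coe_mul_of_left_le_normalizer_right (Subgroup.zpowers Y) Γ
      (Subgroup.zpowers_le.2 hnorm)
    have hw' : w ∈ ((Subgroup.zpowers Y ⊔ Γ : Subgroup (G × G')) : Set (G × G')) := hw
    rw [h1] at hw'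
    obtain ⟨_, ⟨n, rfl⟩, _, ⟨a, rfl⟩, rfl⟩ := hw'
    exact ⟨n, a, rfl⟩
  have hdec2 : ∀ w ∈ P, (w.1 ∈ A ∨ w.2 ∈ A') → ∃ a, w = γ a := by
    intro w hw h
    obtain ⟨n, a, rfl⟩ := hdec w hw
    have hdvd : (p : ℤ) ∣ n := by
      rcases h with h | h
      · apply sims_dvd_of_zpow_mem hpp A hy hyp
        exact (Subgroup.mul_mem_cancel_right A a.2).1 h
      · apply sims_dvd_of_zpow_mem hpp A' hy' hyp'
        exact (Subgroup.mul_mem_cancel_right A' (e a).2).1 h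
    obtain ⟨c, rfl⟩ := hdvd
    have : Y ^ ((p : ℤ) * c) * γ a ∈ Γ := by
      rw [zpow_mul, zpow_natCast]
      exact mul_mem (zpow_mem hYp c) ⟨a, rfl⟩
    obtain ⟨b, hb⟩ := this
    exact ⟨b, hb.symm⟩
  let f1 : P →* G := (MonoidHom.fst G G').comp P.subtype
  let f2 : P →* G' := (MonoidHom.snd G G').comp P.subtype
  have hi1 : Function.Injective f1 := by
    rw [injective_iff_map_eq_one]
    rintro ⟨w, hw⟩ h
    have h' : w.1 = 1 := h
    obtain ⟨a, rfl⟩ := hdec2 w hw (Or.inl (h' ▸ one_mem A))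
    have ha : a = 1 := Subtype.ext h'
    subst ha
    exact Subtype.ext (map_one γ)
  have hi2 : Function.Injective f2 := by
    rw [injective_iff_map_eq_one]
    rintro ⟨w, hw⟩ h
    have h' : w.2 = 1 := h
    obtain ⟨a, rfl⟩ := hdec2 w hw (Or.inr (h' ▸ one_mem A'))
    have ha : e a = 1 := Subtype.ext h'
    rw [map_eq_one_iff e e.injective] at ha
    subst ha
    exact Subtype.ext (map_one γ)
  have hYP : Y ∈ P := (le_sup_left : _ ≤ P) (Subgroup.mem_zpowers Y)
  have hΓP : Γ ≤ P := le_sup_right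
  have hs1 : Function.Surjective f1 := by
    rw [← MonoidHom.range_eq_top, eq_top_iff, ← htop, sup_le_iff, Subgroup.zpowers_le]
    refine ⟨fun a ha => ⟨⟨γ ⟨a, ha⟩, hΓP ⟨_, rfl⟩⟩, rfl⟩, ⟨⟨Y, hYP⟩, rfl⟩⟩
  have hs2 : Function.Surjective f2 := by
    rw [← MonoidHom.range_eq_top, eq_top_iff, ← htop', sup_le_iff, Subgroup.zpowers_le]
    refine ⟨fun a ha => ⟨⟨γ (e.symm ⟨a, ha⟩), hΓP ⟨_, rfl⟩⟩, ?_⟩, ⟨⟨Y, hYP⟩, rfl⟩⟩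
    change (e (e.symm ⟨a, ha⟩) : G') = a
    simp
  let E1 := MulEquiv.ofBijective f1 ⟨hi1, hs1⟩
  let E2 := MulEquiv.ofBijective f2 ⟨hi2, hs2⟩
  have hE : ∀ w : P, (E1.symm.trans E2) w.1.1 = w.1.2 := by
    intro w
    have : E1.symm w.1.1 = w := by
      rw [MulEquiv.symm_apply_eq]; rfl
    rw [MulEquiv.trans_apply, this]
    rfl
  refine ⟨E1.symm.trans E2, fun j => ?_, hE ⟨Y, hYP⟩⟩
  exact hE ⟨(g j, g' j), hΓP (by rw [hΓgen]; exact Subgroup.subset_closure ⟨j, rfl⟩)⟩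

end covers

section coverExt

open scoped commutatorElement

theorem sims_code {α : Type*} (S : Set α) (t : ℕ) (ht : 0 < t) :
    ∃ f : α → Fin t, S.Finite → Nat.card S ≤ t → Set.InjOn f S := by
  by_cases h : S.Finite ∧ Nat.card S ≤ t
  · obtain ⟨h1, h2⟩ := h
    have : Finite S := h1
    have : Nonempty (Fin t) := ⟨⟨0, ht⟩⟩
    obtain ⟨f, -, hf⟩ := Set.Finite.exists_injOn_of_encard_le (s := S) (t := (Set.univ : Set (Fin t)))
      h1 (by
        rw [Nat.card_coe_set_eq] at h2
        rw [Set.encard_univ, ENat.card_eq_coe_natCard, ← h1.cast_ncard_eq, Nat.card_eq_fintype_card,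
          Fintype.card_fin]
        exact_mod_cast h2)
    exact ⟨f, fun _ _ => hf⟩
  · exact ⟨fun _ => ⟨0, ht⟩, fun h1 h2 => absurd ⟨h1, h2⟩ h⟩

/-- The subgroup generated by all marked elements but the last. -/
def simsSub {d : ℕ} {G : Type} [Group G] (g : Fin (d + 1) → G) : Subgroup G :=
  Subgroup.closure (Set.range fun j : Fin d => g j.castSucc)

/-- The marking of `simsSub g`. -/
def simsRes {d : ℕ} {G : Type} [Group G] (g : Fin (d + 1) → G) (j : Fin d) : simsSub g :=
  ⟨g j.castSucc, Subgroup.subset_closure ⟨j, rfl⟩⟩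

/-- Extensions of members of `C` by one generator. -/
def SimsExt {d : ℕ} (p : ℕ) (T : ∀ (G : Type) [Group G], Subgroup G) (M t : ℕ) (C : SimsClass d) :
    SimsClass (d + 1) := fun G _ g =>
  Subgroup.closure (Set.range g) = ⊤ ∧ Finite (simsSub g) ∧ Nat.card (simsSub g) ≤ M ∧
    Nat.card (T (simsSub g)) ≤ t ∧ g (Fin.last d) ∉ simsSub g ∧ g (Fin.last d) ^ p ∈ simsSub g ∧
    (∀ j : Fin d, ∃ x ∈ T (simsSub g), (x : G) = ⁅g (Fin.last d), g j.castSucc⁆) ∧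
    C (simsSub g) (simsRes g)

theorem sims_cover_ext {d p : ℕ} (hpp : p.Prime) (T : ∀ (G : Type) [Group G], Subgroup G)
    (hT : ∀ (G H : Type) [Group G] [Group H] (e : G ≃* H), (T G).map e.toMonoidHom = T H)
    {M t B : ℕ} (hM : 0 < M) (ht : 0 < t) {C : SimsClass d} (hC : SimsCover C B) :
    SimsCover (SimsExt p T M t C) (B * (M * t ^ d)) := by
  obtain ⟨ι, A, gr, a, hfin, hcard, hCA, hcov⟩ := hC
  have hc1 : ∀ i, ∃ f : A i → Fin M, Finite (A i) → Nat.card (A i) ≤ M → Function.Injective f := by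
    intro i
    obtain ⟨f, hf⟩ := sims_code (Set.univ : Set (A i)) M hM
    exact ⟨f, fun h1 h2 => Set.injOn_univ.1 (hf Set.finite_univ (by
      rwa [Nat.card_congr (Equiv.Set.univ _)]))⟩
  choose c1 hc1 using hc1
  have hc2 : ∀ i, ∃ f : A i → Fin t, Finite (A i) → Nat.card (T (A i)) ≤ t →
      Set.InjOn f (T (A i) : Set (A i)) := by
    intro i
    obtain ⟨f, hf⟩ := sims_code (T (A i) : Set (A i)) t ht
    exact ⟨f, fun h1 h2 => hf (Set.toFinite _) h2⟩
  choose c2 hc2 using hc2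
  refine sims_cover_of_data (κ := ι × Fin M × (Fin d → Fin t)) ?_
    (fun k G _ g => ∃ e : A k.1 ≃* simsSub g, (∀ j, e (a k.1 j) = simsRes g j) ∧
      (∃ h : g (Fin.last d) ^ p ∈ simsSub g, c1 k.1 (e.symm ⟨_, h⟩) = k.2.1) ∧
      ∀ j : Fin d, ∃ h : ⁅g (Fin.last d), g j.castSucc⁆ ∈ simsSub g,
        c2 k.1 (e.symm ⟨_, h⟩) = k.2.2 j) ?_ ?_
  · rw [Nat.card_prod, Nat.card_prod, Nat.card_fun]
    simp only [Nat.card_eq_fintype_card, Fintype.card_fin]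
    exact Nat.mul_le_mul_right _ hcard
  · rintro G _ g ⟨-, -, -, -, -, h6, h7, h8⟩
    obtain ⟨i, e, he⟩ := hcov _ _ h8
    have h7' : ∀ j : Fin d, ⁅g (Fin.last d), g j.castSucc⁆ ∈ simsSub g := by
      intro j
      obtain ⟨x, -, hx⟩ := h7 j
      rw [← hx]; exact x.2
    exact ⟨⟨i, c1 i (e.symm ⟨_, h6⟩), fun j => c2 i (e.symm ⟨_, h7' j⟩)⟩, e, he, ⟨h6, rfl⟩,
      fun j => ⟨h7' j, rfl⟩⟩
  · rintro ⟨i, v, w⟩ G _ g G' _ g' ⟨h1, h2, h3, h4, h5, h6, h7, -⟩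
      ⟨h1', -, -, -, h5', h6', h7', -⟩ ⟨e, he, ⟨hv, hev⟩, hw⟩ ⟨e', he', ⟨hv', hev'⟩, hw'⟩
    dsimp only at e he hev hw e' he' hev' hw'
    have hfinA : Finite (A i) := Finite.of_equiv _ e.symm.toEquiv
    have hcA : Nat.card (A i) ≤ M := by rwa [Nat.card_congr e.toEquiv]
    have hTe : ∀ x, x ∈ T (simsSub g) → e.symm x ∈ T (A i) := by
      intro x hx
      rw [← hT _ _ e.symm]
      exact ⟨x, hx, rfl⟩
    have hTe' : ∀ x, x ∈ T (simsSub g') → e'.symm x ∈ T (A i) := by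
      intro x hx
      rw [← hT _ _ e'.symm]
      exact ⟨x, hx, rfl⟩
    have hcT : Nat.card (T (A i)) ≤ t := by
      rw [← hT _ _ e.symm]
      rwa [Nat.card_congr ((T (simsSub g)).equivMapOfInjective _ e.symm.injective).toEquiv.symm]
    have heq1 : e.symm ⟨_, hv⟩ = e'.symm ⟨_, hv'⟩ := hc1 i hfinA hcA (hev.trans hev'.symm)
    have htop : ∀ {G : Type} [Group G] (g : Fin (d + 1) → G), Subgroup.closure (Set.range g) = ⊤ →
        simsSub g ⊔ Subgroup.zpowers (g (Fin.last d)) = ⊤ := by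
      intro G _ g hg
      rw [eq_top_iff, ← hg, Subgroup.closure_le]
      rintro _ ⟨j, rfl⟩
      refine Fin.lastCases ?_ (fun j => ?_) j
      · exact (le_sup_right : _ ≤ simsSub g ⊔ Subgroup.zpowers (g (Fin.last d)))
          (Subgroup.mem_zpowers _)
      · exact (le_sup_left : _ ≤ simsSub g ⊔ Subgroup.zpowers (g (Fin.last d)))
          (Subgroup.subset_closure ⟨j, rfl⟩)
    obtain ⟨E, hE1, hE2⟩ := sims_ext_unique hpp (fun j : Fin d => g j.castSucc)
      (fun j : Fin d => g' j.castSucc) (g (Fin.last d)) (g' (Fin.last d)) (simsSub g) (simsSub g')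
      rfl rfl h5 h5' h6 h6' (e.symm.trans e')
      (fun j h => by
        have h9 : e.symm ⟨g j.castSucc, h⟩ = a i j := by
          rw [MulEquiv.symm_apply_eq, he]; rfl
        rw [MulEquiv.trans_apply, h9, he']; rfl)
      (by rw [MulEquiv.trans_apply, heq1]; simp)
      (fun j => by
        obtain ⟨q, hq⟩ := hw j
        obtain ⟨q', hq'⟩ := hw' j
        refine ⟨q, ?_⟩
        have heq2 : e.symm ⟨_, q⟩ = e'.symm ⟨_, q'⟩ := by
          apply hc2 i hfinA hcT _ _ (hq.trans hq'.symm)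
          · apply hTe
            obtain ⟨x, hx, hx2⟩ := h7 j
            have : x = ⟨_, q⟩ := Subtype.ext hx2
            rwa [← this]
          · apply hTe'
            obtain ⟨x, hx, hx2⟩ := h7' j
            have : x = ⟨_, q'⟩ := Subtype.ext hx2
            rwa [← this]
        rw [MulEquiv.trans_apply, heq2]; simp)
      (htop g h1) (htop g' h1')
    exact ⟨E, fun j => Fin.lastCases hE2 hE1 j⟩

/-- Closure of a class under marked isomorphism. -/
def SimsHat {d : ℕ} (C : SimsClass d) : SimsClass d := fun G _ g =>
  ∃ (A : Type) (_ : Group A) (a : Fin d → A), C A a ∧ SimsMI A a G g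

theorem sims_cover_hat {d B : ℕ} {C : SimsClass d} (h : SimsCover C B) : SimsCover (SimsHat C) B := by
  obtain ⟨ι, A, gr, a, hfin, hcard, hCA, hcov⟩ := h
  refine ⟨ι, A, gr, a, hfin, hcard, fun i => ⟨A i, gr i, a i, hCA i, MulEquiv.refl _, fun _ => rfl⟩, ?_⟩
  rintro G _ g ⟨D, _, b, hD, e, he⟩
  obtain ⟨i, e', he'⟩ := hcov _ _ hD
  exact ⟨i, e'.trans e, fun j => by rw [MulEquiv.trans_apply, he', he]⟩

/-- `A` has a generating marking in `C`. -/
def SimsHas {d : ℕ} (C : SimsClass d) (A : Type) [Group A] : Prop :=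
  ∃ a : Fin d → A, Subgroup.closure (Set.range a) = ⊤ ∧ SimsHat C A a

theorem sims_has_congr {d : ℕ} {C : SimsClass d} {A D : Type} [Group A] [Group D]
    (hA : SimsHas C A) (e : A ≃* D) : SimsHas C D := by
  obtain ⟨a, ha, A0, _, a0, hC, e0, he0⟩ := hA
  refine ⟨fun j => e (a j), ?_, A0, inferInstance, a0, hC, e0.trans e, fun j => ?_⟩
  · have h1 := MonoidHom.map_closure e.toMonoidHom (Set.range a)
    rw [ha, ← MonoidHom.range_eq_map, MonoidHom.range_eq_top.2 e.surjective, ← Set.range_comp] at h1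
    exact h1.symm
  · rw [MulEquiv.trans_apply, he0]

theorem sims_has_ext {d p : ℕ} (T : ∀ (G : Type) [Group G], Subgroup G)
    (hT : ∀ (G H : Type) [Group G] [Group H] (e : G ≃* H), (T G).map e.toMonoidHom = T H)
    {M t : ℕ} {C : SimsClass d} {A : Type} [Group A] [Finite A] {D : Type} [Group D] (φ : A →* D)
    (hφ : Function.Injective φ) (hA : SimsHas C A) (hM : Nat.card A ≤ M) (ht : Nat.card (T A) ≤ t)
    (y : D) (hy : y ∉ φ.range) (hyp : y ^ p ∈ φ.range)
    (hc : ∀ x : A, ⁅y, φ x⁆ ∈ (T A).map φ) (htop : φ.range ⊔ Subgroup.zpowers y = ⊤) :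
    SimsHas (SimsExt p T M t (SimsHat C)) D := by
  obtain ⟨a, ha, hCa⟩ := hA
  let g : Fin (d + 1) → D := Fin.snoc (α := fun _ => D) (fun j => φ (a j)) y
  have hg1 : ∀ j : Fin d, g j.castSucc = φ (a j) := fun j => by simp [g]
  have hg2 : g (Fin.last d) = y := by simp [g]
  have hsub : simsSub g = φ.range := by
    rw [MonoidHom.range_eq_map, ← ha, MonoidHom.map_closure, simsSub]
    congr 1
    ext x
    simp [hg1]
  have hgtop : Subgroup.closure (Set.range g) = ⊤ := by
    rw [eq_top_iff, ← htop, sup_le_iff, Subgroup.zpowers_le, ← hsub]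
    constructor
    · apply Subgroup.closure_mono
      rintro _ ⟨j, rfl⟩
      exact ⟨_, rfl⟩
    · exact Subgroup.subset_closure ⟨Fin.last d, hg2⟩
  let e : A ≃* simsSub g := (MonoidHom.ofInjective hφ).trans (MulEquiv.subgroupCongr hsub.symm)
  have he : ∀ x, (e x : D) = φ x := fun x => rfl
  refine ⟨g, hgtop, D, inferInstance, g, ?_, MulEquiv.refl _, fun _ => rfl⟩
  refine ⟨hgtop, Finite.of_equiv _ e.toEquiv, ?_, ?_, ?_, ?_, ?_, ?_⟩
  · rwa [← Nat.card_congr e.toEquiv]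
  · rw [← hT _ _ e]
    rwa [Nat.card_congr ((T A).equivMapOfInjective _ e.injective).toEquiv.symm]
  · rwa [hg2, hsub]
  · rwa [hg2, hsub]
  · intro j
    obtain ⟨x, hx, hx2⟩ := hc (a j)
    refine ⟨e x, ?_, ?_⟩
    · rw [← hT _ _ e]; exact ⟨x, hx, rfl⟩
    · rw [he, hx2, hg2, hg1]
  · obtain ⟨A0, _, a0, hC0, e0, he0⟩ := hCa
    refine ⟨A0, inferInstance, a0, hC0, e0.trans e, fun j => ?_⟩
    apply Subtype.ext
    rw [MulEquiv.trans_apply, he, he0]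
    exact (hg1 j).symm

/-- Iterated extensions. -/
def SimsChain (p : ℕ) (T : ∀ (G : Type) [Group G], Subgroup G) (M t : ℕ) {d : ℕ} (C : SimsClass d) :
    ∀ r : ℕ, SimsClass (d + r)
  | 0 => C
  | r + 1 => SimsExt p T M t (SimsHat (SimsChain p T M t C r))

theorem sims_cover_chain {d p : ℕ} (hpp : p.Prime) (T : ∀ (G : Type) [Group G], Subgroup G)
    (hT : ∀ (G H : Type) [Group G] [Group H] (e : G ≃* H), (T G).map e.toMonoidHom = T H)
    {m n b : ℕ} {C : SimsClass d} (hC : SimsCover C (p ^ b)) (r : ℕ) :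
    SimsCover (SimsChain p T (p ^ m) (p ^ n) C r)
      (p ^ (b + r * m + n * ∑ i ∈ Finset.range r, (d + i))) := by
  induction r with
  | zero =>
    have e : b + 0 * m + n * ∑ i ∈ Finset.range 0, (d + i) = b := by simp
    rw [e]
    exact hC
  | succ r ih =>
    have h := sims_cover_ext hpp T hT (M := p ^ m) (t := p ^ n) (Nat.pow_pos hpp.pos)
      (Nat.pow_pos hpp.pos) (sims_cover_hat ih)
    have e : p ^ (b + (r + 1) * m + n * ∑ i ∈ Finset.range (r + 1), (d + i)) =
        p ^ (b + r * m + n * ∑ i ∈ Finset.range r, (d + i)) * (p ^ m * (p ^ n) ^ (d + r)) := by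
      rw [Finset.sum_range_succ, ← pow_mul, ← pow_add, ← pow_add]
      congr 1
      ring
    rw [e]
    exact h

end coverExt

section assembly

open scoped commutatorElement

theorem sims_up_step {p : ℕ} [Fact p.Prime] {X : Type} [Group X] [Finite X] {M a : ℕ}
    (hX : Nat.card X = p ^ M) (A : Subgroup X) (hA : Nat.card A = p ^ a) (haM : a < M) :
    ∃ (K : Subgroup X) (y : X), A ≤ K ∧ Nat.card K = p ^ (a + 1) ∧ y ∈ K ∧ y ∉ A ∧ y ^ p ∈ A ∧
      K ≤ A ⊔ Subgroup.zpowers y ∧ ∀ x ∈ A, ⁅y, x⁆ ∈ A := by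
  have hpp : p.Prime := Fact.out
  obtain ⟨K, hK, hAK⟩ := Sylow.exists_subgroup_card_pow_succ (G := X) (p := p) (n := a)
    (by rw [hX]; exact pow_dvd_pow p haM) hA
  have hcA : Nat.card (A.subgroupOf K) = p ^ a := by
    rw [Nat.card_congr (Subgroup.subgroupOfEquivOfLe hAK).toEquiv, hA]
  have hidx : (A.subgroupOf K).index = p := by
    have h1 := Subgroup.card_mul_index (A.subgroupOf K)
    rw [hcA, hK, pow_succ] at h1
    exact Nat.eq_of_mul_eq_mul_left (Nat.pow_pos hpp.pos) h1
  have hnorm : (A.subgroupOf K).Normal := by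
    apply Subgroup.normal_of_index_eq_minFac_card
    rw [hidx, hK, Nat.Prime.pow_minFac hpp (by omega)]
  have hlt : ¬ K ≤ A := by
    intro h
    have : A = K := le_antisymm hAK h
    rw [this, hK] at hA
    exact absurd (Nat.pow_right_injective hpp.two_le hA) (by omega)
  obtain ⟨y, hyK, hyA⟩ := SetLike.not_le_iff_exists.1 hlt
  have hyp : y ^ p ∈ A := by
    have := Subgroup.pow_index_mem (A.subgroupOf K) ⟨y, hyK⟩
    rw [hidx] at this
    exact this
  refine ⟨K, y, hAK, hK, hyK, hyA, hyp, ?_, ?_⟩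
  · have hle : A ⊔ Subgroup.zpowers y ≤ K := sup_le hAK (Subgroup.zpowers_le.2 hyK)
    have h1 := Subgroup.relIndex_mul_relIndex A (A ⊔ Subgroup.zpowers y) K le_sup_left hle
    have hidx' : A.relIndex K = p := hidx
    rw [hidx'] at h1
    have h2 : A.relIndex (A ⊔ Subgroup.zpowers y) ≠ 1 := by
      intro h
      rw [Subgroup.relIndex_eq_one] at h
      exact hyA (h ((le_sup_right : _ ≤ A ⊔ Subgroup.zpowers y) (Subgroup.mem_zpowers y)))
    have h3 : (A ⊔ Subgroup.zpowers y).relIndex K = 1 := by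
      rcases Nat.prime_mul_iff.1 (h1 ▸ hpp) with h | h
      · exact h.2
      · exact absurd h.2 h2
    rwa [Subgroup.relIndex_eq_one] at h3
  · intro x hx
    have h1 := hnorm.conj_mem ⟨x, hAK hx⟩ hx ⟨y, hyK⟩
    have h2 : y * x * y⁻¹ ∈ A := h1
    rw [commutatorElement_def]
    exact mul_mem h2 (inv_mem hx)

theorem sims_chain_up {p : ℕ} [Fact p.Prime] {X : Type} [Group X] [Finite X] {M a m n d : ℕ}
    (hX : Nat.card X = p ^ M) (hMm : M ≤ m) (H : Subgroup X) (hH : Nat.card H = p ^ a)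
    (T : ∀ (G : Type) [Group G], Subgroup G)
    (hT : ∀ (G H : Type) [Group G] [Group H] (e : G ≃* H), (T G).map e.toMonoidHom = T H)
    (hT1 : ∀ A : Subgroup X, H ≤ A → Nat.card (T A) ≤ p ^ n)
    (hT2 : ∀ A : Subgroup X, H ≤ A → ∀ y : X, ∀ x ∈ A, ⁅y, x⁆ ∈ A → ⁅y, x⁆ ∈ (T A).map A.subtype)
    (C : SimsClass d) (hC : SimsHas C H) (r : ℕ) (hr : a + r ≤ M) :
    ∃ A : Subgroup X, H ≤ A ∧ Nat.card A = p ^ (a + r) ∧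
      SimsHas (SimsChain p T (p ^ m) (p ^ n) C r) A := by
  have hpp : p.Prime := Fact.out
  induction r with
  | zero => exact ⟨H, le_rfl, hH, hC⟩
  | succ r ih =>
    obtain ⟨A, hHA, hA, hAC⟩ := ih (by omega)
    obtain ⟨K, y, h1, h2, h3, h4, h5, h6, h7⟩ := sims_up_step hX A hA (by omega)
    refine ⟨K, hHA.trans h1, h2, ?_⟩
    have hrange : (Subgroup.inclusion h1).range = A.subgroupOf K := Subgroup.inclusion_range h1
    refine sims_has_ext T hT (Subgroup.inclusion h1) (Subgroup.inclusion_injective h1) hAC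
      (by rw [hA]; exact Nat.pow_le_pow_right hpp.pos (by omega)) (hT1 A hHA) ⟨y, h3⟩ ?_ ?_ ?_ ?_
    · rw [hrange]; exact h4
    · rw [hrange]; exact h5
    · intro x
      obtain ⟨z, hz, hz2⟩ := hT2 A hHA y x x.2 (h7 x x.2)
      refine ⟨z, hz, ?_⟩
      apply Subtype.ext
      exact hz2
    · rw [eq_top_iff, hrange]
      rintro ⟨x, hx⟩ -
      have h8 : K = (A.subgroupOf K ⊔ Subgroup.zpowers ⟨y, h3⟩).map K.subtype := by
        apply le_antisymm
        · refine h6.trans ?_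
          rw [Subgroup.map_sup, Subgroup.map_subgroupOf_eq_of_le h1, MonoidHom.map_zpowers]
          exact le_rfl
        · rintro _ ⟨z, -, rfl⟩
          exact z.2
      have hx' := hx
      rw [h8] at hx'
      obtain ⟨z, hz, hz2⟩ := hx'
      have : z = ⟨x, hx⟩ := Subtype.ext hz2
      rwa [← this]

theorem sims_pad {X : Type*} [Group X] (U : Finset X) (u : ℕ) (hU : U.card ≤ u) :
    ∃ f : Fin u → Subgroup.closure (U : Set X), Subgroup.closure (Set.range f) = ⊤ := by
  classical
  let f : Fin u → Subgroup.closure (U : Set X) := fun i =>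
    if h : i.1 < U.card then
      ⟨(U.equivFin.symm ⟨i.1, h⟩ : X), Subgroup.subset_closure (U.equivFin.symm ⟨i.1, h⟩).2⟩ else 1
  refine ⟨f, ?_⟩
  have h1 : Subgroup.closure (U : Set X) ≤ (Subgroup.closure (Set.range f)).map
      (Subgroup.closure (U : Set X)).subtype := by
    rw [Subgroup.closure_le]
    intro x hx
    have hi := (U.equivFin ⟨x, hx⟩).2
    refine ⟨f ⟨U.equivFin ⟨x, hx⟩, hi.trans_le hU⟩, Subgroup.subset_closure ⟨_, rfl⟩, ?_⟩
    simp [f, hi]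
  rw [eq_top_iff]
  rintro x -
  obtain ⟨z, hz, hz2⟩ := h1 x.2
  have : z = x := Subtype.ext hz2
  rwa [← this]

/-- The base class. -/
def SimsBase (p u N : ℕ) : SimsClass u :=
  fun G _ g => Nat.card G = p ^ N ∧ Subgroup.closure (Set.range g) = ⊤

/-- The full class with its parameters. -/
def SimsFull (p m u N r n q : ℕ) : SimsClass (u + r + q) :=
  SimsChain p (fun G _ => (⊤ : Subgroup G)) (p ^ m) (p ^ m)
    (SimsChain p (fun G _ => commutator G) (p ^ m) (p ^ n) (SimsBase p u N) r) q

theorem sims_T_top (G H : Type) [Group G] [Group H] (e : G ≃* H) :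
    (⊤ : Subgroup G).map e.toMonoidHom = ⊤ := by
  rw [← MonoidHom.range_eq_map]
  exact MonoidHom.range_eq_top.2 e.surjective

theorem sims_T_comm (G H : Type) [Group G] [Group H] (e : G ≃* H) :
    (commutator G).map e.toMonoidHom = commutator H := by
  rw [commutator_def, commutator_def, Subgroup.map_commutator, sims_T_top]

theorem sims_full_cover (p : ℕ) [Fact p.Prime] (m u N r n q : ℕ) :
    SimsCover (SimsFull p m u N r n q)
      (p ^ ((u + 1) * (N * (N + 1)) + r * m + n * ∑ i ∈ Finset.range r, (u + i) + q * m +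
        m * ∑ i ∈ Finset.range q, (u + r + i))) := by
  have hpp : p.Prime := Fact.out
  have h1 : SimsCover (SimsBase p u N) _ := sims_cover_base p u N
  have h2 := sims_cover_chain hpp (fun G _ => commutator G) sims_T_comm (m := m) (n := n) h1 r
  exact sims_cover_chain hpp (fun G _ => (⊤ : Subgroup G)) sims_T_top (m := m) (n := m) h2 q

theorem sims_full_has {p : ℕ} [Fact p.Prime] {m k : ℕ} (hk : 1 ≤ k) (hmk : m ≤ k ^ 3)
    (G : Type) [Group G] (hG : Nat.card G = p ^ m) :
    ∃ N r n q : ℕ, N + r + q = m ∧ n ≤ N ∧ q ≤ 4 * (k + 1) * k ∧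
      SimsHas (SimsFull p m (k ^ 2 + 4 * k + 1 + 2 * ((k + 1) * (k + 1))) N r n q) G := by
  have hpp : p.Prime := Fact.out
  have hfin : Finite G := Nat.finite_of_card_ne_zero (by rw [hG]; exact (Nat.pow_pos hpp.pos).ne')
  have hpow : ∀ K : Subgroup G, ∃ c, c ≤ m ∧ Nat.card K = p ^ c := by
    intro K
    have h1 := Subgroup.card_subgroup_dvd_card K
    rw [hG] at h1
    exact (Nat.dvd_prime_pow hpp).1 h1
  obtain ⟨G0, hidx, U, hUc, hUG, hcomm⟩ := sims_reduction (p := p) (k + 1) m (k ^ 2 + 4 * k + 1)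
    (by nlinarith) k G (IsPGroup.of_card hG) hG.le (by
      obtain ⟨c, hc, hc2⟩ := hpow (commutator G)
      rw [hc2]
      exact Nat.pow_lt_pow_right hpp.one_lt (by nlinarith))
  set u := k ^ 2 + 4 * k + 1 + 2 * ((k + 1) * (k + 1)) with hu
  set H := Subgroup.closure (U : Set G) with hH
  have hHG0 : H ≤ G0 := (Subgroup.closure_le _).2 hUG
  obtain ⟨M, hMm, hM⟩ := hpow G0
  obtain ⟨N, hNm, hN⟩ := hpow H
  obtain ⟨n, hnm, hn⟩ := hpow ⁅G0, G0⁆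
  have hNM : N ≤ M := by
    have := Subgroup.card_dvd_of_le hHG0
    rw [hM, hN] at this
    exact (Nat.pow_dvd_pow_iff_le_right hpp.one_lt).1 this
  have hnN : n ≤ N := by
    have := Subgroup.card_dvd_of_le (hcomm.trans (Subgroup.commutator_le_self H))
    rw [hn, hN] at this
    exact (Nat.pow_dvd_pow_iff_le_right hpp.one_lt).1 this
  refine ⟨N, M - N, n, m - M, by omega, hnN, ?_, ?_⟩
  · have h1 := Subgroup.card_mul_index G0
    have h2 : p ^ m = p ^ M * p ^ (m - M) := by rw [← pow_add]; congr 1; omega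
    rw [hG, hM, h2] at h1
    have h3 := Nat.eq_of_mul_eq_mul_left (Nat.pow_pos hpp.pos) h1
    rw [h3] at hidx
    exact (Nat.pow_le_pow_iff_right hpp.one_lt).1 hidx
  obtain ⟨f, hf⟩ := sims_pad U u hUc
  have hb0 : SimsHas (SimsBase p u N) H :=
    ⟨f, hf, H, inferInstance, f, ⟨hN, hf⟩, MulEquiv.refl _, fun _ => rfl⟩
  have hb1 : SimsHas (SimsBase p u N) (H.subgroupOf G0) :=
    sims_has_congr hb0 (Subgroup.subgroupOfEquivOfLe hHG0).symm
  have hcard1 : Nat.card (H.subgroupOf G0) = p ^ N := by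
    rw [Nat.card_congr (Subgroup.subgroupOfEquivOfLe hHG0).toEquiv, hN]
  have hcardc : Nat.card (commutator G0) = p ^ n := by
    rw [← hn, ← Subgroup.map_subtype_commutator]
    exact Nat.card_congr ((commutator G0).equivMapOfInjective _ G0.subtype_injective).toEquiv
  have hcomm1 : commutator G0 ≤ ⁅H.subgroupOf G0, H.subgroupOf G0⁆ := by
    rw [← Subgroup.map_le_map_iff_of_injective G0.subtype_injective,
      Subgroup.map_subtype_commutator, Subgroup.map_commutator,
      Subgroup.map_subgroupOf_eq_of_le hHG0]
    exact hcomm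
  obtain ⟨A, -, hA1, hA2⟩ := sims_chain_up (X := G0) (m := m) (n := n) hM hMm (H.subgroupOf G0) hcard1
    (fun G _ => commutator G) sims_T_comm
    (by
      intro A hA
      rw [← hcardc, Nat.card_congr ((commutator A).equivMapOfInjective _
        A.subtype_injective).toEquiv, Subgroup.map_subtype_commutator]
      exact Subgroup.card_le_of_le (by
        rw [commutator_def]; exact Subgroup.commutator_mono le_top le_top))
    (by
      intro A hA y x hx _
      rw [Subgroup.map_subtype_commutator]
      apply Subgroup.commutator_mono hA hA
      apply hcomm1
      rw [commutator_def]
      exact Subgroup.commutator_mem_commutator trivial trivial)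
    _ hb1 (M - N) (by omega)
  have hAtop : A = ⊤ := by
    apply Subgroup.eq_top_of_card_eq
    rw [hA1, hM]; congr 1; omega
  subst hAtop
  have hb2 := sims_has_congr hA2 Subgroup.topEquiv
  obtain ⟨A, -, hA1, hA2⟩ := sims_chain_up (X := G) (m := m) (n := m) hG le_rfl G0 hM
    (fun G _ => (⊤ : Subgroup G)) sims_T_top
    (by
      intro A hA
      rw [← hG]
      exact (Nat.card_le_card_of_injective _ (Subtype.val_injective)).trans
        (Nat.card_le_card_of_injective _ (A.subtype_injective)))
    (by
      intro A hA y x hx h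
      exact ⟨⟨_, h⟩, trivial, rfl⟩)
    _ hb2 (m - M) (by omega)
  have hAtop : A = ⊤ := by
    apply Subgroup.eq_top_of_card_eq
    rw [hA1, hG]; congr 1; omega
  subst hAtop
  exact sims_has_congr hA2 Subgroup.topEquiv

end assembly

section final

theorem sims_num_le {n B : ℕ} (ι : Type) [Finite ι] (hB : Nat.card ι ≤ B) (A : ι → Type)
    (gr : ∀ i, Group (A i))
    (h : ∀ (G : Type) [Group G], Nat.card G = n → ∃ i, Nonempty (A i ≃* G)) :
    numGroups n (fun _ _ => True) ≤ B := by
  have htr : ∀ {α β γ : Type} (x : Group α) (y : Group β) (z : Group γ), GroupIsoOf x y →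
      GroupIsoOf x z → GroupIsoOf y z := by
    rintro α β γ x y z ⟨e1⟩ ⟨e2⟩
    exact ⟨e1.symm.trans e2⟩
  have h' : ∀ g : {g : Group (Fin n) // True}, ∃ i, GroupIsoOf (gr i) g.1 :=
    fun g => @h (Fin n) g.1 (by simp)
  choose f hf using h'
  refine le_trans ?_ hB
  unfold numGroups
  refine Nat.card_le_card_of_injective (fun q => f q.out) ?_
  intro q1 q2 hq
  rw [← Quot.out_eq q1, ← Quot.out_eq q2]
  apply Quot.sound
  have h2 := hf q2.out
  dsimp only at hq
  rw [← hq] at h2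
  exact htr _ _ _ (hf q1.out) h2

theorem sims_sum_bound (u r : ℕ) : 2 * ∑ i ∈ Finset.range r, (u + i) ≤ r * (2 * u + r) := by
  induction r with
  | zero => simp
  | succ r ih =>
    rw [Finset.sum_range_succ]
    nlinarith

theorem sims_exponent {m k u N r n q : ℕ} (hm : 1 ≤ m) (hk : 1 ≤ k) (h1 : N + r + q = m)
    (h2 : n ≤ N) (h3 : q ≤ 4 * (k + 1) * k)
    (hu : u = k ^ 2 + 4 * k + 1 + 2 * ((k + 1) * (k + 1))) :
    27 * ((u + 1) * (N * (N + 1)) + r * m + n * ∑ i ∈ Finset.range r, (u + i) + q * m +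
        m * ∑ i ∈ Finset.range q, (u + r + i)) ≤ 2 * m ^ 3 + 27 * (76 * k ^ 2 * m ^ 2) := by
  have hu2 : u ≤ 14 * k ^ 2 := by nlinarith
  have hq2 : q ≤ 8 * k ^ 2 := by nlinarith
  have hs1 := sims_sum_bound u r
  have hs2 := sims_sum_bound (u + r) q
  set s1 := ∑ i ∈ Finset.range r, (u + i)
  set s2 := ∑ i ∈ Finset.range q, (u + r + i)
  have hm2 : m ≤ m ^ 2 := by nlinarith
  have e1 : (u + 1) * (N * (N + 1)) ≤ (14 * k ^ 2 + k ^ 2) * (2 * m ^ 2) := by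
    apply Nat.mul_le_mul
    · nlinarith
    · calc N * (N + 1) ≤ m * (m + 1) := Nat.mul_le_mul (by omega) (by omega)
        _ ≤ 2 * m ^ 2 := by nlinarith
  have hkm : m ^ 2 ≤ k ^ 2 * m ^ 2 := Nat.le_mul_of_pos_left _ (by positivity)
  have e2 : r * m ≤ k ^ 2 * m ^ 2 := by
    calc r * m ≤ m * m := Nat.mul_le_mul_right _ (by omega)
      _ = m ^ 2 := by ring
      _ ≤ _ := hkm
  have e4 : q * m ≤ k ^ 2 * m ^ 2 := by
    calc q * m ≤ m * m := Nat.mul_le_mul_right _ (by omega)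
      _ = m ^ 2 := by ring
      _ ≤ _ := hkm
  have e3 : 27 * (n * s1) ≤ 2 * m ^ 3 + 27 * (14 * k ^ 2 * m ^ 2) := by
    have hA : 2 * (n * s1) ≤ n * r ^ 2 + 2 * (u * (n * r)) := by
      calc 2 * (n * s1) = n * (2 * s1) := by ring
        _ ≤ n * (r * (2 * u + r)) := Nat.mul_le_mul_left _ hs1
        _ = _ := by ring
    have hB : u * (n * r) ≤ 14 * k ^ 2 * m ^ 2 := by
      calc u * (n * r) ≤ 14 * k ^ 2 * (m * m) :=
            Nat.mul_le_mul hu2 (Nat.mul_le_mul (by omega) (by omega))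
        _ = _ := by ring
    have hC : 27 * (n * r ^ 2) ≤ 4 * m ^ 3 := by
      have hD : 27 * (n * r ^ 2) ≤ 4 * (n + r) ^ 3 := by
        zify
        have : 4 * ((n : ℤ) + r) ^ 3 - 27 * (n * r ^ 2) = (2 * n - r) ^ 2 * (n + 4 * r) := by ring
        have h0 : 0 ≤ (2 * (n : ℤ) - r) ^ 2 * (n + 4 * r) := by positivity
        linarith
      exact hD.trans (Nat.mul_le_mul_left _ (Nat.pow_le_pow_left (by omega) 3))
    linarith
  have e5 : m * s2 ≤ 30 * k ^ 2 * m ^ 2 := by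
    have hA : 2 * (m * s2) ≤ m * (q * (2 * (u + r) + q)) := by
      calc 2 * (m * s2) = m * (2 * s2) := by ring
        _ ≤ _ := Nat.mul_le_mul_left _ hs2
    have hB : q * (2 * (u + r) + q) ≤ 2 * (14 * k ^ 2 * m) + 2 * (8 * k ^ 2 * m) + 8 * k ^ 2 * m := by
      have b1 : q * u ≤ 14 * k ^ 2 * m := by
        rw [mul_comm]; exact Nat.mul_le_mul hu2 (by omega)
      have b2 : q * r ≤ 8 * k ^ 2 * m := Nat.mul_le_mul hq2 (by omega)
      have b3 : q * q ≤ 8 * k ^ 2 * m := Nat.mul_le_mul hq2 (by omega)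
      calc q * (2 * (u + r) + q) = 2 * (q * u) + 2 * (q * r) + q * q := by ring
        _ ≤ _ := by linarith
    have hC := Nat.mul_le_mul_left m hB
    nlinarith
  nlinarith

theorem sims_nat_bound {p m k : ℕ} [Fact p.Prime] (hm : 1 ≤ m) (hk : 1 ≤ k) (hmk : m ≤ k ^ 3) :
    ∃ E : ℕ, 27 * E ≤ 2 * m ^ 3 + 27 * (80 * k ^ 2 * m ^ 2) ∧
      numGroups (p ^ m) (fun _ _ => True) ≤ p ^ E := by
  classical
  have hpp : p.Prime := Fact.out
  set u := k ^ 2 + 4 * k + 1 + 2 * ((k + 1) * (k + 1)) with hu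
  let Q := Fin (m + 1) × Fin (m + 1) × Fin (m + 1) × Fin (m + 1)
  let V : Q → Prop := fun x => x.1.1 + x.2.1.1 + x.2.2.2.1 = m ∧ x.2.2.1.1 ≤ x.1.1 ∧
    x.2.2.2.1 ≤ 4 * (k + 1) * k
  set E0 := (2 * m ^ 3 + 27 * (76 * k ^ 2 * m ^ 2)) / 27 with hE0
  have hcov : ∀ x : {x : Q // V x}, ∃ (ι : Type) (A : ι → Type) (_ : ∀ i, Group (A i)), Finite ι ∧
      Nat.card ι ≤ p ^ E0 ∧ ∀ (G : Type) [Group G],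
        SimsHas (SimsFull p m u x.1.1.1 x.1.2.1.1 x.1.2.2.1.1 x.1.2.2.2.1) G →
          ∃ i, Nonempty (A i ≃* G) := by
    rintro ⟨⟨N, r, n, q⟩, hV1, hV2, hV3⟩
    dsimp only at hV1 hV2 hV3 ⊢
    obtain ⟨ι, A, gr, a, h1, h2, h3, h4⟩ := sims_full_cover p m u N.1 r.1 n.1 q.1
    refine ⟨ι, A, gr, h1, h2.trans (Nat.pow_le_pow_right hpp.pos ?_), ?_⟩
    · rw [hE0, Nat.le_div_iff_mul_le (by norm_num), mul_comm]
      exact sims_exponent hm hk hV1 hV2 hV3 hu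
    · rintro G _ ⟨g, -, A0, _, a0, hC, e, -⟩
      obtain ⟨i, e', -⟩ := h4 A0 a0 hC
      exact ⟨i, ⟨e'.trans e⟩⟩
  choose ι A gr hfin hcard hcov using hcov
  refine ⟨4 * m + E0, ?_, ?_⟩
  · have : 27 * E0 ≤ 2 * m ^ 3 + 27 * (76 * k ^ 2 * m ^ 2) := Nat.mul_div_le _ _
    have hkm : m ≤ k ^ 2 * m ^ 2 := by
      calc m ≤ m ^ 2 := by nlinarith
        _ ≤ _ := Nat.le_mul_of_pos_left _ (by positivity)
    nlinarith
  · refine sims_num_le (Σ x : {x : Q // V x}, ι x) ?_ (fun y => A y.1 y.2) (fun y => gr y.1 y.2) ?_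
    · rw [Nat.card_sigma]
      refine (Finset.sum_le_card_nsmul _ _ _ fun x _ => hcard x).trans ?_
      rw [smul_eq_mul, pow_add]
      refine Nat.mul_le_mul_right _ ?_
      have h1 : (Finset.univ : Finset {x : Q // V x}).card ≤ (m + 1) ^ 4 := by
        rw [Finset.card_univ]
        refine (Fintype.card_subtype_le V).trans (le_of_eq ?_)
        simp only [Q, Fintype.card_prod, Fintype.card_fin]
        ring
      refine h1.trans ?_
      rw [mul_comm 4 m, pow_mul]
      refine Nat.pow_le_pow_left ?_ 4
      exact (Nat.lt_two_pow_self (n := m)).trans_le (Nat.pow_le_pow_left hpp.two_le m)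
    · intro G _ hG
      obtain ⟨N, r, n, q, h1, h2, h3, h4⟩ := sims_full_has hk hmk G hG
      let x : {x : Q // V x} := ⟨⟨⟨N, by omega⟩, ⟨r, by omega⟩, ⟨n, by omega⟩, ⟨q, by omega⟩⟩,
        h1, h2, h3⟩
      obtain ⟨i, hi⟩ := hcov x G h4
      exact ⟨⟨x, i⟩, hi⟩

end final

/-- Sims.  There is a constant `C > 0` with
`f(p^m) ≤ p^{(2/27)m³ + C·m^{8/3}}` for every prime `p` and every `m`. -/
theorem sims_upper_bound :
    ∃ C : ℝ, 0 < C ∧ ∀ p m : ℕ, p.Prime →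
      (numGroups (p ^ m) (fun _ _ => True) : ℝ) ≤
        (p : ℝ) ^ ((2 / 27 : ℝ) * (m : ℝ) ^ 3 + C * (m : ℝ) ^ ((8 : ℝ) / 3)) := by
  refine ⟨320, by norm_num, fun p m hpp => ?_⟩
  have : Fact p.Prime := ⟨hpp⟩
  have hp1 : (1 : ℝ) ≤ p := by exact_mod_cast hpp.one_lt.le
  rcases Nat.eq_zero_or_pos m with rfl | hm
  · have h1 : numGroups (p ^ 0) (fun _ _ => True) ≤ 1 := by
      refine sims_num_le Unit (by simp) (fun _ => Unit) (fun _ => inferInstance) ?_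
      intro G _ hG
      rw [pow_zero, Nat.card_eq_one_iff_unique] at hG
      obtain ⟨h1, h2⟩ := hG
      let i0 : Inhabited G := ⟨1⟩
      let i1 : Unique G := Unique.mk' G
      exact ⟨(), ⟨MulEquiv.ofUnique (M := Unit) (N := G)⟩⟩
    calc (numGroups (p ^ 0) (fun _ _ => True) : ℝ) ≤ 1 := by exact_mod_cast h1
      _ ≤ _ := Real.one_le_rpow hp1 (by positivity)
  · have hm1 : (1 : ℝ) ≤ m := by exact_mod_cast hm
    set x : ℝ := (m : ℝ) ^ ((1 : ℝ) / 3) with hx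
    have hx1 : 1 ≤ x := Real.one_le_rpow hm1 (by norm_num)
    have hx3 : x ^ 3 = m := by
      rw [hx, ← Real.rpow_natCast, ← Real.rpow_mul (by positivity)]
      norm_num
    have hx8 : (m : ℝ) ^ ((8 : ℝ) / 3) = x ^ 8 := by
      rw [hx, ← Real.rpow_natCast, ← Real.rpow_mul (by positivity)]
      norm_num
    set k := ⌈x⌉₊ with hk
    have hk1 : x ≤ k := Nat.le_ceil x
    have hk2 : (k : ℝ) ≤ 2 * x := by
      have := (Nat.ceil_lt_add_one (by linarith : 0 ≤ x)).le
      linarith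
    have hk0 : 1 ≤ k := by
      have : (1 : ℝ) ≤ k := hx1.trans hk1
      exact_mod_cast this
    have hmk : m ≤ k ^ 3 := by
      have : (m : ℝ) ≤ (k : ℝ) ^ 3 := by
        rw [← hx3]; exact pow_le_pow_left₀ (by linarith) hk1 3
      exact_mod_cast this
    obtain ⟨E, hE, hnum⟩ := sims_nat_bound (p := p) hm hk0 hmk
    calc (numGroups (p ^ m) (fun _ _ => True) : ℝ) ≤ (p : ℝ) ^ E := by exact_mod_cast hnum
      _ = (p : ℝ) ^ (E : ℝ) := (Real.rpow_natCast _ _).symm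
      _ ≤ _ := by
        apply Real.rpow_le_rpow_of_exponent_le hp1
        have hE' : 27 * (E : ℝ) ≤ 2 * (m : ℝ) ^ 3 + 27 * (80 * (k : ℝ) ^ 2 * (m : ℝ) ^ 2) := by
          exact_mod_cast hE
        have hkk : (k : ℝ) ^ 2 ≤ 4 * x ^ 2 := by nlinarith
        have : (k : ℝ) ^ 2 * (m : ℝ) ^ 2 ≤ 4 * x ^ 8 := by
          calc (k : ℝ) ^ 2 * (m : ℝ) ^ 2 ≤ 4 * x ^ 2 * (m : ℝ) ^ 2 :=
                mul_le_mul_of_nonneg_right hkk (by positivity)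
            _ = 4 * x ^ 8 := by rw [← hx3]; ring
        rw [hx8]
        linarith
end
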